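/- If 24n ≡ 1 (mod 11^j) for some j ≥ 1, then p(n) ≡ 0 (mod 11^j), where p is the partition function. -/

import Mathlib

noncomputable def partp (n : ℕ) : ℕ := Fintype.card (Nat.Partition n)

open Complex Filter Topology
open UpperHalfPlane hiding I
open scoped Real Manifold MatrixGroups ModularForm

namespace RamanujanEleven

section

/-! ### The local ring of rational numbers with denominator prime to 11 -/

/-- The subring of `ℂ` of rational numbers whose denominator is prime to `11`. -/
def localRing : Subring ℂ where
  carrier := {x | ∃ d : ℤ, ¬ (11 : ℤ) ∣ d ∧ ∃ m : ℤ, (d : ℂ) * x = m}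
  mul_mem' := by
    rintro x y ⟨d, hd, m, hm⟩ ⟨e, he, k, hk⟩
    refine ⟨d * e, fun h ↦ ?_, m * k, ?_⟩
    · rcases (Int.Prime.dvd_mul' (p := 11) (by norm_num) h) with h | h
      exacts [hd h, he h]
    · push_cast; rw [← hm, ← hk]; ring
  one_mem' := ⟨1, by norm_num, 1, by simp⟩
  add_mem' := by
    rintro x y ⟨d, hd, m, hm⟩ ⟨e, he, k, hk⟩
    refine ⟨d * e, fun h ↦ ?_, m * e + k * d, ?_⟩
    · rcases (Int.Prime.dvd_mul' (p := 11) (by norm_num) h) with h | h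
      exacts [hd h, he h]
    · push_cast; rw [← hm, ← hk]; ring
  zero_mem' := ⟨1, by norm_num, 0, by simp⟩
  neg_mem' := by
    rintro x ⟨d, hd, m, hm⟩
    exact ⟨d, hd, -m, by push_cast; rw [← hm]; ring⟩

lemma intCast_mem_localRing (m : ℤ) : (m : ℂ) ∈ localRing := intCast_mem _ m

lemma natCast_mem_localRing (m : ℕ) : (m : ℂ) ∈ localRing := natCast_mem _ m

lemma mem_localRing_of_mul {d : ℤ} (hd : ¬ (11 : ℤ) ∣ d) {x : ℂ} (h : (d : ℂ) * x ∈ localRing) :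
    x ∈ localRing := by
  obtain ⟨e, he, m, hm⟩ := h
  refine ⟨e * d, fun h ↦ ?_, m, by push_cast; rw [← hm]; ring⟩
  rcases (Int.Prime.dvd_mul' (p := 11) (by norm_num) h) with h | h
  exacts [he h, hd h]

lemma inv_intCast_mem_localRing {d : ℤ} (hd : ¬ (11 : ℤ) ∣ d) : (d : ℂ)⁻¹ ∈ localRing := by
  refine mem_localRing_of_mul hd ?_
  have : (d : ℂ) ≠ 0 := by
    rintro h; apply hd; simp [Int.cast_eq_zero.mp h]
  rw [mul_inv_cancel₀ this]; exact localRing.one_mem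

lemma pow_dvd_of_eq_mul_localRing {m : ℤ} {x : ℂ} {k : ℕ} (hx : x ∈ localRing)
    (h : (m : ℂ) = 11 ^ k * x) : (11 : ℤ) ^ k ∣ m := by
  obtain ⟨d, hd, e, he⟩ := hx
  have h1 : d * m = 11 ^ k * e := by
    have : (d : ℂ) * m = 11 ^ k * e := by rw [h, ← he]; ring
    exact_mod_cast this
  have hc : IsCoprime ((11 : ℤ) ^ k) d := by
    apply IsCoprime.pow_left
    exact (Int.prime_iff_natAbs_prime.mpr (by norm_num)).irreducible.coprime_iff_not_dvd.mpr hd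
  exact hc.dvd_of_dvd_mul_left ⟨e, h1⟩

lemma zpow_mem_localRing {k : ℤ} (hk : 0 ≤ k) : (11 : ℂ) ^ k ∈ localRing := by
  lift k to ℕ using hk
  exact_mod_cast natCast_mem_localRing (11 ^ k)

/-! ### Laurent series -/

/-- Laurent series with coefficients in `localRing`. -/
def localSeries : Subring (LaurentSeries ℂ) where
  carrier := {A | ∀ n, A.coeff n ∈ localRing}
  mul_mem' := by
    intro A B hA hB n
    rw [HahnSeries.coeff_mul]
    exact sum_mem fun i _ ↦ mul_mem (hA _) (hB _)
  one_mem' := by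
    intro n
    rw [HahnSeries.coeff_one]
    split_ifs
    exacts [one_mem _, zero_mem _]
  add_mem' := by
    intro A B hA hB n
    exact add_mem (hA n) (hB n)
  zero_mem' := fun n ↦ zero_mem _
  neg_mem' := by
    intro A hA n
    exact neg_mem (hA n)

lemma mem_localSeries {A : LaurentSeries ℂ} : A ∈ localSeries ↔ ∀ n, A.coeff n ∈ localRing :=
  Iff.rfl

lemma smul_mem_localSeries {c : ℂ} (hc : c ∈ localRing) {A : LaurentSeries ℂ}
    (hA : A ∈ localSeries) : c • A ∈ localSeries := fun n ↦ by
  rw [HahnSeries.coeff_smul]; exact mul_mem hc (hA n)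

/-- The coefficients of `A` vanish below `d`. -/
def OrdGE (d : ℤ) (A : LaurentSeries ℂ) : Prop := ∀ n < d, A.coeff n = 0

lemma OrdGE.mono {d e : ℤ} (h : e ≤ d) {A : LaurentSeries ℂ} (hA : OrdGE d A) : OrdGE e A :=
  fun n hn ↦ hA n (hn.trans_le h)

lemma OrdGE.add {d : ℤ} {A B : LaurentSeries ℂ} (hA : OrdGE d A) (hB : OrdGE d B) :
    OrdGE d (A + B) := fun n hn ↦ by simp [hA n hn, hB n hn]

lemma OrdGE.sub {d : ℤ} {A B : LaurentSeries ℂ} (hA : OrdGE d A) (hB : OrdGE d B) :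
    OrdGE d (A - B) := fun n hn ↦ by simp [hA n hn, hB n hn]

lemma OrdGE.neg {d : ℤ} {A : LaurentSeries ℂ} (hA : OrdGE d A) :
    OrdGE d (-A) := fun n hn ↦ by simp [hA n hn]

lemma OrdGE.smul {d : ℤ} {A : LaurentSeries ℂ} (hA : OrdGE d A) (c : ℂ) :
    OrdGE d (c • A) := fun n hn ↦ by simp [hA n hn]

lemma OrdGE.zero (d : ℤ) : OrdGE d 0 := fun n _ ↦ by simp

lemma OrdGE.one : OrdGE 0 1 := fun n hn ↦ by
  rw [HahnSeries.coeff_one, if_neg hn.ne]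

lemma OrdGE.mul {d e : ℤ} {A B : LaurentSeries ℂ} (hA : OrdGE d A) (hB : OrdGE e B) :
    OrdGE (d + e) (A * B) := fun n hn ↦ by
  rw [HahnSeries.coeff_mul]
  refine Finset.sum_eq_zero fun i hi ↦ ?_
  rw [Finset.mem_antidiagonal] at hi
  rcases lt_or_ge i.1 d with h | h
  · rw [hA _ h, zero_mul]
  · rw [hB _ (by omega), mul_zero]

lemma coeff_mul_of_ordGE {d e : ℤ} {A B : LaurentSeries ℂ} (hA : OrdGE d A) (hB : OrdGE e B) :
    (A * B).coeff (d + e) = A.coeff d * B.coeff e := by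
  rw [HahnSeries.coeff_mul]
  rw [Finset.sum_eq_single (d, e)]
  · rintro ⟨i, j⟩ hi hne
    rw [Finset.mem_antidiagonal] at hi
    rcases lt_or_ge i d with h | h
    · rw [hA _ h, zero_mul]
    · rw [hB _ ?_, mul_zero]
      have h1 : i + j = d + e := hi.2.2
      have h2 : i ≠ d := by
        rintro rfl
        exact hne (by simp; omega)
      change j < e
      omega
  · intro h
    simp only [Finset.mem_antidiagonal, HahnSeries.mem_support, and_true, not_and_or,
      not_not] at h
    rcases h with h | h <;> simp [h]

/-- Multiply the `k`-th coefficient by `c k`. -/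
def hadamard (c : ℤ → ℂ) (A : LaurentSeries ℂ) : LaurentSeries ℂ where
  coeff k := c k * A.coeff k
  isPWO_support' := A.isPWO_support.mono fun k hk ↦ by
    simp only [Function.mem_support, ne_eq, mul_eq_zero, not_or] at hk
    exact hk.2

@[simp] lemma coeff_hadamard (c : ℤ → ℂ) (A : LaurentSeries ℂ) (k : ℤ) :
    (hadamard c A).coeff k = c k * A.coeff k := rfl

lemma hadamard_mem {c : ℤ → ℂ} (hc : ∀ k, c k ∈ localRing) {A : LaurentSeries ℂ}
    (hA : A ∈ localSeries) : hadamard c A ∈ localSeries :=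
  fun n ↦ mul_mem (hc n) (hA n)

lemma OrdGE.hadamard {d : ℤ} {A : LaurentSeries ℂ} (hA : OrdGE d A) (c : ℤ → ℂ) :
    OrdGE d (hadamard c A) := fun n hn ↦ by simp [hA n hn]

/-- Multiply every exponent by `11`. -/
noncomputable def vSeries (A : LaurentSeries ℂ) : LaurentSeries ℂ where
  coeff n := if (11 : ℤ) ∣ n then A.coeff (n / 11) else 0
  isPWO_support' := by
    apply (A.isPWO_support.image_of_monotone (f := fun n ↦ 11 * n)
      (fun _ _ _ ↦ by dsimp only; omega)).mono
    intro n hn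
    simp only [Function.mem_support, ne_eq, ite_eq_right_iff, Classical.not_imp] at hn
    exact ⟨n / 11, hn.2, by dsimp only; omega⟩

lemma coeff_vSeries (A : LaurentSeries ℂ) (n : ℤ) :
    (vSeries A).coeff n = if (11 : ℤ) ∣ n then A.coeff (n / 11) else 0 := rfl

@[simp] lemma coeff_vSeries_mul (A : LaurentSeries ℂ) (n : ℤ) :
    (vSeries A).coeff (11 * n) = A.coeff n := by
  rw [coeff_vSeries, if_pos (dvd_mul_right _ _)]; congr 1; omega

lemma vSeries_mem {A : LaurentSeries ℂ} (hA : A ∈ localSeries) : vSeries A ∈ localSeries :=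
  fun n ↦ by
    rw [coeff_vSeries]
    split_ifs
    exacts [hA _, zero_mem _]

lemma OrdGE.vSeries {d : ℤ} {A : LaurentSeries ℂ} (hA : OrdGE d A) :
    OrdGE (11 * d) (vSeries A) := fun n hn ↦ by
  rw [coeff_vSeries]
  split_ifs with h
  · exact hA _ (by omega)
  · rfl

/-- Keep the coefficients whose exponent is divisible by `11`, and divide these exponents by
`11`. -/
noncomputable def uSeries (A : LaurentSeries ℂ) : LaurentSeries ℂ where
  coeff n := A.coeff (11 * n)
  isPWO_support' := by
    apply (A.isPWO_support.image_of_monotone (f := fun n ↦ n / 11)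
      (fun _ _ _ ↦ by dsimp only; omega)).mono
    intro n hn
    exact ⟨11 * n, hn, by dsimp only; omega⟩

@[simp] lemma coeff_uSeries (A : LaurentSeries ℂ) (n : ℤ) :
    (uSeries A).coeff n = A.coeff (11 * n) := rfl

lemma uSeries_mem {A : LaurentSeries ℂ} (hA : A ∈ localSeries) : uSeries A ∈ localSeries :=
  fun _ ↦ hA _

lemma OrdGE.uSeries {d e : ℤ} {A : LaurentSeries ℂ} (hA : OrdGE d A) (h : 11 * e ≤ d + 10) :
    OrdGE e (uSeries A) := fun n hn ↦ hA _ (by omega)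

lemma exists_ordGE (A : LaurentSeries ℂ) : ∃ d : ℤ, OrdGE d A := by
  by_cases h : A = 0
  · exact ⟨0, h ▸ OrdGE.zero 0⟩
  · exact ⟨A.order, fun _ hn ↦ HahnSeries.coeff_eq_zero_of_lt_order hn⟩

end

section

/-! ### Maps of the upper half plane -/

/-- The nome `e^{2 π i τ}`. -/
noncomputable def nome (τ : ℍ) : ℂ := cexp (2 * π * I * τ)

/-- The map `τ ↦ 11 τ`. -/
noncomputable def elevenMul (τ : ℍ) : ℍ := ⟨11 * τ, by
  have := τ.im_pos
  simpa using this⟩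

/-- The map `τ ↦ (τ + b) / 11`. -/
noncomputable def divEleven (b : ℤ) (τ : ℍ) : ℍ := ⟨(τ + b) / 11, by
  have := τ.im_pos
  have h : ((τ : ℂ) + b) / 11 = ((11⁻¹ : ℝ) : ℂ) * (τ + b) := by push_cast; ring
  rw [h, im_ofReal_mul]
  simpa using this⟩

/-- The Fricke involution `τ ↦ -1 / (11 τ)`. -/
noncomputable def fricke (τ : ℍ) : ℍ := ⟨-1 / (11 * τ), by
  have := im_pnat_div_pos 1 (elevenMul τ)
  simpa [elevenMul] using this⟩

@[simp] lemma coe_elevenMul (τ : ℍ) : (elevenMul τ : ℂ) = 11 * τ := rfl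
@[simp] lemma coe_divEleven (b : ℤ) (τ : ℍ) : (divEleven b τ : ℂ) = (τ + b) / 11 := rfl
@[simp] lemma coe_fricke (τ : ℍ) : (fricke τ : ℂ) = -1 / (11 * τ) := rfl

lemma fricke_fricke (τ : ℍ) : fricke (fricke τ) = τ := by
  have := τ.ne_zero
  ext
  simp
  field_simp

lemma elevenMul_divEleven (b : ℤ) (τ : ℍ) : elevenMul (divEleven b τ) = (b : ℝ) +ᵥ τ := by
  ext; simp [coe_vadd]; ring

lemma elevenMul_divEleven_zero (τ : ℍ) : elevenMul (divEleven 0 τ) = τ := by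
  ext; simp; ring

lemma nome_ne_zero (τ : ℍ) : nome τ ≠ 0 := exp_ne_zero _

lemma norm_nome_lt_one (τ : ℍ) : ‖nome τ‖ < 1 := norm_exp_two_pi_I_lt_one τ

lemma nome_vadd (x : ℝ) (τ : ℍ) : nome (x +ᵥ τ) = cexp (2 * π * I * x) * nome τ := by
  rw [nome, nome, coe_vadd, ← Complex.exp_add]; ring_nf

lemma nome_vadd_int (x : ℤ) (τ : ℍ) : nome ((x : ℝ) +ᵥ τ) = nome τ := by
  rw [nome_vadd]
  have : cexp (2 * π * I * ((x : ℝ) : ℂ)) = 1 := by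
    rw [Complex.exp_eq_one_iff]; exact ⟨x, by push_cast; ring⟩
  rw [this, one_mul]

lemma nome_elevenMul (τ : ℍ) : nome (elevenMul τ) = nome τ ^ 11 := by
  rw [nome, nome, ← Complex.exp_nat_mul]; simp; ring_nf

lemma exists_nome_eq {z : ℂ} (h0 : z ≠ 0) (h1 : ‖z‖ < 1) : ∃ τ : ℍ, nome τ = z := by
  refine ⟨⟨_, Function.Periodic.im_invQParam_pos_of_norm_lt_one one_pos h1 h0⟩, ?_⟩
  have := Function.Periodic.qParam_right_inv one_ne_zero h0
  simpa [Function.Periodic.qParam, nome] using this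

/-! ### Laurent expansions at infinity -/

/-- `f` is the sum of the Laurent series `A` in the nome. -/
def IsExp (f : ℍ → ℂ) (A : LaurentSeries ℂ) : Prop :=
  ∀ τ, HasSum (fun n : ℤ ↦ A.coeff n * nome τ ^ n) (f τ)

lemma hasSum_coeff_mul (A B : LaurentSeries ℂ) (k : ℤ) :
    HasSum (fun i : ℤ ↦ A.coeff i * B.coeff (k - i)) ((A * B).coeff k) := by
  have hinj : Function.Injective (fun i : ℤ ↦ (i, k - i)) := fun a b h ↦ (Prod.ext_iff.mp h).1
  have h := hasSum_sum_of_ne_finset_zero (L := .unconditional (ℤ × ℤ))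
    (f := fun ij : ℤ × ℤ ↦ if ij.1 + ij.2 = k then A.coeff ij.1 * B.coeff ij.2 else 0)
    (s := Finset.antidiagonal A.isPWO_support B.isPWO_support k) (by
      intro ij hij
      simp only [Finset.mem_antidiagonal, HahnSeries.mem_support] at hij
      by_contra hne
      rw [ite_eq_right_iff, Classical.not_imp, mul_eq_zero, not_or] at hne
      exact hij ⟨hne.2.1, hne.2.2, hne.1⟩)
  rw [← hinj.hasSum_iff] at h
  · rw [HahnSeries.coeff_mul, ← Finset.sum_congr rfl (fun ij hij ↦ if_pos ?_)]
    · exact h.congr_fun fun i ↦ by simp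
    · exact (Finset.mem_antidiagonal.mp hij).2.2
  · rintro ⟨i, j⟩ hij
    rw [if_neg]
    rintro rfl
    exact hij ⟨i, by simp⟩

/-- Group pairs of integers according to their sum. -/
def fiberSumEquiv : (_ : ℤ) × ℤ ≃ ℤ × ℤ where
  toFun x := (x.2, x.1 - x.2)
  invFun y := ⟨y.1 + y.2, y.1⟩
  left_inv x := by simp
  right_inv y := by simp

namespace IsExp

variable {f g : ℍ → ℂ} {A B : LaurentSeries ℂ}

lemma add (hf : IsExp f A) (hg : IsExp g B) : IsExp (fun τ ↦ f τ + g τ) (A + B) := fun τ ↦ by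
  simpa [add_mul] using (hf τ).add (hg τ)

lemma neg (hf : IsExp f A) : IsExp (fun τ ↦ -f τ) (-A) := fun τ ↦ by
  simpa using (hf τ).neg

lemma sub (hf : IsExp f A) (hg : IsExp g B) : IsExp (fun τ ↦ f τ - g τ) (A - B) := fun τ ↦ by
  simpa [sub_mul] using (hf τ).sub (hg τ)

lemma const_mul (hf : IsExp f A) (c : ℂ) : IsExp (fun τ ↦ c * f τ) (c • A) := fun τ ↦ by
  simpa [mul_assoc] using (hf τ).mul_left c

lemma single (d : ℤ) : IsExp (fun τ ↦ nome τ ^ d) (HahnSeries.single d 1) := fun τ ↦ by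
  have := hasSum_ite_eq d (nome τ ^ d)
  refine this.congr_fun fun n ↦ ?_
  rw [HahnSeries.coeff_single]
  split_ifs with h <;> simp [h]

lemma one : IsExp (fun _ ↦ 1) 1 := by
  simpa using single 0

lemma const (c : ℂ) : IsExp (fun _ ↦ c) (c • 1) := by
  simpa using one.const_mul c

lemma zero : IsExp (fun _ ↦ 0) 0 := fun τ ↦ by
  simp [hasSum_zero]

lemma mul (hf : IsExp f A) (hg : IsExp g B) : IsExp (fun τ ↦ f τ * g τ) (A * B) := by
  intro τ
  have ha := summable_norm_iff.mpr (hf τ).summable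
  have hb := summable_norm_iff.mpr (hg τ).summable
  have h0 := summable_mul_of_summable_norm ha hb
  have h1 := HasSum.mul (f := fun n : ℤ ↦ A.coeff n * nome τ ^ n)
    (g := fun n : ℤ ↦ B.coeff n * nome τ ^ n) (hf τ) (hg τ) h0
  have h2 := fiberSumEquiv.hasSum_iff.mpr h1
  have h3 : ∀ k, HasSum (fun i : ℤ ↦ (A.coeff i * nome τ ^ i) *
      (B.coeff (k - i) * nome τ ^ (k - i))) ((A * B).coeff k * nome τ ^ k) := by
    intro k
    refine ((hasSum_coeff_mul A B k).mul_right (nome τ ^ k)).congr_fun fun i ↦ ?_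
    have : nome τ ^ k = nome τ ^ i * nome τ ^ (k - i) := by
      rw [← zpow_add₀ (nome_ne_zero τ)]; simp
    rw [this]
    ring
  exact h2.sigma h3

lemma pow (hf : IsExp f A) (n : ℕ) : IsExp (fun τ ↦ f τ ^ n) (A ^ n) := by
  induction n with
  | zero => simpa using one
  | succ n ih => simpa [pow_succ] using ih.mul hf

lemma sum {ι : Type*} (s : Finset ι) {f : ι → ℍ → ℂ} {A : ι → LaurentSeries ℂ}
    (h : ∀ i ∈ s, IsExp (f i) (A i)) : IsExp (fun τ ↦ ∑ i ∈ s, f i τ) (∑ i ∈ s, A i) := by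
  classical
  induction s using Finset.induction_on with
  | empty => simpa using zero
  | insert a s ha ih =>
    simp_rw [Finset.sum_insert ha]
    exact (h a (Finset.mem_insert_self a s)).add (ih fun i hi ↦ h i (Finset.mem_insert_of_mem hi))

lemma prod {ι : Type*} (s : Finset ι) {f : ι → ℍ → ℂ} {A : ι → LaurentSeries ℂ}
    (h : ∀ i ∈ s, IsExp (f i) (A i)) : IsExp (fun τ ↦ ∏ i ∈ s, f i τ) (∏ i ∈ s, A i) := by
  classical
  induction s using Finset.induction_on with
  | empty => simpa using one
  | insert a s ha ih =>
    simp_rw [Finset.prod_insert ha]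
    exact (h a (Finset.mem_insert_self a s)).mul (ih fun i hi ↦ h i (Finset.mem_insert_of_mem hi))

lemma comp_vadd (hf : IsExp f A) (x : ℝ) :
    IsExp (fun τ ↦ f (x +ᵥ τ)) (hadamard (fun k ↦ cexp (2 * π * I * x) ^ k) A) := fun τ ↦ by
  have := hf (x +ᵥ τ)
  refine this.congr_fun fun n ↦ ?_
  rw [nome_vadd, mul_zpow, coeff_hadamard]; ring

lemma comp_vadd_int (hf : IsExp f A) (x : ℤ) (τ : ℍ) : f ((x : ℝ) +ᵥ τ) = f τ := by
  have h := hf ((x : ℝ) +ᵥ τ)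
  rw [nome_vadd_int] at h
  exact h.unique (hf τ)

lemma comp_elevenMul (hf : IsExp f A) : IsExp (fun τ ↦ f (elevenMul τ)) (vSeries A) := fun τ ↦ by
  have h := hf (elevenMul τ)
  rw [nome_elevenMul] at h
  have hinj : Function.Injective (fun n : ℤ ↦ 11 * n) := fun a b h ↦ by simpa using h
  rw [← hinj.hasSum_iff]
  · refine h.congr_fun fun n ↦ ?_
    simp [zpow_mul]
  · intro n hn
    rw [coeff_vSeries, if_neg, zero_mul]
    rintro ⟨m, rfl⟩
    exact hn ⟨m, rfl⟩

/-- The power series obtained after dividing by a power of the nome. -/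
lemma hasSum_nat (hf : IsExp f A) {d : ℤ} (hd : OrdGE d A) (τ : ℍ) :
    HasSum (fun n : ℕ ↦ A.coeff (d + n) * nome τ ^ n) (f τ * nome τ ^ (-d)) := by
  have h := (hf τ).mul_right (nome τ ^ (-d))
  have hinj : Function.Injective (fun n : ℕ ↦ d + (n : ℤ)) := fun a b h ↦ by simpa using h
  rw [← hinj.hasSum_iff] at h
  · refine h.congr_fun fun n ↦ ?_
    dsimp only [Function.comp]
    rw [mul_assoc, ← zpow_add₀ (nome_ne_zero τ)]; simp
  · intro n hn
    rw [hd n, zero_mul, zero_mul]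
    by_contra h
    exact hn ⟨(n - d).toNat, by dsimp only; omega⟩

end IsExp

lemma hasFPowerSeriesOnBall_of_summable {c : ℕ → ℂ}
    (h : ∀ z : ℂ, ‖z‖ < 1 → Summable fun n ↦ c n * z ^ n) :
    HasFPowerSeriesOnBall (fun z ↦ ∑' n, c n * z ^ n) (.ofScalars ℂ c) 0 1 := by
  have hr : 1 ≤ (FormalMultilinearSeries.ofScalars ℂ c).radius := by
    refine ENNReal.le_of_forall_nnreal_lt fun r hr ↦ ?_
    apply FormalMultilinearSeries.le_radius_of_summable_norm
    have hr' : ‖((r : ℝ) : ℂ)‖ < 1 := by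
      simpa using (by exact_mod_cast hr : r < 1)
    refine (h _ hr').norm.congr fun n ↦ ?_
    rw [FormalMultilinearSeries.ofScalars_norm]
    simp
  have h1 := (FormalMultilinearSeries.hasFPowerSeriesOnBall _ (one_pos.trans_le hr)).mono
    one_pos hr
  refine h1.congr fun z hz ↦ ?_
  have := FormalMultilinearSeries.ofScalars_sum_eq (E := ℂ) c z
  simpa [FormalMultilinearSeries.ofScalarsSum] using this

namespace IsExp

variable {f g : ℍ → ℂ} {A B : LaurentSeries ℂ}

lemma summable_nat (hf : IsExp f A) {d : ℤ} (hd : OrdGE d A) (z : ℂ) (hz : ‖z‖ < 1) :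
    Summable fun n : ℕ ↦ A.coeff (d + n) * z ^ n := by
  rcases eq_or_ne z 0 with rfl | h0
  · apply summable_of_ne_finset_zero (s := {0})
    intro n hn
    rw [zero_pow (by simpa using hn), mul_zero]
  · obtain ⟨τ, rfl⟩ := exists_nome_eq h0 hz
    exact (hf.hasSum_nat hd τ).summable

lemma exists_differentiableOn (hf : IsExp f A) {d : ℤ} (hd : OrdGE d A) :
    ∃ G : ℂ → ℂ, DifferentiableOn ℂ G (Metric.ball 0 1) ∧ G 0 = A.coeff d ∧
      ∀ τ, f τ = nome τ ^ d * G (nome τ) := by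
  refine ⟨fun z ↦ ∑' n : ℕ, A.coeff (d + n) * z ^ n, ?_, ?_, fun τ ↦ ?_⟩
  · have := (hasFPowerSeriesOnBall_of_summable (hf.summable_nat hd)).differentiableOn
    rwa [← ENNReal.coe_one, Metric.eball_coe] at this
  · dsimp only
    rw [tsum_eq_single 0]
    · simp
    · intro n hn
      rw [zero_pow hn, mul_zero]
  · dsimp only
    rw [(hf.hasSum_nat hd τ).tsum_eq, mul_comm, mul_assoc, ← zpow_add₀ (nome_ne_zero τ)]
    simp

end IsExp

/-- A function which is holomorphic in the nome has a power series expansion. -/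
lemma exists_isExp_of_differentiableOn {G : ℂ → ℂ}
    (hG : DifferentiableOn ℂ G (Metric.ball 0 1)) :
    ∃ A : LaurentSeries ℂ, OrdGE 0 A ∧ A.coeff 0 = G 0 ∧ IsExp (fun τ ↦ G (nome τ)) A := by
  have h12 : (0 : NNReal) < 1 / 2 := by norm_num
  let p := cauchyPowerSeries G 0 ((1 / 2 : NNReal) : ℝ)
  have hp : ∀ r : NNReal, 0 < r → r < 1 → HasFPowerSeriesOnBall G p 0 r := by
    intro r h0 h1
    have hd : ∀ s : NNReal, s < 1 → DifferentiableOn ℂ G (Metric.closedBall 0 s) := fun s hs ↦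
      hG.mono (Metric.closedBall_subset_ball (by exact_mod_cast hs))
    have h2 := (hd r h1).hasFPowerSeriesOnBall h0
    have h3 := (hd (1 / 2) (by
      rw [← NNReal.coe_lt_coe]; norm_num)).hasFPowerSeriesOnBall h12
    rwa [h2.hasFPowerSeriesAt.eq_formalMultilinearSeries h3.hasFPowerSeriesAt] at h2
  have hs : ∀ z : ℂ, ‖z‖ < 1 → HasSum (fun n : ℕ ↦ p.coeff n * z ^ n) (G z) := by
    intro z hz
    obtain ⟨r, hr1, hr2⟩ := exists_between hz
    have hr0 : 0 < r := (norm_nonneg z).trans_lt hr1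
    lift r to NNReal using hr0.le
    have := (hp r (by exact_mod_cast hr0) (by exact_mod_cast hr2)).hasSum (y := z) (by
      rw [Metric.eball_coe]; simpa using hr1)
    rw [zero_add] at this
    refine this.congr_fun fun n ↦ ?_
    rw [FormalMultilinearSeries.apply_eq_pow_smul_coeff, smul_eq_mul, mul_comm]
  refine ⟨HahnSeries.ofPowerSeries ℤ ℂ (PowerSeries.mk p.coeff), ?_, ?_, fun τ ↦ ?_⟩
  · intro n hn
    rw [PowerSeries.coeff_coe, if_pos hn]
  · have h0 := hs 0 (by simp)
    have h1 := hasSum_ite_eq (0 : ℕ) (p.coeff 0)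
    have : G 0 = p.coeff 0 := by
      refine h0.unique (h1.congr_fun fun n ↦ ?_)
      split_ifs with h <;> simp [h]
    rw [this, PowerSeries.coeff_coe]
    simp
  · have h := hs _ (norm_nome_lt_one τ)
    have hinj : Function.Injective (fun n : ℕ ↦ (n : ℤ)) := fun a b h ↦ by simpa using h
    rw [← hinj.hasSum_iff]
    · refine h.congr_fun fun n ↦ ?_
      simp
    · intro n hn
      rw [PowerSeries.coeff_coe, if_pos, zero_mul]
      by_contra h0
      exact hn ⟨n.toNat, by dsimp only; omega⟩

end

section

namespace IsExp

variable {f g : ℍ → ℂ} {A B : LaurentSeries ℂ}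

lemma eq_zero (h : IsExp (fun _ ↦ 0) A) : A = 0 := by
  by_contra hA
  obtain ⟨G, hG, hG0, hG1⟩ := h.exists_differentiableOn
    (d := A.order) (fun n hn ↦ HahnSeries.coeff_eq_zero_of_lt_order hn)
  have h1 : ∀ z, z ≠ 0 → ‖z‖ < 1 → G z = 0 := by
    intro z h0 h1
    obtain ⟨τ, rfl⟩ := exists_nome_eq h0 h1
    have := hG1 τ
    rw [eq_comm, mul_eq_zero] at this
    exact this.resolve_left (zpow_ne_zero _ h0)
  have hc : ContinuousAt G 0 := (hG.differentiableAt (Metric.ball_mem_nhds 0 one_pos)).continuousAt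
  have h2 : G =ᶠ[𝓝[≠] 0] fun _ ↦ 0 := by
    filter_upwards [self_mem_nhdsWithin, mem_nhdsWithin_of_mem_nhds
      (Metric.ball_mem_nhds (0 : ℂ) one_pos)] with z hz hz1
    exact h1 z hz (by simpa using hz1)
  have h3 : G 0 = 0 := tendsto_nhds_unique (hc.tendsto.mono_left nhdsWithin_le_nhds)
    (tendsto_const_nhds.congr' h2.symm)
  rw [hG0] at h3
  exact HahnSeries.coeff_order_eq_zero.not.mpr hA h3

lemma unique (hf : IsExp f A) (hg : IsExp f B) : A = B := by
  have := hf.sub hg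
  simp only [sub_self] at this
  exact sub_eq_zero.mp this.eq_zero

lemma congr (hf : IsExp f A) (h : ∀ τ, g τ = f τ) : IsExp g A := by
  rwa [funext h]

lemma eq_of_series (hf : IsExp f A) (hg : IsExp g A) (τ : ℍ) : f τ = g τ :=
  (hf τ).unique (hg τ)

lemma ne_zero (hf : IsExp f A) (τ : ℍ) (h : f τ ≠ 0) : A ≠ 0 := by
  rintro rfl
  exact h (hf.eq_of_series zero τ)

lemma inv (hf : IsExp f A) (h0 : ∀ τ, f τ ≠ 0) : IsExp (fun τ ↦ (f τ)⁻¹) A⁻¹ := by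
  have hA : A ≠ 0 := hf.ne_zero UpperHalfPlane.I (h0 _)
  obtain ⟨G, hG, hG0, hG1⟩ := hf.exists_differentiableOn
    (d := A.order) (fun n hn ↦ HahnSeries.coeff_eq_zero_of_lt_order hn)
  have h1 : ∀ z ∈ Metric.ball (0 : ℂ) 1, G z ≠ 0 := by
    intro z hz
    rcases eq_or_ne z 0 with rfl | hz0
    · rw [hG0]; exact HahnSeries.coeff_order_eq_zero.not.mpr hA
    · obtain ⟨τ, rfl⟩ := exists_nome_eq hz0 (by simpa using hz)
      intro h
      apply h0 τ
      rw [hG1, h, mul_zero]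
  obtain ⟨B, -, -, hB⟩ := exists_isExp_of_differentiableOn (hG.inv h1)
  have h2 : IsExp (fun τ ↦ (f τ)⁻¹) (HahnSeries.single (-A.order) 1 * B) :=
    ((single (-A.order)).mul hB).congr fun τ ↦ by
      rw [hG1 τ, mul_inv, zpow_neg]; rfl
  have h3 : A * (HahnSeries.single (-A.order) 1 * B) = 1 :=
    (hf.mul h2).unique (one.congr fun τ ↦ mul_inv_cancel₀ (h0 τ))
  rwa [eq_inv_of_mul_eq_one_right h3] at h2

lemma zpow (hf : IsExp f A) (h0 : ∀ τ, f τ ≠ 0) (n : ℤ) : IsExp (fun τ ↦ f τ ^ n) (A ^ n) := by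
  cases n with
  | ofNat n => simpa using hf.pow n
  | negSucc n => simpa [zpow_negSucc] using (hf.inv h0).pow (n + 1)

lemma div (hf : IsExp f A) (hg : IsExp g B) (h0 : ∀ τ, g τ ≠ 0) :
    IsExp (fun τ ↦ f τ / g τ) (A / B) := by
  simpa [div_eq_mul_inv] using hf.mul (hg.inv h0)

lemma mdifferentiable (hf : IsExp f A) : MDiff f := by
  obtain ⟨d, hd⟩ := exists_ordGE A
  obtain ⟨G, hG, -, hG1⟩ := hf.exists_differentiableOn hd
  rw [mdifferentiable_iff]
  have h1 : DifferentiableOn ℂ (fun z ↦ cexp (2 * π * I * z) ^ d * G (cexp (2 * π * I * z)))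
      {z | 0 < z.im} := by
    intro z hz
    have hn : cexp (2 * π * I * z) ∈ Metric.ball (0 : ℂ) 1 := by
      simpa using norm_exp_two_pi_I_lt_one ⟨z, hz⟩
    have he : DifferentiableAt ℂ (fun z ↦ cexp (2 * π * I * z)) z := by fun_prop
    refine DifferentiableAt.differentiableWithinAt (DifferentiableAt.mul ?_ ?_)
    · exact he.zpow (Or.inl (exp_ne_zero _))
    · exact DifferentiableAt.comp z
        (hG.differentiableAt (Metric.isOpen_ball.mem_nhds hn)) he
  refine h1.congr fun z hz ↦ ?_
  rw [Function.comp_apply, ofComplex_apply_of_im_pos hz, hG1]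
  rfl

lemma continuous (hf : IsExp f A) : Continuous f := hf.mdifferentiable.continuous

lemma isBoundedAtImInfty (hf : IsExp f A) (h : OrdGE 0 A) : IsBoundedAtImInfty f := by
  refine isBoundedAtImInfty_of_hasSum_qExpansion (h := 1) (c := fun n ↦ A.coeff n) one_pos
    fun τ ↦ ?_
  have := hf.hasSum_nat h τ
  simpa [Function.Periodic.qParam, nome] using this

end IsExp

/-! ### The operator `U` -/

/-- The additive character `x ↦ e^{2 π i x / 11}`. -/
noncomputable abbrev psi : AddChar (ZMod 11) ℂ := ZMod.stdAddChar

/-- The translation by `b / 11`. -/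
noncomputable def shiftEleven (b : ZMod 11) (τ : ℍ) : ℍ := ((b.val / 11 : ℝ)) +ᵥ τ

/-- The point `(τ + b) / 11`. -/
noncomputable def cosetPt (b : ZMod 11) (τ : ℍ) : ℍ := divEleven b.val τ

lemma cosetPt_elevenMul (b : ZMod 11) (τ : ℍ) : cosetPt b (elevenMul τ) = shiftEleven b τ := by
  ext; simp only [cosetPt, shiftEleven, coe_divEleven, coe_elevenMul, coe_vadd]; push_cast; ring

lemma psi_apply (b : ZMod 11) : psi b = cexp (2 * π * I * ((b.val / 11 : ℝ) : ℂ)) := by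
  conv_lhs => rw [← ZMod.natCast_zmod_val b]
  have := ZMod.stdAddChar_coe (N := 11) b.val
  rw [Int.cast_natCast] at this
  rw [this]
  congr 1
  push_cast
  ring

lemma psi_mul_int (b : ZMod 11) (k : ℤ) : psi (b * k) = psi b ^ k := by
  rw [← AddChar.map_zsmul_eq_zpow, zsmul_eq_mul, mul_comm]

lemma IsExp.comp_shiftEleven {f : ℍ → ℂ} {A : LaurentSeries ℂ} (hf : IsExp f A) (b : ZMod 11) :
    IsExp (fun τ ↦ f (shiftEleven b τ)) (hadamard (fun k ↦ psi (b * k)) A) := by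
  have := hf.comp_vadd (b.val / 11 : ℝ)
  simp_rw [psi_mul_int, psi_apply]
  exact this

lemma IsExp.sum_shiftEleven {f : ℍ → ℂ} {A : LaurentSeries ℂ} (hf : IsExp f A)
    (c : ZMod 11 → ℂ) :
    IsExp (fun τ ↦ ∑ b, c b * f (shiftEleven b τ))
      (hadamard (fun k ↦ ∑ b, c b * psi (b * k)) A) := by
  have h := IsExp.sum Finset.univ fun b _ ↦ (hf.comp_shiftEleven b).const_mul (c b)
  convert h using 1
  ext k
  simp [HahnSeries.coeff_sum, Finset.sum_mul, mul_assoc]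

lemma sum_psi (k : ℤ) : ∑ b : ZMod 11, psi (b * k) = if (11 : ℤ) ∣ k then 11 else 0 := by
  have h := AddChar.sum_mulShift (k : ZMod 11) (ZMod.isPrimitive_stdAddChar 11)
  have h1 := ZMod.intCast_zmod_eq_zero_iff_dvd k 11
  push_cast at h1
  simp only [h, h1]
  split_ifs <;> simp [ZMod.card]

/-- The operator `U`. -/
noncomputable def uOp (f : ℍ → ℂ) (τ : ℍ) : ℂ := 11⁻¹ * ∑ b, f (cosetPt b τ)

lemma isExp_of_comp_elevenMul {f : ℍ → ℂ} {A B : LaurentSeries ℂ}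
    (h : IsExp (fun τ ↦ f (elevenMul τ)) B) (hB : B = vSeries A) : IsExp f A := by
  intro τ
  have h1 := h (divEleven 0 τ)
  dsimp only at h1
  rw [elevenMul_divEleven_zero] at h1
  have hinj : Function.Injective (fun n : ℤ ↦ 11 * n) := fun a b h ↦ by simpa using h
  rw [← hinj.hasSum_iff] at h1
  · refine h1.congr_fun fun n ↦ ?_
    have : nome τ = nome (divEleven 0 τ) ^ 11 := by
      rw [← nome_elevenMul, elevenMul_divEleven_zero]
    rw [this]
    simp [zpow_mul, hB]
  · intro n hn
    rw [hB, coeff_vSeries, if_neg, zero_mul]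
    rintro ⟨m, rfl⟩
    exact hn ⟨m, rfl⟩

lemma vSeries_uSeries (A : LaurentSeries ℂ) :
    vSeries (uSeries A) = hadamard (fun k ↦ if (11 : ℤ) ∣ k then 1 else 0) A := by
  ext k
  rw [coeff_vSeries, coeff_hadamard, coeff_uSeries]
  split_ifs with h
  · rw [Int.mul_ediv_cancel' h, one_mul]
  · rw [zero_mul]

lemma IsExp.uOp {f : ℍ → ℂ} {A : LaurentSeries ℂ} (hf : IsExp f A) :
    IsExp (uOp f) (uSeries A) := by
  refine isExp_of_comp_elevenMul ?_ rfl
  have h := (hf.sum_shiftEleven fun _ ↦ 1).const_mul 11⁻¹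
  convert h using 1
  · ext τ
    simp [RamanujanEleven.uOp, cosetPt_elevenMul]
  · rw [vSeries_uSeries]
    ext k
    simp only [coeff_hadamard, one_mul, HahnSeries.coeff_smul, sum_psi, smul_eq_mul]
    split_ifs <;> simp

end

section

/-! ### Group actions -/

/-- The element of `SL(2, ℤ)` with the given entries. -/
def slMk (a b c d : ℤ) (h : a * d - b * c = 1) : SL(2, ℤ) :=
  ⟨!![a, b; c, d], by rw [Matrix.det_fin_two_of, h]⟩

lemma sl_det (γ : SL(2, ℤ)) : γ 0 0 * γ 1 1 - γ 0 1 * γ 1 0 = 1 := by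
  rw [← Matrix.det_fin_two, Matrix.SpecialLinearGroup.det_coe]

lemma coe_sl_smul (γ : SL(2, ℤ)) (τ : ℍ) :
    (↑(γ • τ) : ℂ) = (γ 0 0 * τ + γ 0 1) / (γ 1 0 * τ + γ 1 1) := by
  rw [coe_specialLinearGroup_apply]; simp

lemma sl_denom_ne_zero (γ : SL(2, ℤ)) (τ : ℍ) : (γ 1 0 * τ + γ 1 1 : ℂ) ≠ 0 := by
  have := denom_ne_zero γ τ
  rwa [ModularGroup.denom_apply] at this

lemma coe_slMk_smul (a b c d : ℤ) (h : a * d - b * c = 1) (τ : ℍ) :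
    (↑(slMk a b c d h • τ) : ℂ) = (a * τ + b) / (c * τ + d) := by
  rw [coe_sl_smul]; rfl

lemma slMk_denom_ne_zero {a b c d : ℤ} (h : a * d - b * c = 1) (τ : ℍ) :
    (c * τ + d : ℂ) ≠ 0 := sl_denom_ne_zero (slMk a b c d h) τ

lemma discriminant_smul (γ : SL(2, ℤ)) (τ : ℍ) :
    CuspForm.discriminant (γ • τ) = (γ 1 0 * τ + γ 1 1 : ℂ) ^ 12 * CuspForm.discriminant τ := by
  have := SlashInvariantForm.slash_action_eqn'' (Γ := 𝒮ℒ) (k := 12) CuspForm.discriminant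
    (γ := γ) ⟨γ, rfl⟩ τ
  have h2 := ModularGroup.denom_apply γ τ
  rw [← h2]
  exact_mod_cast this

lemma slMk_mem_Gamma0 {N : ℕ} {a b c d : ℤ} {h : a * d - b * c = 1} :
    slMk a b c d h ∈ CongruenceSubgroup.Gamma0 N ↔ (N : ℤ) ∣ c := by
  rw [CongruenceSubgroup.Gamma0_mem, ← ZMod.intCast_zmod_eq_zero_iff_dvd]; rfl

lemma mem_Gamma0_iff {N : ℕ} {γ : SL(2, ℤ)} :
    γ ∈ CongruenceSubgroup.Gamma0 N ↔ (N : ℤ) ∣ γ 1 0 := by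
  rw [CongruenceSubgroup.Gamma0_mem, ← ZMod.intCast_zmod_eq_zero_iff_dvd]

instance : Fact (Nat.Prime 11) := ⟨by norm_num⟩

lemma exists_cosetPt_smul {γ : SL(2, ℤ)} (hγ : γ ∈ CongruenceSubgroup.Gamma0 11) :
    ∃ (σ : Equiv.Perm (ZMod 11)) (δ : ZMod 11 → SL(2, ℤ)), σ 0 = γ 0 1 * γ 1 1 ∧
      ∀ j, δ j ∈ CongruenceSubgroup.Gamma0 121 ∧
        ∀ τ, cosetPt j (γ • τ) = δ j • cosetPt (σ j) τ := by
  have hdet := sl_det γ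
  have hc : (γ 1 0 : ZMod 11) = 0 := CongruenceSubgroup.Gamma0_mem.mp hγ
  have hdet' : (γ 0 0 : ZMod 11) * γ 1 1 = 1 := by
    have := congrArg (Int.cast : ℤ → ZMod 11) hdet
    push_cast at this
    rwa [hc, mul_zero, sub_zero] at this
  have hd : (γ 1 1 : ZMod 11) ≠ 0 := right_ne_zero_of_mul_eq_one hdet'
  let f : ZMod 11 → ZMod 11 := fun j ↦ (γ 0 1 + j * γ 1 1) * γ 1 1
  have hf : Function.Injective f := fun i j hij ↦ by
    have := mul_right_cancel₀ hd hij
    exact mul_right_cancel₀ hd (add_left_cancel this)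
  let σ : Equiv.Perm (ZMod 11) := Equiv.ofBijective f (Finite.injective_iff_bijective.mp hf)
  have key : ∀ j : ZMod 11, ∃ δ : SL(2, ℤ), δ ∈ CongruenceSubgroup.Gamma0 121 ∧
      ∀ τ, cosetPt j (γ • τ) = δ • cosetPt (σ j) τ := by
    intro j
    obtain ⟨k, hk⟩ : (11 : ℤ) ∣ γ 1 0 := mem_Gamma0_iff.mp hγ
    obtain ⟨m, hm⟩ : (11 : ℤ) ∣
        γ 0 1 + j.val * γ 1 1 - (σ j).val * (γ 0 0 + j.val * γ 1 0) := by
      rw [← Nat.cast_ofNat, ← ZMod.intCast_zmod_eq_zero_iff_dvd]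
      push_cast
      rw [ZMod.natCast_zmod_val, ZMod.natCast_zmod_val, hc]
      change (γ 0 1 + j * γ 1 1 : ZMod 11) - (γ 0 1 + j * γ 1 1) * γ 1 1 * (γ 0 0 + j * 0) = 0
      linear_combination -(γ 0 1 + j * γ 1 1 : ZMod 11) * hdet'
    have hδ : (γ 0 0 + j.val * γ 1 0) * (γ 1 1 - γ 1 0 * (σ j).val) - m * (11 * γ 1 0) = 1 := by
      linear_combination hdet + hm * γ 1 0
    refine ⟨slMk _ _ _ _ hδ, slMk_mem_Gamma0.mpr ⟨k, by rw [hk]; push_cast; ring⟩, fun τ ↦ ?_⟩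
    have h1 := slMk_denom_ne_zero hδ (cosetPt (σ j) τ)
    have h2 := sl_denom_ne_zero γ τ
    ext
    rw [coe_slMk_smul]
    simp only [cosetPt, coe_divEleven, coe_sl_smul] at h1 ⊢
    rw [div_eq_div_iff (by norm_num) h1, div_add' _ _ _ h2, div_mul_eq_mul_div,
      div_eq_iff h2]
    have hm' := congrArg (Int.cast : ℤ → ℂ) hm
    push_cast at hm' ⊢
    have : (m : ℂ) = ((γ 0 1 : ℂ) + j.val * γ 1 1 - (σ j).val * (γ 0 0 + j.val * γ 1 0)) / 11 := by
      rw [hm']; ring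
    rw [this]
    ring
  choose δ hδ using key
  refine ⟨σ, δ, ?_, hδ⟩
  change (γ 0 1 + 0 * γ 1 1 : ZMod 11) * γ 1 1 = _
  ring

/-- Invariance under `Γ₀(N)`. -/
def IsInv (N : ℕ) (f : ℍ → ℂ) : Prop :=
  ∀ γ ∈ CongruenceSubgroup.Gamma0 N, ∀ τ, f (γ • τ) = f τ

lemma IsInv.mono {M N : ℕ} (h : M ∣ N) {f : ℍ → ℂ} (hf : IsInv M f) : IsInv N f :=
  fun γ hγ ↦ hf γ <| by
    rw [mem_Gamma0_iff] at hγ ⊢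
    exact (Int.natCast_dvd_natCast.mpr h).trans hγ

/-- A symmetric function of the values at the points `(τ + b) / 11` of a function that is
invariant under `Γ₀(121)` is invariant under `Γ₀(11)`. -/
lemma IsInv.symm_cosetPt {f : ℍ → ℂ} (hf : IsInv 121 f) {F : (ZMod 11 → ℂ) → ℂ}
    (hF : ∀ (σ : Equiv.Perm (ZMod 11)) x, F (x ∘ σ) = F x) :
    IsInv 11 fun τ ↦ F fun b ↦ f (cosetPt b τ) := fun γ hγ τ ↦ by
  obtain ⟨σ, δ, -, h⟩ := exists_cosetPt_smul hγ
  have : (fun b ↦ f (cosetPt b (γ • τ))) = (fun b ↦ f (cosetPt b τ)) ∘ σ := by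
    ext b
    rw [(h b).2, hf _ (h b).1]; rfl
  dsimp only
  rw [this, hF]

lemma IsInv.uOp {f : ℍ → ℂ} (hf : IsInv 121 f) : IsInv 11 (uOp f) :=
  hf.symm_cosetPt (F := fun x ↦ 11⁻¹ * ∑ b, x b) fun σ x ↦ by
    simp [Equiv.sum_comp σ x]

end

section

/-! ### The Euler product -/

lemma norm_prod_one_sub_pow_le {q : ℂ} (hq : ‖q‖ < 1) (k n : ℕ) :
    ‖∏ i ∈ Finset.range n, (1 - q ^ (k + i + 1))‖ ≤ Real.exp (1 - ‖q‖)⁻¹ := by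
  rw [norm_prod]
  calc ∏ i ∈ Finset.range n, ‖1 - q ^ (k + i + 1)‖
      ≤ ∏ i ∈ Finset.range n, (1 + ‖q‖ ^ i) := by
        refine Finset.prod_le_prod (fun _ _ ↦ norm_nonneg _) fun i _ ↦ ?_
        refine (norm_sub_le _ _).trans ?_
        rw [norm_one, norm_pow]
        gcongr 1 + ?_
        exact pow_le_pow_of_le_one (norm_nonneg _) hq.le (by omega)
    _ ≤ Real.exp (∑ i ∈ Finset.range n, ‖q‖ ^ i) :=
        Real.prod_one_add_le_exp_sum _ fun _ ↦ by positivity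
    _ ≤ _ := by
        rw [← tsum_geometric_of_lt_one (norm_nonneg _) hq]
        gcongr
        exact (summable_geometric_of_lt_one (norm_nonneg _) hq).sum_le_tsum _
          fun _ _ ↦ by positivity

lemma norm_pow_mul_prod_le {q : ℂ} (hq : ‖q‖ < 1) (k n : ℕ) :
    ‖q ^ ((k + 1) * n) * ∏ i ∈ Finset.range (n + 1), (1 - q ^ (k + i + 1))‖ ≤
      ‖q‖ ^ n * Real.exp (1 - ‖q‖)⁻¹ := by
  rw [norm_mul, norm_pow]
  exact mul_le_mul (pow_le_pow_of_le_one (norm_nonneg _) hq.le (by nlinarith))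
    (norm_prod_one_sub_pow_le hq k _) (norm_nonneg _) (by positivity)

lemma hasSum_pentagonal {q : ℂ} (hq : ‖q‖ < 1) :
    HasSum (fun k : ℤ ↦ (Int.negOnePow k : ℂ) * q ^ pentagonal k) (∏' n, (1 - q ^ (n + 1))) := by
  have hg := summable_geometric_of_lt_one (norm_nonneg _) hq
  have hgC := hg.mul_right (Real.exp (1 - ‖q‖)⁻¹)
  have hs : Summable fun k : ℤ ↦ (Int.negOnePow k : ℂ) * q ^ pentagonal k := by
    refine Summable.of_norm_bounded (hg.comp_injective pentagonal_injective) fun k ↦ ?_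
    rw [norm_mul, norm_pow, Function.comp_apply]
    rcases Int.even_or_odd k with hk | hk <;> simp [Int.negOnePow_even, Int.negOnePow_odd, hk]
  have h2 := hs.hasSum
  rw [← neg_injective.hasSum_iff (fun x hx ↦ by absurd hx; use -x; simp)] at h2
  have h3 : HasSum (fun k : ℕ ↦ (-1 : ℂ) ^ k * (q ^ pentagonal (-k) - q ^ pentagonal (k + 1)))
      (∑' k : ℤ, (Int.negOnePow k : ℂ) * q ^ pentagonal k) := by
    convert h2.nat_add_neg_add_one using 2 with k
    simp_rw [Function.comp_apply, neg_neg, Int.negOnePow_add]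
    simp
    ring
  convert hs.hasSum
  rw [← h3.tsum_eq]
  refine Pentagonal.tprod_one_sub_pow (tendsto_pow_atTop_nhds_zero_of_norm_lt_one hq)
    (fun k ↦ Summable.of_norm_bounded hgC fun n ↦ norm_pow_mul_prod_le hq k n) (fun k ↦ ?_)
    h3.summable ?_
  · have hk : Summable fun n ↦ ‖-q ^ (n + k + 1)‖ := by
      simpa [add_assoc] using (summable_nat_add_iff (k + 1)).mpr hg
    simpa [sub_eq_add_neg] using multipliable_one_add_of_summable hk
  · refine squeeze_zero_norm (a := fun k ↦ ‖q‖ ^ k *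
      ∑' n : ℕ, ‖q‖ ^ n * Real.exp (1 - ‖q‖)⁻¹) (fun k ↦ ?_) ?_
    · rw [norm_mul, norm_mul, norm_pow, norm_neg, norm_one, one_pow, one_mul, norm_pow]
      refine mul_le_mul (pow_le_pow_of_le_one (norm_nonneg _) hq.le ?_)
        (tsum_of_norm_bounded hgC.hasSum fun n ↦ norm_pow_mul_prod_le hq k n)
        (norm_nonneg _) (by positivity)
      rw [Nat.le_div_iff_mul_le two_pos]
      nlinarith
    · simpa using (tendsto_pow_atTop_nhds_zero_of_lt_one (norm_nonneg _) hq).mul_const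
        (∑' n : ℕ, ‖q‖ ^ n * Real.exp (1 - ‖q‖)⁻¹)

/-- The Laurent series over `ℂ` of an integral power series. -/
noncomputable def intSeries : PowerSeries ℤ →+* LaurentSeries ℂ :=
  (HahnSeries.ofPowerSeries ℤ ℂ).comp (PowerSeries.map (Int.castRingHom ℂ))

@[simp] lemma coeff_intSeries (A : PowerSeries ℤ) (n : ℕ) :
    (intSeries A).coeff n = A.coeff n := by
  simp [intSeries, LaurentSeries.coeff_coe_powerSeries]

lemma ordGE_intSeries (A : PowerSeries ℤ) : OrdGE 0 (intSeries A) := fun n hn ↦ by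
  simp [intSeries, PowerSeries.coeff_coe, hn]

lemma intSeries_mem (A : PowerSeries ℤ) : intSeries A ∈ localSeries :=
  mem_localSeries.mpr fun n ↦ by
  rcases lt_or_ge n 0 with hn | hn
  · rw [ordGE_intSeries A n hn]; exact zero_mem _
  · lift n to ℕ using hn
    rw [coeff_intSeries]
    exact intCast_mem_localRing _

/-- The Euler product `∏ (1 - q ^ n)`. -/
noncomputable def eFun (τ : ℍ) : ℂ := ∏' n, (1 - nome τ ^ (n + 1))

/-- The `q`-expansion of the Euler product. -/
noncomputable def eSeries : LaurentSeries ℂ := intSeries (PowerSeries.pentagonalSeries ℤ)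

lemma isExp_eFun : IsExp eFun eSeries := fun τ ↦ by
  have h1 := hasSum_pentagonal (norm_nome_lt_one τ)
  have h2 : HasSum (fun n : ℕ ↦ eSeries.coeff n * nome τ ^ (n : ℤ)) (eFun τ) := by
    rw [← pentagonal_injective.hasSum_iff]
    · refine h1.congr_fun fun k ↦ ?_
      simp [eSeries]
    · intro n hn
      rw [eSeries, coeff_intSeries, PowerSeries.coeff_pentagonalSeries_eq_zero _ hn]
      simp
  refine (Function.Injective.hasSum_iff (Nat.cast_injective (R := ℤ)) ?_).mp h2
  · intro n hn
    rw [eSeries, ordGE_intSeries, zero_mul]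
    by_contra h
    exact hn ⟨n.toNat, by omega⟩

lemma eFun_ne_zero (τ : ℍ) : eFun τ ≠ 0 := by
  have := ModularForm.eta_tprod_ne_zero τ.2
  simp_rw [ModularForm.eta_q_eq_pow] at this
  exact this

/-- The value of `e^{2 π i τ / 24}`. -/
noncomputable def rootNome (τ : ℍ) : ℂ := cexp (2 * π * I * τ / 24)

lemma rootNome_ne_zero (τ : ℍ) : rootNome τ ≠ 0 := exp_ne_zero _

/-- The Dedekind eta function. -/
noncomputable def etaFun (τ : ℍ) : ℂ := ModularForm.eta τ

lemma etaFun_eq (τ : ℍ) : etaFun τ = rootNome τ * eFun τ := by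
  simp only [etaFun, ModularForm.eta, ModularForm.eta_q_eq_pow, Function.Periodic.qParam]
  push_cast
  rfl

lemma etaFun_ne_zero (τ : ℍ) : etaFun τ ≠ 0 := ModularForm.eta_ne_zero τ.2

lemma etaFun_pow (τ : ℍ) : etaFun τ ^ 24 = CuspForm.discriminant τ := rfl

lemma etaFun_pow_smul (γ : SL(2, ℤ)) (τ : ℍ) :
    etaFun (γ • τ) ^ 24 = (γ 1 0 * τ + γ 1 1 : ℂ) ^ 12 * etaFun τ ^ 24 := by
  rw [etaFun_pow, etaFun_pow, discriminant_smul]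

lemma coeff_eSeries_zero : eSeries.coeff 0 = 1 := by
  have := PowerSeries.coeff_pentagonalSeries_pentagonal ℤ 0
  rw [show pentagonal 0 = 0 from rfl] at this
  have h := coeff_intSeries (PowerSeries.pentagonalSeries ℤ) 0
  rw [this] at h
  simpa [eSeries] using h

lemma eSeries_ne_zero : eSeries ≠ 0 := fun h ↦ by
  simpa [h] using coeff_eSeries_zero

lemma eSeries_coeff_of_sq {k : ℤ} {n : ℤ} (h : 2 * n = k * (3 * k - 1)) :
    eSeries.coeff n = (Int.negOnePow k : ℂ) := by
  have : n = pentagonal k := by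
    have := two_mul_natCast_pentagonal k
    omega
  rw [this, eSeries, coeff_intSeries, PowerSeries.coeff_pentagonalSeries_pentagonal]
  simp

lemma eSeries_coeff_eq_zero {n : ℤ} (h : ∀ k : ℤ, 2 * n ≠ k * (3 * k - 1)) :
    eSeries.coeff n = 0 := by
  rcases lt_or_ge n 0 with hn | hn
  · exact ordGE_intSeries _ n hn
  · lift n to ℕ using hn
    rw [eSeries, coeff_intSeries, PowerSeries.coeff_pentagonalSeries_eq_zero]
    · simp
    · rintro ⟨k, rfl⟩
      exact h k (two_mul_natCast_pentagonal k)

/-- The dissection of Euler's pentagonal series. -/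
lemma coeff_eSeries_eleven (n : ℤ) :
    eSeries.coeff (11 * n + 5) = if (11 : ℤ) ∣ n then eSeries.coeff (n / 11) else 0 := by
  have key : ∀ k : ℤ, 2 * (11 * n + 5) = k * (3 * k - 1) →
      ∃ l : ℤ, k = 2 - 11 * l ∧ n = 11 * (n / 11) ∧ 2 * (n / 11) = l * (3 * l - 1) := by
    intro k hk
    have h1 : (11 : ℤ) ∣ (k - 2) := by
      have : (11 : ℤ) ∣ (k - 2) ^ 2 := ⟨8 * n + 4 - k ^ 2 , by linear_combination -4 * hk⟩
      exact Int.Prime.dvd_pow' (by norm_num) this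
    obtain ⟨l, hl⟩ := h1
    have hk' : k = 2 - 11 * (-l) := by linarith
    refine ⟨-l, hk', ?_⟩
    have h2 : 2 * n = 11 * ((-l) * (3 * (-l) - 1)) := by
      rw [hk'] at hk; linarith
    have h3 : (11 : ℤ) ∣ n := by omega
    obtain ⟨m, rfl⟩ := h3
    rw [Int.mul_ediv_cancel_left _ (by norm_num)]
    exact ⟨rfl, by linarith⟩
  split_ifs with h
  · obtain ⟨m, rfl⟩ := h
    rw [Int.mul_ediv_cancel_left _ (by norm_num)]
    by_cases hm : ∃ l : ℤ, 2 * m = l * (3 * l - 1)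
    · obtain ⟨l, hl⟩ := hm
      rw [eSeries_coeff_of_sq hl, eSeries_coeff_of_sq (k := 2 - 11 * l) (by linarith)]
      rcases Int.even_or_odd l with h | h
      · rw [Int.negOnePow_even l h, Int.negOnePow_even _ (by grind)]
      · rw [Int.negOnePow_odd l h, Int.negOnePow_odd _ (by grind)]
    · push Not at hm
      rw [eSeries_coeff_eq_zero hm, eSeries_coeff_eq_zero]
      intro k hk
      obtain ⟨l, -, -, hl⟩ := key k hk
      rw [Int.mul_ediv_cancel_left _ (by norm_num)] at hl
      exact hm l hl
  · refine eSeries_coeff_eq_zero fun k hk ↦ ?_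
    obtain ⟨l, -, hn, -⟩ := key k hk
    exact h ⟨_, hn⟩

end

section

/-! ### The quotient `η(121 τ) / η(τ)` -/

/-- A continuous function on the upper half plane one of whose powers is constant is constant. -/
lemma exists_const_of_pow_eq {f : ℍ → ℂ} (hf : Continuous f) {n : ℕ} (hn : 0 < n) {c : ℂ}
    (h : ∀ τ, f τ ^ n = c) : ∃ w, w ^ n = c ∧ ∀ τ, f τ = w := by
  have hfin : {z : ℂ | z ^ n = c}.Finite :=
    (Polynomial.nthRoots n c).toFinset.finite_toSet.subset fun z hz ↦ by
      simpa [Polynomial.mem_nthRoots hn] using hz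
  obtain ⟨w, hw, hw'⟩ := (isPreconnected_univ (α := ℍ)).eqOn_const_of_mapsTo hfin.isDiscrete
    hf.continuousOn (fun τ _ ↦ h τ) ⟨f UpperHalfPlane.I, h _⟩
  exact ⟨w, hw, fun τ ↦ hw' (Set.mem_univ τ)⟩

lemma rootNome_pow (τ : ℍ) : rootNome τ ^ 24 = nome τ := by
  rw [rootNome, ← Complex.exp_nat_mul, nome]; congr 1; push_cast; ring

lemma rootNome_elevenMul (τ : ℍ) : rootNome (elevenMul τ) = rootNome τ ^ 11 := by
  rw [rootNome, rootNome, ← Complex.exp_nat_mul, coe_elevenMul]; congr 1; push_cast; ring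

lemma eFun_vadd_int (x : ℤ) (τ : ℍ) : eFun ((x : ℝ) +ᵥ τ) = eFun τ :=
  isExp_eFun.comp_vadd_int x τ

/-- The function `η(121 τ) / η(τ)`. -/
noncomputable def phi (τ : ℍ) : ℂ := etaFun (elevenMul (elevenMul τ)) / etaFun τ

lemma phi_ne_zero (τ : ℍ) : phi τ ≠ 0 := div_ne_zero (etaFun_ne_zero _) (etaFun_ne_zero _)

lemma phi_eq (τ : ℍ) : phi τ = nome τ ^ (5 : ℤ) * eFun (elevenMul (elevenMul τ)) / eFun τ := by
  have h1 := rootNome_ne_zero τ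
  have h2 := eFun_ne_zero τ
  rw [phi, etaFun_eq, etaFun_eq, rootNome_elevenMul, rootNome_elevenMul, ← rootNome_pow]
  field_simp

/-- The `q`-expansion of `η(121 τ) / η(τ)`. -/
noncomputable def phiSeries : LaurentSeries ℂ :=
  HahnSeries.single 5 1 * vSeries (vSeries eSeries) / eSeries

lemma isExp_phi : IsExp phi phiSeries :=
  (((IsExp.single 5).mul isExp_eFun.comp_elevenMul.comp_elevenMul).div isExp_eFun
    eFun_ne_zero).congr phi_eq

lemma continuous_phi : Continuous phi := isExp_phi.continuous

lemma uOp_mul_comp_elevenMul {f g : ℍ → ℂ} (hg : ∀ (x : ℤ) τ, g ((x : ℝ) +ᵥ τ) = g τ) (τ : ℍ) :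
    uOp (fun τ ↦ f τ * g (elevenMul τ)) τ = uOp f τ * g τ := by
  simp only [uOp, cosetPt, elevenMul_divEleven, hg, ← Finset.sum_mul, mul_assoc]

lemma uOp_phi_inv (τ : ℍ) : uOp (fun τ ↦ (phi τ)⁻¹) τ = 1 := by
  have h1 : (fun τ ↦ (phi τ)⁻¹) =
      fun τ ↦ (nome τ ^ (-5 : ℤ) * eFun τ) * (fun τ ↦ (eFun (elevenMul τ))⁻¹) (elevenMul τ) := by
    ext τ
    rw [phi_eq, inv_div, zpow_neg, ← div_eq_mul_inv, div_mul_eq_div_div]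
    congr 1
    rw [div_eq_inv_mul]
  have h2 : ∀ (x : ℤ) τ, (fun τ ↦ (eFun (elevenMul τ))⁻¹) ((x : ℝ) +ᵥ τ) =
      (fun τ ↦ (eFun (elevenMul τ))⁻¹) τ := fun x τ ↦ by
    have : elevenMul ((x : ℝ) +ᵥ τ) = ((11 * x : ℤ) : ℝ) +ᵥ elevenMul τ := by
      ext; simp [coe_vadd]; ring
    simp only [this, eFun_vadd_int]
  rw [h1, uOp_mul_comp_elevenMul (f := fun τ ↦ nome τ ^ (-5 : ℤ) * eFun τ)
    (g := fun τ ↦ (eFun (elevenMul τ))⁻¹) h2]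
  have h3 := ((IsExp.single (-5)).mul isExp_eFun).uOp
  have h4 : uSeries (HahnSeries.single (-5) 1 * eSeries) = vSeries eSeries := by
    ext n
    have h5 := HahnSeries.coeff_single_mul_add (r := (1 : ℂ)) (x := eSeries) (a := 11 * n + 5)
      (b := -5)
    rw [coeff_uSeries, coeff_vSeries, ← coeff_eSeries_eleven, ← one_mul (eSeries.coeff _), ← h5]
    congr 1
    ring
  rw [h4] at h3
  rw [h3.eq_of_series isExp_eFun.comp_elevenMul]
  exact mul_inv_cancel₀ (eFun_ne_zero _)

lemma continuous_sl_smul (γ : SL(2, ℤ)) : Continuous fun τ : ℍ ↦ γ • τ := by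
  rw [isOpenEmbedding_coe.isEmbedding.continuous_iff]
  have : ((↑) ∘ fun τ : ℍ ↦ γ • τ : ℍ → ℂ) =
      fun τ : ℍ ↦ (γ 0 0 * τ + γ 0 1 : ℂ) / (γ 1 0 * τ + γ 1 1 : ℂ) := funext (coe_sl_smul γ)
  rw [this]
  exact ((continuous_const.mul continuous_coe).add continuous_const).div
    ((continuous_const.mul continuous_coe).add continuous_const) (sl_denom_ne_zero γ)

lemma exists_phi_smul {γ : SL(2, ℤ)} (hγ : γ ∈ CongruenceSubgroup.Gamma0 121) :
    ∃ w : ℂ, w ^ 24 = 1 ∧ ∀ τ, phi (γ • τ) = w * phi τ := by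
  obtain ⟨k, hk⟩ : (121 : ℤ) ∣ γ 1 0 := mem_Gamma0_iff.mp hγ
  have hdet := sl_det γ
  have hγ' : γ 0 0 * γ 1 1 - (121 * γ 0 1) * k = 1 := by rw [hk] at hdet; linarith
  have h0 : ∀ τ, elevenMul (elevenMul (γ • τ)) =
      slMk _ _ _ _ hγ' • elevenMul (elevenMul τ) := fun τ ↦ by
    have h1 := slMk_denom_ne_zero hγ' (elevenMul (elevenMul τ))
    have h2 := sl_denom_ne_zero γ τ
    ext
    rw [coe_slMk_smul]
    simp only [coe_elevenMul, coe_sl_smul] at h1 ⊢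
    rw [← mul_assoc, mul_div_assoc', div_eq_div_iff h2 h1, hk]
    push_cast
    ring
  have h1 : ∀ τ, (phi (γ • τ) / phi τ) ^ 24 = 1 := fun τ ↦ by
    have h2 := sl_denom_ne_zero γ τ
    have h3 := etaFun_ne_zero τ
    have h4 := etaFun_ne_zero (elevenMul (elevenMul τ))
    rw [div_pow, phi, phi, div_pow, div_pow, h0, etaFun_pow_smul, etaFun_pow_smul]
    have h5 : ((slMk _ _ _ _ hγ' 1 0 : ℤ) : ℂ) * (elevenMul (elevenMul τ)) +
        ((slMk _ _ _ _ hγ' 1 1 : ℤ) : ℂ) = γ 1 0 * τ + γ 1 1 := by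
      change (k : ℂ) * _ + γ 1 1 = _
      rw [hk, coe_elevenMul, coe_elevenMul]; push_cast; ring
    rw [h5]
    field_simp
  have hc : Continuous fun τ ↦ phi (γ • τ) / phi τ :=
    (continuous_phi.comp (continuous_sl_smul γ)).div continuous_phi phi_ne_zero
  obtain ⟨w, hw, hw'⟩ := exists_const_of_pow_eq hc (by norm_num) h1
  exact ⟨w, hw, fun τ ↦ by rw [← hw' τ, div_mul_cancel₀ _ (phi_ne_zero τ)]⟩

lemma eq_one_of_sum_eq_card {ι : Type*} [Fintype ι] {c : ι → ℂ} (h1 : ∀ i, ‖c i‖ = 1)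
    (h : ∑ i, c i = Fintype.card ι) (i : ι) : c i = 1 := by
  have hle : ∀ i ∈ Finset.univ, (c i).re ≤ 1 := fun i _ ↦ (re_le_norm _).trans (h1 i).le
  have hsum : ∑ i, (c i).re = ∑ i : ι, (1 : ℝ) := by
    rw [← re_sum, h]; simp
  have hre := (Finset.sum_eq_sum_iff_of_le hle).mp hsum i (Finset.mem_univ i)
  have hn := h1 i
  have : (c i).re * (c i).re + (c i).im * (c i).im = 1 := by
    rw [← normSq_apply, normSq_eq_norm_sq, hn, one_pow]
  rw [hre] at this
  exact Complex.ext hre (by simpa using this)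

lemma isInv_phi : IsInv 121 phi := fun γ hγ ↦ by
  obtain ⟨w, hw, hγw⟩ := exists_phi_smul hγ
  suffices w = 1 by simpa [this] using hγw
  obtain ⟨k, hk⟩ : (121 : ℤ) ∣ γ 1 0 := mem_Gamma0_iff.mp hγ
  have hdet := sl_det γ
  have hγ' : γ 0 0 * γ 1 1 - (11 * γ 0 1) * (11 * k) = 1 := by rw [hk] at hdet; linarith
  set γ' := slMk _ _ _ _ hγ' with hγ'def
  have hmem : γ' ∈ CongruenceSubgroup.Gamma0 11 := slMk_mem_Gamma0.mpr ⟨k, rfl⟩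
  obtain ⟨σ, δ, hσ, hδ⟩ := exists_cosetPt_smul hmem
  have hσ0 : σ 0 = 0 := by
    rw [hσ]
    change (((11 * γ 0 1 : ℤ) : ZMod 11)) * _ = 0
    push_cast
    rw [show (11 : ZMod 11) = 0 from rfl, zero_mul, zero_mul]
  have hγ0 : ∀ τ, cosetPt 0 (γ' • τ) = γ • cosetPt 0 τ := fun τ ↦ by
    have h1 := slMk_denom_ne_zero hγ' τ
    have h2 := sl_denom_ne_zero γ (cosetPt 0 τ)
    ext
    rw [coe_sl_smul]
    simp only [cosetPt, coe_divEleven] at h2 ⊢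
    rw [coe_slMk_smul, div_add' _ _ _ h1, div_div, div_eq_div_iff (mul_ne_zero h1 (by norm_num)) h2,
      hk]
    push_cast
    simp only [ZMod.val_zero, Nat.cast_zero]
    ring
  choose χ hχ hχ' using fun j ↦ exists_phi_smul (hδ j).1
  have hχ0 : χ 0 = w := by
    have h1 := hγw (cosetPt 0 UpperHalfPlane.I)
    have h2 := hχ' 0 (cosetPt 0 UpperHalfPlane.I)
    rw [← hγ0, (hδ 0).2, hσ0, h2] at h1
    exact mul_right_cancel₀ (phi_ne_zero _) h1
  have hexp := isExp_phi.inv phi_ne_zero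
  have h0 : (phiSeries⁻¹).coeff 0 = 1 := by
    have h1 := hexp.uOp.unique (IsExp.one.congr uOp_phi_inv)
    have h2 := congrArg (fun A ↦ HahnSeries.coeff A 0) h1
    simpa using h2
  have hs : ∀ τ, ∑ b, (χ (σ.symm b))⁻¹ * (phi (shiftEleven b τ))⁻¹ = 11 * 1 := fun τ ↦ by
    have h1 := uOp_phi_inv (γ' • elevenMul τ)
    have h2 : ∀ j, (phi (cosetPt j (γ' • elevenMul τ)))⁻¹ =
        (χ (σ.symm (σ j)))⁻¹ * (phi (shiftEleven (σ j) τ))⁻¹ := fun j ↦ by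
      rw [(hδ j).2, hχ', mul_inv, cosetPt_elevenMul, Equiv.symm_apply_apply]
    simp only [uOp, h2] at h1
    rw [Equiv.sum_comp σ (fun b ↦ (χ (σ.symm b))⁻¹ * (phi (shiftEleven b τ))⁻¹)] at h1
    rw [← h1]
    ring
  have h3 := (hexp.sum_shiftEleven fun b ↦ (χ (σ.symm b))⁻¹).unique
    ((IsExp.one.const_mul 11).congr hs)
  have h4 := congrArg (fun A ↦ HahnSeries.coeff A 0) h3
  simp only [coeff_hadamard, h0, mul_one, Int.cast_zero, mul_zero, AddChar.map_zero_eq_one,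
    HahnSeries.coeff_smul, HahnSeries.coeff_one, if_true, smul_eq_mul] at h4
  have h5 := eq_one_of_sum_eq_card (c := fun b ↦ (χ (σ.symm b))⁻¹) (fun b ↦ ?_) (by
    rw [h4, ZMod.card]; norm_num) (σ 0)
  · rw [Equiv.symm_apply_apply, hχ0, inv_eq_one] at h5
    exact h5
  · rw [norm_inv, norm_eq_one_of_pow_eq_one (hχ _) (by norm_num), inv_one]

end

section

/-! ### Behaviour of `η(121 τ) / η(τ)` at the other cusps -/

lemma etaFun_of_coe_eq {τ z : ℍ} (h : (z : ℂ) = -1 / τ) :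
    etaFun z = (sqrt Complex.I)⁻¹ * (sqrt τ * etaFun τ) := by
  have h1 := ModularForm.eta_comp_eq_csqrt_I_inv τ.2
  rw [etaFun, h]
  simpa [etaFun] using h1

lemma sqrt_mul_of_pos {r : ℝ} (hr : 0 < r) {z : ℂ} (hz : z ≠ 0) :
    sqrt ((r ^ 2 : ℝ) * z) = r * sqrt z := by
  have h : ((r ^ 2 : ℝ) : ℂ) ≠ 0 := by exact_mod_cast (pow_pos hr 2).ne'
  rw [sqrt_eq_exp (mul_ne_zero h hz), sqrt_eq_exp hz, Complex.log_ofReal_mul (by positivity) hz,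
    Real.log_pow, add_div, Complex.exp_add]
  push_cast
  rw [mul_div_cancel_left₀ _ two_ne_zero, ← Complex.ofReal_exp, Real.exp_log hr]

lemma phi_cosetPt_zero_fricke (τ : ℍ) : (phi (cosetPt 0 (fricke τ)))⁻¹ = 11 * phi τ := by
  have hτ := τ.ne_zero
  have h1 : (elevenMul (elevenMul (cosetPt 0 (fricke τ))) : ℂ) = -1 / τ := by
    simp [cosetPt]; field_simp
  have h2 : ((cosetPt 0 (fricke τ) : ℍ) : ℂ) = -1 / (elevenMul (elevenMul τ) : ℍ) := by
    simp [cosetPt]; field_simp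
  have h3 : sqrt (elevenMul (elevenMul τ) : ℍ) = 11 * sqrt τ := by
    have := sqrt_mul_of_pos (r := 11) (by norm_num) hτ
    rw [coe_elevenMul, coe_elevenMul, ← mul_assoc]
    norm_num at this ⊢
    exact this
  have h4 : sqrt τ ≠ 0 := by rw [sqrt_eq_exp hτ]; exact exp_ne_zero _
  have h5 : sqrt Complex.I ≠ 0 := by rw [sqrt_eq_exp I_ne_zero]; exact exp_ne_zero _
  have h6 := etaFun_ne_zero τ
  rw [phi, etaFun_of_coe_eq h1, etaFun_of_coe_eq h2, h3, phi]
  field_simp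

lemma exists_cosetPt_fricke {β : ZMod 11} (hβ : β ≠ 0) :
    ∃ (B : ℤ) (γ : SL(2, ℤ)), (24 : ℤ) ∣ B ∧ (B : ZMod 11) = β ∧
      γ ∈ CongruenceSubgroup.Gamma0 11 ∧ γ 1 0 = 11 ∧ γ 1 1 = -B ∧
      ∀ τ, cosetPt (-β⁻¹) (fricke τ) = γ • ((B / 11 : ℝ) +ᵥ τ) := by
  set b : ℤ := ((-β⁻¹ : ZMod 11).val : ℤ) with hb
  set B : ℤ := 24 * ((6 * β).val : ℤ) with hB
  have hbB : (B : ZMod 11) = β := by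
    rw [hB]; push_cast; rw [ZMod.natCast_val, ZMod.cast_id', id, ← mul_assoc,
      show (24 : ZMod 11) * 6 = 1 from rfl, one_mul]
  have hbb : (b : ZMod 11) = -β⁻¹ := by
    rw [hb]; push_cast; rw [ZMod.natCast_val, ZMod.cast_id', id]
  obtain ⟨y, hy⟩ : (11 : ℤ) ∣ -(1 + b * B) := by
    rw [show (11 : ℤ) = ((11 : ℕ) : ℤ) from rfl, ← ZMod.intCast_zmod_eq_zero_iff_dvd]
    push_cast
    rw [hbB, hbb, neg_mul, inv_mul_cancel₀ hβ, add_neg_cancel, neg_zero]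
  have hdet : b * -B - y * 11 = 1 := by linarith
  refine ⟨B, slMk b y 11 (-B) hdet, ⟨_, hB⟩, hbB, slMk_mem_Gamma0.mpr dvd_rfl, rfl, rfl,
    fun τ ↦ ?_⟩
  have h1 := slMk_denom_ne_zero hdet ((B / 11 : ℝ) +ᵥ τ)
  have hτ := τ.ne_zero
  ext
  rw [coe_slMk_smul]
  have h2 : (11 : ℂ) * y = -(1 + b * B) := by exact_mod_cast hy.symm
  simp only [cosetPt, coe_divEleven, coe_fricke, coe_vadd] at h1 ⊢
  rw [← hb]
  push_cast at h1 ⊢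
  have h3 : (11 : ℂ) * (B / 11 + τ) + -B = 11 * τ := by ring
  rw [h3]
  field_simp
  linear_combination -h2

lemma shift_eq {B : ℤ} {β : ZMod 11} (h : (B : ZMod 11) = β) (τ : ℍ) :
    ∃ m : ℤ, (B / 11 : ℝ) +ᵥ τ = (m : ℝ) +ᵥ shiftEleven β τ := by
  obtain ⟨m, hm⟩ : (11 : ℤ) ∣ B - β.val := by
    rw [show (11 : ℤ) = ((11 : ℕ) : ℤ) from rfl, ← ZMod.intCast_zmod_eq_zero_iff_dvd]
    push_cast
    rw [h, ZMod.natCast_val, ZMod.cast_id', id, sub_self]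
  refine ⟨m, ?_⟩
  ext
  have : (B : ℂ) = 11 * m + β.val := by
    have : B = 11 * m + β.val := by linarith
    exact_mod_cast this
  simp only [shiftEleven, coe_vadd]
  push_cast
  rw [this]
  ring

lemma rootNome_shift {B : ℤ} (hB : (24 : ℤ) ∣ B) {β : ZMod 11} (h : (B : ZMod 11) = β) (τ : ℍ) :
    rootNome ((B / 11 : ℝ) +ᵥ τ) = psi (6 * β) * rootNome τ := by
  obtain ⟨k, rfl⟩ := hB
  have h1 : 6 * β = ((k : ℤ) : ZMod 11) := by
    rw [← h]; push_cast
    rw [← mul_assoc, show (6 : ZMod 11) * 24 = 1 from rfl, one_mul]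
  have h2 := ZMod.stdAddChar_coe (N := 11) k
  rw [h1, h2, rootNome, rootNome, coe_vadd, ← Complex.exp_add]
  congr 1
  push_cast
  ring

lemma continuous_vadd_real (x : ℝ) : Continuous fun τ : ℍ ↦ x +ᵥ τ := by
  rw [isOpenEmbedding_coe.isEmbedding.continuous_iff]
  exact continuous_const.add continuous_coe

lemma exists_phi_cosetPt {β : ZMod 11} (hβ : β ≠ 0) : ∃ w : ℂ, w ^ 24 = 11 ^ 12 ∧
    ∀ τ, (phi (cosetPt (-β⁻¹) (fricke τ)))⁻¹ =
      w * (psi (6 * β) * eFun (shiftEleven β τ) / eFun τ) := by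
  obtain ⟨B, γ, hB, hBβ, -, hγ1, hγ2, hγ⟩ := exists_cosetPt_fricke hβ
  have hE : ∀ τ, eFun ((B / 11 : ℝ) +ᵥ τ) = eFun (shiftEleven β τ) := fun τ ↦ by
    obtain ⟨m, hm⟩ := shift_eq hBβ τ
    rw [hm, eFun_vadd_int]
  have h1 : ∀ τ, etaFun ((B / 11 : ℝ) +ᵥ τ) / etaFun τ =
      psi (6 * β) * eFun (shiftEleven β τ) / eFun τ := fun τ ↦ by
    have := rootNome_ne_zero τ
    have := eFun_ne_zero τ
    rw [etaFun_eq, etaFun_eq, rootNome_shift hB hBβ, hE]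
    field_simp
  have h2 : ∀ τ, ((phi (cosetPt (-β⁻¹) (fricke τ)))⁻¹ /
      (etaFun ((B / 11 : ℝ) +ᵥ τ) / etaFun τ)) ^ 24 = 11 ^ 12 := fun τ ↦ by
    have hτ := τ.ne_zero
    have h3 := etaFun_ne_zero τ
    have h4 := etaFun_ne_zero ((B / 11 : ℝ) +ᵥ τ)
    have h5 : etaFun (elevenMul (elevenMul (cosetPt (-β⁻¹) (fricke τ)))) ^ 24 =
        (τ : ℂ) ^ 12 * etaFun τ ^ 24 := by
      have h6 : elevenMul (elevenMul (cosetPt (-β⁻¹) (fricke τ))) =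
          slMk (11 * (-β⁻¹ : ZMod 11).val) (-1) 1 0 (by ring) • τ := by
        ext
        rw [coe_slMk_smul]
        simp only [coe_elevenMul, cosetPt, coe_divEleven, coe_fricke]
        push_cast
        rw [one_mul, add_zero]
        field_simp
        ring
      rw [h6, etaFun_pow_smul]
      congr 2
      change ((1 : ℤ) : ℂ) * _ + ((0 : ℤ) : ℂ) = _
      simp
    have h7 : (11 : ℂ) * ((B / 11 : ℝ) +ᵥ τ : ℍ) + -B = 11 * τ := by
      rw [coe_vadd]; push_cast; ring
    rw [div_pow, div_pow, inv_pow, phi, div_pow, h5, hγ, etaFun_pow_smul, hγ1, hγ2]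
    push_cast
    rw [h7]
    field_simp
  have hc : Continuous fun τ ↦ (phi (cosetPt (-β⁻¹) (fricke τ)))⁻¹ /
      (etaFun ((B / 11 : ℝ) +ᵥ τ) / etaFun τ) := by
    simp only [h1, hγ]
    refine Continuous.div ?_ ?_ fun τ ↦
      div_ne_zero (mul_ne_zero ?_ (eFun_ne_zero _)) (eFun_ne_zero _)
    · refine Continuous.inv₀ (continuous_phi.comp ((continuous_sl_smul γ).comp
        (continuous_vadd_real (B / 11)))) fun τ ↦ phi_ne_zero _
    · exact (continuous_const.mul (isExp_eFun.comp_shiftEleven β).continuous).div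
        isExp_eFun.continuous eFun_ne_zero
    · rw [psi_apply]; exact exp_ne_zero _
  obtain ⟨w, hw, hw'⟩ := exists_const_of_pow_eq hc (by norm_num) h2
  refine ⟨w, hw, fun τ ↦ ?_⟩
  rw [← hw' τ, ← h1, div_mul_cancel₀]
  exact div_ne_zero (etaFun_ne_zero _) (etaFun_ne_zero _)

lemma sum_eq_zero_add (F : ZMod 11 → ℂ) :
    ∑ b, F b = F 0 + ∑ β, if β = 0 then 0 else F (-β⁻¹) := by
  have h : Function.Involutive fun β : ZMod 11 ↦ -β⁻¹ := fun β ↦ by simp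
  rw [← Equiv.sum_comp h.toPerm F, Fintype.sum_eq_add_sum_compl 0]
  congr 1
  · simp
  · rw [← Finset.sum_filter_ne_zero]
    symm
    rw [← Finset.sum_subset (Finset.subset_univ {0}ᶜ) fun β _ hβ ↦ by
      rw [if_pos (by simpa using hβ)], Finset.sum_filter_ne_zero]
    exact Finset.sum_congr rfl fun β hβ ↦ by
      rw [if_neg (by simpa using hβ)]; rfl

end

section

lemma sum_sum_psi (w : ZMod 11 → ℂ) (β : ZMod 11) :
    ∑ m, (∑ b, w b * psi (b * m)) * psi (-(β * m)) = 11 * w β := by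
  have h : ∀ b, ∑ m, psi (m * (b - β)) = if b = β then 11 else 0 := fun b ↦ by
    rw [AddChar.sum_mulShift _ (ZMod.isPrimitive_stdAddChar 11)]
    simp only [sub_eq_zero]
    split_ifs <;> simp [ZMod.card]
  calc ∑ m, (∑ b, w b * psi (b * m)) * psi (-(β * m))
      = ∑ b, w b * ∑ m, psi (m * (b - β)) := by
        simp_rw [Finset.sum_mul, Finset.mul_sum]
        rw [Finset.sum_comm]
        refine Finset.sum_congr rfl fun b _ ↦ Finset.sum_congr rfl fun m _ ↦ ?_
        rw [mul_assoc, ← AddChar.map_add_eq_mul]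
        congr 2
        ring
    _ = 11 * w β := by simp [h, mul_comm]

lemma sum_normSq_fourier (w : ZMod 11 → ℂ) :
    ∑ m, ‖∑ b, w b * psi (b * m)‖ ^ 2 = 11 * ∑ b, ‖w b‖ ^ 2 := by
  have h : ∀ z : ℂ, ((‖z‖ ^ 2 : ℝ) : ℂ) = z * (starRingEnd ℂ) z := fun z ↦ by
    rw [Complex.mul_conj, Complex.normSq_eq_norm_sq]
  apply Complex.ofReal_injective
  rw [Complex.ofReal_sum, Complex.ofReal_mul, Complex.ofReal_sum]
  simp only [h]
  calc ∑ m, (∑ b, w b * psi (b * m)) * (starRingEnd ℂ) (∑ b, w b * psi (b * m))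
      = ∑ β, (starRingEnd ℂ) (w β) * ∑ m, (∑ b, w b * psi (b * m)) * psi (-(β * m)) := by
        simp_rw [map_sum, map_mul, ← AddChar.map_neg_eq_conj, Finset.mul_sum]
        rw [Finset.sum_comm]
        exact Finset.sum_congr rfl fun b _ ↦ Finset.sum_congr rfl fun m _ ↦ by ring
    _ = _ := by
        simp_rw [sum_sum_psi, Finset.mul_sum]
        exact Finset.sum_congr rfl fun b _ ↦ by push_cast; ring

/-- The quadratic character modulo `11`. -/
noncomputable def chi (m : ZMod 11) : ℂ := (quadraticChar (ZMod 11) m : ℤ)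

lemma fourier_eq_chi {w : ZMod 11 → ℂ} (h0 : w 0 = 0) (h1 : ∀ β ≠ 0, ‖w β‖ ^ 2 = 11)
    (he0 : ∑ b, w b * psi (b * 0) = 0)
    (he : ∀ m ∈ ({6, 7, 2, 8, 10} : Finset (ZMod 11)), ∑ b, w b * psi (b * m) = 11)
    (m : ZMod 11) : ∑ b, w b * psi (b * m) = -11 * chi m := by
  set e : ZMod 11 → ℂ := fun m ↦ ∑ b, w b * psi (b * m) with hedef
  have hsplit : ∀ F : ZMod 11 → ℝ, ∑ m, F m =
      F 0 + (F 6 + F 7 + F 2 + F 8 + F 10) + (F 1 + F 3 + F 4 + F 5 + F 9) := fun F ↦ by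
    have : (Finset.univ : Finset (ZMod 11)) = {0, 6, 7, 2, 8, 10, 1, 3, 4, 5, 9} := by decide
    rw [this]
    repeat rw [Finset.sum_insert (by decide)]
    rw [Finset.sum_singleton]
    ring
  have he0' : e 0 = 0 := he0
  have h6 : e 6 = 11 := he 6 (by decide)
  have h7 : e 7 = 11 := he 7 (by decide)
  have h2 : e 2 = 11 := he 2 (by decide)
  have h8 : e 8 = 11 := he 8 (by decide)
  have h10 : e 10 = 11 := he 10 (by decide)
  have hsum : ∑ m, e m = 0 := by
    have := sum_sum_psi w 0
    simpa [h0] using this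
  have hre : ∑ m, (e m).re = 0 := by rw [← Complex.re_sum, hsum, zero_re]
  have hsq : ∑ m, ‖e m‖ ^ 2 = 1210 := by
    rw [sum_normSq_fourier, Fintype.sum_eq_add_sum_compl 0,
      Finset.sum_congr rfl fun β hβ ↦ h1 β (by simpa using hβ)]
    simp [h0, Finset.card_compl, ZMod.card]
    norm_num
  have hexp : ∀ z : ℂ, ‖z + 11‖ ^ 2 = ‖z‖ ^ 2 + 22 * z.re + 121 := fun z ↦ by
    rw [← Complex.normSq_eq_norm_sq, ← Complex.normSq_eq_norm_sq, normSq_apply, normSq_apply]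
    simp
    ring
  rw [hsplit] at hre hsq
  rw [he0', h6, h7, h2, h8, h10] at hre hsq
  norm_num at hre hsq
  have hx : ‖e 1 + 11‖ ^ 2 + ‖e 3 + 11‖ ^ 2 + ‖e 4 + 11‖ ^ 2 + ‖e 5 + 11‖ ^ 2 +
      ‖e 9 + 11‖ ^ 2 = 0 := by
    simp only [hexp]; linarith
  have hz : ∀ z : ℂ, ‖z + 11‖ ^ 2 ≤ 0 → z = -11 := fun z hz ↦ by
    have : ‖z + 11‖ = 0 := by
      have := sq_nonneg ‖z + 11‖
      exact pow_eq_zero_iff two_ne_zero |>.mp (le_antisymm hz this)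
    exact eq_neg_of_add_eq_zero_left (norm_eq_zero.mp this)
  have k1 := sq_nonneg ‖e 1 + 11‖
  have k3 := sq_nonneg ‖e 3 + 11‖
  have k4 := sq_nonneg ‖e 4 + 11‖
  have k5 := sq_nonneg ‖e 5 + 11‖
  have k9 := sq_nonneg ‖e 9 + 11‖
  have e1 := hz (e 1) (by linarith)
  have e3 := hz (e 3) (by linarith)
  have e4 := hz (e 4) (by linarith)
  have e5 := hz (e 5) (by linarith)
  have e9 := hz (e 9) (by linarith)
  have hchi : ∀ m : ZMod 11, (m = 0 ∧ quadraticChar (ZMod 11) m = 0) ∨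
      ((m = 6 ∨ m = 7 ∨ m = 2 ∨ m = 8 ∨ m = 10) ∧ quadraticChar (ZMod 11) m = -1) ∨
      ((m = 1 ∨ m = 3 ∨ m = 4 ∨ m = 5 ∨ m = 9) ∧ quadraticChar (ZMod 11) m = 1) := by
    decide
  change e m = _
  rcases hchi m with ⟨rfl, h⟩ | ⟨h', h⟩ | ⟨h', h⟩
  · rw [he0', chi, h]; simp
  · rw [chi, h]
    rcases h' with rfl | rfl | rfl | rfl | rfl <;> simp [h6, h7, h2, h8, h10]
  · rw [chi, h]
    rcases h' with rfl | rfl | rfl | rfl | rfl <;> simp [e1, e3, e4, e5, e9]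

lemma sq_eq_of_fourier_eq_chi {w : ZMod 11 → ℂ}
    (h : ∀ m, ∑ b, w b * psi (b * m) = -11 * chi m) {β : ZMod 11} (hβ : β ≠ 0) :
    w β ^ 2 = -11 := by
  have h1 := sum_sum_psi w β
  simp only [h] at h1
  have hF : ringChar (ZMod 11) ≠ 2 := by rw [ZMod.ringChar_zmod_n]; norm_num
  have h2 := gaussSum_sq (χ := (quadraticChar (ZMod 11)).ringHomComp (Int.castRingHom ℂ))
    (ψ := AddChar.mulShift psi (-β)) ?_ ?_ ?_
  · have h3 : 11 * w β = -11 * gaussSum ((quadraticChar (ZMod 11)).ringHomComp (Int.castRingHom ℂ))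
        (AddChar.mulShift psi (-β)) := by
      rw [← h1, gaussSum, Finset.mul_sum]
      refine Finset.sum_congr rfl fun m _ ↦ ?_
      rw [AddChar.mulShift_apply, chi, neg_mul β m]
      simp [mul_assoc]
    have h4 : w β = -gaussSum ((quadraticChar (ZMod 11)).ringHomComp (Int.castRingHom ℂ))
        (AddChar.mulShift psi (-β)) := by linear_combination h3 / 11
    have h5 : quadraticChar (ZMod 11) (-1) = -1 := by decide
    rw [h4, neg_sq, h2, ZMod.card, MulChar.ringHomComp_apply, h5]
    simp
  · have := quadraticChar_ne_one hF
    exact (MulChar.ringHomComp_ne_one_iff (RingHom.injective_int _)).mpr this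
  · exact (quadraticChar_isQuadratic (ZMod 11)).comp _
  · exact AddChar.IsPrimitive.of_ne_one
      ((ZMod.isPrimitive_stdAddChar 11) (neg_ne_zero.mpr hβ))

/-- The transformation factors of `phi` at the points other than `0`. -/
lemma exists_weights : ∃ w : ZMod 11 → ℂ, w 0 = 0 ∧ (∀ β ≠ 0, w β ^ 2 = -11) ∧
    (∀ m, ∑ b, w b * psi (b * m) = -11 * chi m) ∧
    ∀ β ≠ 0, ∀ τ, (phi (cosetPt (-β⁻¹) (fricke τ)))⁻¹ =
      w β * (psi (6 * β) * eFun (shiftEleven β τ) / eFun τ) := by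
  choose w₀ hw₀ hphi₀ using fun β : {β : ZMod 11 // β ≠ 0} ↦ exists_phi_cosetPt β.2
  let w : ZMod 11 → ℂ := fun β ↦ if h : β = 0 then 0 else w₀ ⟨β, h⟩
  have hw0 : w 0 = 0 := by simp [w]
  have hw : ∀ β ≠ 0, w β ^ 24 = 11 ^ 12 := fun β hβ ↦ by simp [w, hβ, hw₀]
  have hphi : ∀ β ≠ 0, ∀ τ, (phi (cosetPt (-β⁻¹) (fricke τ)))⁻¹ =
      w β * (psi (6 * β) * eFun (shiftEleven β τ) / eFun τ) := fun β hβ τ ↦ by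
    simp only [w, dif_neg hβ]; exact hphi₀ ⟨β, hβ⟩ τ
  have hnorm : ∀ β ≠ 0, ‖w β‖ ^ 2 = 11 := fun β hβ ↦ by
    have h1 := congrArg norm (hw β hβ)
    rw [norm_pow, norm_pow, show 24 = 2 * 12 from rfl, pow_mul] at h1
    simp only [Complex.norm_ofNat] at h1
    exact (pow_left_inj₀ (by positivity) (by norm_num) (by norm_num)).mp h1
  have hsum : ∀ τ, 11 * (nome τ ^ (5 : ℤ) * eFun (elevenMul (elevenMul τ))) +
      ∑ b, (w b * psi (6 * b)) * eFun (shiftEleven b τ) = 11 * eFun τ := fun τ ↦ by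
    have h1 := uOp_phi_inv (fricke τ)
    have hE := eFun_ne_zero τ
    rw [uOp, sum_eq_zero_add, phi_cosetPt_zero_fricke, phi_eq] at h1
    have h2 : ∀ β, (if β = 0 then 0 else (phi (cosetPt (-β⁻¹) (fricke τ)))⁻¹) =
        (w β * psi (6 * β)) * eFun (shiftEleven β τ) / eFun τ := fun β ↦ by
      split_ifs with hβ
      · rw [hβ, hw0]; simp
      · rw [hphi β hβ]; ring
    simp only [h2, ← Finset.sum_div] at h1
    field_simp at h1
    rw [zpow_ofNat]
    linear_combination h1
  have hser := (((((IsExp.single 5).mul isExp_eFun.comp_elevenMul.comp_elevenMul).const_mul 11).add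
    (isExp_eFun.sum_shiftEleven fun b ↦ w b * psi (6 * b))).unique
      ((isExp_eFun.const_mul 11).congr hsum))
  have hfour : ∀ k : ℤ, ∑ b, w b * psi (6 * b) * psi (b * k) =
      ∑ b, w b * psi (b * ((k + 6 : ℤ) : ZMod 11)) := fun k ↦ by
    refine Finset.sum_congr rfl fun b _ ↦ ?_
    rw [mul_assoc, ← AddChar.map_add_eq_mul]
    congr 2
    push_cast
    ring
  have hcoef : ∀ k : ℤ, 11 * (vSeries (vSeries eSeries)).coeff (k - 5) +
      (∑ b, w b * psi (b * ((k + 6 : ℤ) : ZMod 11))) * eSeries.coeff k = 11 * eSeries.coeff k := by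
    intro k
    have h1 := congrArg (fun A ↦ HahnSeries.coeff A k) hser
    have h2 := HahnSeries.coeff_single_mul_add (r := (1 : ℂ)) (x := vSeries (vSeries eSeries))
      (a := k - 5) (b := 5)
    rw [sub_add_cancel, one_mul] at h2
    simpa [hfour, h2] using h1
  have hE0 : eSeries.coeff 0 = 1 := coeff_eSeries_zero
  have hval : ∀ k : ℤ, ¬ (11 : ℤ) ∣ k - 5 → eSeries.coeff k ≠ 0 →
      ∑ b, w b * psi (b * ((k + 6 : ℤ) : ZMod 11)) = 11 := fun k hk hk' ↦ by
    have h1 := hcoef k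
    rw [coeff_vSeries, if_neg hk, mul_zero, zero_add] at h1
    exact mul_right_cancel₀ hk' h1
  have hneg : ∀ (k : ℤ) (n : ℤ), 2 * n = k * (3 * k - 1) → eSeries.coeff n ≠ 0 := fun k n h ↦ by
    rw [eSeries_coeff_of_sq h]
    exact_mod_cast (Int.negOnePow k).ne_zero
  have hfin := fourier_eq_chi hw0 hnorm ?_ ?_
  · exact ⟨w, hw0, fun β hβ ↦ sq_eq_of_fourier_eq_chi hfin hβ, hfin, hphi⟩
  · have h1 := hcoef 5
    rw [eSeries_coeff_of_sq (k := 2) (by norm_num), sub_self, coeff_vSeries,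
      if_pos (dvd_zero _), Int.zero_ediv, coeff_vSeries, if_pos (dvd_zero _), Int.zero_ediv,
      hE0] at h1
    have h2 : (((5 + 6 : ℤ)) : ZMod 11) = 0 := by decide
    rw [h2] at h1
    simpa using h1
  · intro m hm
    simp only [Finset.mem_insert, Finset.mem_singleton] at hm
    rcases hm with rfl | rfl | rfl | rfl | rfl
    · exact hval 0 (by decide) (hneg 0 0 (by norm_num))
    · exact hval 1 (by decide) (hneg 1 1 (by norm_num))
    · exact hval 7 (by decide) (hneg (-2) 7 (by norm_num))
    · exact hval 2 (by decide) (hneg (-1) 2 (by norm_num))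
    · exact hval 15 (by decide) (hneg (-3) 15 (by norm_num))

end

section

/-! ### The operator `U` at the cusp `0` -/

lemma mul_smul_eq (c : ℂ) (A B : LaurentSeries ℂ) : A * (c • B) = c • (A * B) := by
  rw [← HahnSeries.C_mul_eq_smul, ← HahnSeries.C_mul_eq_smul, mul_left_comm]

lemma cosetPt_zero_fricke (τ : ℍ) : cosetPt 0 (fricke τ) = fricke (elevenMul τ) := by
  have := τ.ne_zero
  ext; simp [cosetPt]; field_simp

lemma IsInv.apply_cosetPt_fricke {f : ℍ → ℂ} (hf : IsInv 11 f) {A : LaurentSeries ℂ}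
    (hA : IsExp f A) {β : ZMod 11} (hβ : β ≠ 0) (τ : ℍ) :
    f (cosetPt (-β⁻¹) (fricke τ)) = f (shiftEleven β τ) := by
  obtain ⟨B, γ, -, hBβ, hγ, -, -, hγτ⟩ := exists_cosetPt_fricke hβ
  obtain ⟨m, hm⟩ := shift_eq hBβ τ
  rw [hγτ, hf γ hγ, hm, hA.comp_vadd_int]

lemma IsInv.isExp_uOp_fricke {f : ℍ → ℂ} (hf : IsInv 11 f) {A B : LaurentSeries ℂ}
    (hA : IsExp f A) (hB : IsExp (fun τ ↦ f (fricke τ)) B) :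
    IsExp (fun τ ↦ RamanujanEleven.uOp f (fricke τ))
      ((11⁻¹ : ℂ) • vSeries B + (vSeries (uSeries A) - (11⁻¹ : ℂ) • A)) := by
  refine ((hB.comp_elevenMul.const_mul 11⁻¹).add
    (hA.uOp.comp_elevenMul.sub (hA.const_mul 11⁻¹))).congr fun τ ↦ ?_
  have h1 : ∑ β, (if β = 0 then 0 else f (cosetPt (-β⁻¹) (fricke τ))) =
      (∑ β, f (shiftEleven β τ)) - f τ := by
    have h2 : f (shiftEleven 0 τ) = f τ := by
      congr 1; ext; simp [shiftEleven]
    rw [eq_sub_iff_add_eq, ← h2, ← Finset.sum_erase_add _ _ (Finset.mem_univ 0),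
      ← Finset.sum_erase_add _ _ (Finset.mem_univ 0), if_pos rfl, add_zero]
    congr 1
    exact Finset.sum_congr rfl fun β hβ ↦ by
      rw [if_neg (Finset.ne_of_mem_erase hβ),
        hf.apply_cosetPt_fricke hA (Finset.ne_of_mem_erase hβ)]
  rw [RamanujanEleven.uOp, sum_eq_zero_add, h1, cosetPt_zero_fricke]
  simp only [RamanujanEleven.uOp, cosetPt_elevenMul]
  ring

lemma IsInv.isExp_uOp_phi_fricke {f : ℍ → ℂ} (hf : IsInv 11 f) {A B : LaurentSeries ℂ}
    (hA : IsExp f A) (hB : IsExp (fun τ ↦ f (fricke τ)) B) {n m : ℤ} (hn : n = 2 * m + 1) :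
    IsExp (fun τ ↦ RamanujanEleven.uOp (fun τ ↦ phi τ ^ n * f τ) (fricke τ))
      ((11⁻¹ : ℂ) • ((11 ^ (-n) : ℂ) • (phiSeries ^ (-n) * vSeries B) + ((-11) ^ (-m) : ℂ) •
        (eSeries ^ n *
          hadamard (fun k ↦ chi ((k - 6 * n : ℤ) : ZMod 11)) (A * eSeries ^ (-n))))) := by
  obtain ⟨w, hw0, hw2, hw, hphi⟩ := exists_weights
  have hinv : ∀ x : ℂ, x ^ n = x⁻¹ ^ (-n) := fun x ↦ by rw [inv_zpow', neg_neg]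
  have hn0 : -n ≠ 0 := by omega
  have hwn : ∀ β, w β ^ (-n) = (-11) ^ (-m - 1) * w β := fun β ↦ by
    rcases eq_or_ne β 0 with rfl | hβ
    · rw [hw0, zero_zpow _ hn0, mul_zero]
    · have hne : w β ≠ 0 := fun h ↦ by have := hw2 β hβ; rw [h] at this; norm_num at this
      rw [← hw2 β hβ, ← zpow_natCast, ← zpow_mul, ← zpow_add_one₀ hne, hn]
      congr 1
      push_cast
      ring
  have h1 := (hA.mul (isExp_eFun.zpow eFun_ne_zero (-n))).sum_shiftEleven
    fun β ↦ w β ^ (-n) * psi (6 * β) ^ (-n)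
  have h2 : hadamard (fun k ↦ ∑ b, w b ^ (-n) * psi (6 * b) ^ (-n) * psi (b * k))
      (A * eSeries ^ (-n)) = ((-11) ^ (-m) : ℂ) •
        hadamard (fun k ↦ chi ((k - 6 * n : ℤ) : ZMod 11)) (A * eSeries ^ (-n)) := by
    ext k
    rw [coeff_hadamard, HahnSeries.coeff_smul, coeff_hadamard, smul_eq_mul, ← mul_assoc]
    congr 1
    have h3 : ∀ b, w b ^ (-n) * psi (6 * b) ^ (-n) * psi (b * k) =
        (-11) ^ (-m - 1) * (w b * psi (b * ((k - 6 * n : ℤ) : ZMod 11))) := fun b ↦ by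
      rw [hwn, ← psi_mul_int, mul_assoc, ← AddChar.map_add_eq_mul, mul_assoc]
      congr 3
      push_cast
      ring
    simp only [h3]
    rw [← Finset.mul_sum, hw, ← mul_assoc, ← zpow_add_one₀ (by norm_num), sub_add_cancel]
  rw [h2] at h1
  have h4 := ((((isExp_phi.zpow phi_ne_zero (-n)).mul hB.comp_elevenMul).const_mul (11 ^ (-n))).add
    (((isExp_eFun.zpow eFun_ne_zero n).mul h1))).const_mul 11⁻¹
  rw [mul_smul_eq] at h4
  refine h4.congr fun τ ↦ ?_
  have h5 : ∀ β, (if β = 0 then 0 else phi (cosetPt (-β⁻¹) (fricke τ)) ^ n *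
      f (cosetPt (-β⁻¹) (fricke τ))) = eFun τ ^ n * (w β ^ (-n) * psi (6 * β) ^ (-n) *
        (f (shiftEleven β τ) * eFun (shiftEleven β τ) ^ (-n))) := fun β ↦ by
    split_ifs with hβ
    · rw [hβ, hw0, zero_zpow _ hn0]; ring
    · rw [hf.apply_cosetPt_fricke hA hβ, hinv, hphi β hβ, mul_zpow, div_zpow, mul_zpow,
        zpow_neg (eFun τ) n, div_inv_eq_mul]
      ring
  have h6 : phi (cosetPt 0 (fricke τ)) ^ n = 11 ^ (-n) * phi τ ^ (-n) := by
    rw [hinv, phi_cosetPt_zero_fricke, mul_zpow]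
  rw [RamanujanEleven.uOp, sum_eq_zero_add, Finset.sum_congr rfl fun β _ ↦ h5 β, ← Finset.mul_sum,
    h6, cosetPt_zero_fricke]
  ring

end

section

/-! ### Modular functions for `Γ₀(11)` -/

lemma IsInv.vadd_one {N : ℕ} {f : ℍ → ℂ} (hf : IsInv N f) (τ : ℍ) : f ((1 : ℝ) +ᵥ τ) = f τ := by
  rw [← hf (slMk 1 1 0 1 (by norm_num)) (slMk_mem_Gamma0.mpr (dvd_zero _)) τ]
  congr 1
  ext
  rw [coe_slMk_smul, coe_vadd]
  push_cast
  ring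

lemma isExp_of_comp_elevenMul_of_periodic {f : ℍ → ℂ} {A : LaurentSeries ℂ}
    (h : IsExp (fun τ ↦ f (elevenMul τ)) A) (hf : ∀ τ, f ((1 : ℝ) +ᵥ τ) = f τ) :
    IsExp f (uSeries A) := by
  refine isExp_of_comp_elevenMul h ?_
  have h1 : hadamard (fun k ↦ psi (1 * k)) A = A := by
    refine (h.comp_shiftEleven 1).unique (h.congr fun τ ↦ ?_)
    rw [← hf (elevenMul τ)]
    congr 1
    ext
    simp only [coe_elevenMul, shiftEleven, coe_vadd]
    rw [ZMod.val_one]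
    push_cast
    ring
  ext k
  rw [vSeries_uSeries, coeff_hadamard]
  split_ifs with hk
  · rw [one_mul]
  · have h2 := congrArg (fun A ↦ HahnSeries.coeff A k) h1
    simp only [coeff_hadamard] at h2
    have h3 : psi (1 * (k : ZMod 11)) ≠ 1 := by
      rw [one_mul, ← AddChar.map_zero_eq_one psi]
      intro h3
      apply hk
      have := (ZMod.intCast_zmod_eq_zero_iff_dvd k 11).mp (ZMod.injective_stdAddChar h3)
      exact_mod_cast this
    rw [zero_mul]
    by_contra h4
    exact h3 (mul_right_cancel₀ h4 (by rw [h2, one_mul]))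

lemma _root_.UpperHalfPlane.IsBoundedAtImInfty.comp_divEleven {f : ℍ → ℂ}
    (hf : IsBoundedAtImInfty f) (b : ℤ) : IsBoundedAtImInfty fun τ ↦ f (divEleven b τ) := by
  rw [isBoundedAtImInfty_iff] at hf ⊢
  obtain ⟨M, A, h⟩ := hf
  refine ⟨M, 11 * A, fun z hz ↦ h _ ?_⟩
  have : (divEleven b z).im = z.im / 11 := by
    rw [← coe_im, coe_divEleven]
    simp [Complex.div_ofNat_im]
  rw [this]
  linarith

/-- A modular function for `Γ₀(11)` without poles is constant. -/
theorem IsInv.eq_const {f : ℍ → ℂ} (hf : IsInv 11 f) {A B : LaurentSeries ℂ} (hA : IsExp f A)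
    (hA0 : OrdGE 0 A) (hB : IsExp (fun τ ↦ f (fricke τ)) B) (hB0 : OrdGE 0 B) :
    ∃ c, ∀ τ, f τ = c := by
  have hslash : ∀ (γ : SL(2, ℤ)) τ, (f ∣[(0 : ℤ)] γ) τ = f (γ • τ) := fun γ τ ↦ by
    rw [ModularForm.SL_slash_apply]; simp
  let F : ModularForm ((CongruenceSubgroup.Gamma0 11).map (Matrix.SpecialLinearGroup.mapGL ℝ)) 0 :=
    { toFun := f
      slash_action_eq' := by
        rintro _ ⟨γ, hγ, rfl⟩
        ext τ
        exact (hslash γ τ).trans (hf γ hγ τ)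
      holo' := hA.mdifferentiable
      bdd_at_cusps' := fun {c} hc ↦ by
        rw [Subgroup.IsArithmetic.isCusp_iff_isCusp_SL2Z] at hc
        rw [OnePoint.isBoundedAt_iff_forall_SL2Z hc]
        intro γ _
        have hfun : f ∣[(0 : ℤ)] γ = fun τ ↦ f (γ • τ) := funext (hslash γ)
        rw [hfun]
        by_cases h11 : (11 : ℤ) ∣ γ 1 0
        · have : (fun τ ↦ f (γ • τ)) = f := funext (hf γ (mem_Gamma0_iff.mpr h11))
          rw [this]
          exact hA.isBoundedAtImInfty hA0
        · have hc0 : ((γ 1 0 : ℤ) : ZMod 11) ≠ 0 := fun h ↦ h11 <| by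
            exact_mod_cast (ZMod.intCast_zmod_eq_zero_iff_dvd _ 11).mp h
          obtain ⟨j, hj⟩ := ZMod.intCast_surjective
            (((γ 1 0 : ℤ) : ZMod 11)⁻¹ * ((γ 1 1 : ℤ) : ZMod 11))
          have hdvd : (11 : ℤ) ∣ γ 1 0 * j - γ 1 1 := by
            rw [show (11 : ℤ) = ((11 : ℕ) : ℤ) from rfl, ← ZMod.intCast_zmod_eq_zero_iff_dvd]
            push_cast
            rw [hj, mul_inv_cancel_left₀ hc0, sub_self]
          have hdet : (γ 0 0 * j - γ 0 1) * γ 1 0 - γ 0 0 * (γ 1 0 * j - γ 1 1) = 1 := by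
            linear_combination sl_det γ
          have : (fun τ ↦ f (γ • τ)) = fun τ ↦ (fun τ ↦ f (fricke τ)) (divEleven j τ) := by
            ext τ
            change _ = f (fricke (divEleven j τ))
            rw [← hf _ (slMk_mem_Gamma0 (h := hdet).mpr hdvd) (fricke (divEleven j τ))]
            congr 1
            have h1 := sl_denom_ne_zero γ τ
            have h2 := slMk_denom_ne_zero hdet (fricke (divEleven j τ))
            have h3 := (divEleven j τ).ne_zero
            have h4 : (τ + j : ℂ) ≠ 0 := by
              intro h; apply h3; rw [coe_divEleven, h, zero_div]
            ext
            rw [coe_slMk_smul, coe_sl_smul, div_eq_div_iff h1 h2]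
            simp only [coe_fricke, coe_divEleven]
            push_cast
            field_simp
            ring
          rw [this]
          exact (hB.isBoundedAtImInfty hB0).comp_divEleven j }
  obtain ⟨c, hc⟩ := ModularForm.eq_const_of_weight_zero F
  exact ⟨c, fun τ ↦ congrFun hc τ⟩

end

section

lemma mul_mem_localSeries {A B : LaurentSeries ℂ} (hA : A ∈ localSeries) (hB : B ∈ localSeries) :
    A * B ∈ localSeries := mul_mem hA hB

lemma pow_mem_localSeries {A : LaurentSeries ℂ} (hA : A ∈ localSeries) (n : ℕ) :
    A ^ n ∈ localSeries := pow_mem hA n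

lemma eSeries_inv :
    eSeries⁻¹ = intSeries (PowerSeries.invOfUnit (PowerSeries.pentagonalSeries ℤ) 1) := by
  refine inv_eq_of_mul_eq_one_right ?_
  rw [eSeries, ← map_mul, PowerSeries.mul_invOfUnit, map_one]
  have h := coeff_eSeries_zero
  rw [eSeries, show (0 : ℤ) = ((0 : ℕ) : ℤ) from rfl, coeff_intSeries] at h
  rw [← PowerSeries.coeff_zero_eq_constantCoeff_apply]
  exact_mod_cast h

lemma eSeries_mem : eSeries ∈ localSeries := intSeries_mem _

lemma eSeries_inv_mem : eSeries⁻¹ ∈ localSeries := by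
  rw [eSeries_inv]
  exact intSeries_mem _

lemma ordGE_eSeries : OrdGE 0 eSeries := ordGE_intSeries _

lemma ordGE_eSeries_inv : OrdGE 0 eSeries⁻¹ := by
  rw [eSeries_inv]
  exact ordGE_intSeries _

lemma coeff_eSeries_inv_zero : eSeries⁻¹.coeff 0 = 1 := by
  have h := coeff_mul_of_ordGE ordGE_eSeries ordGE_eSeries_inv
  rw [mul_inv_cancel₀ eSeries_ne_zero, coeff_eSeries_zero, one_mul] at h
  rw [add_zero] at h
  rw [← h]; simp

lemma isExp_eFun_inv : IsExp (fun τ ↦ (eFun τ)⁻¹) eSeries⁻¹ := isExp_eFun.inv eFun_ne_zero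

lemma vSeries_eSeries_inv : (vSeries eSeries)⁻¹ = vSeries eSeries⁻¹ :=
  (isExp_eFun.comp_elevenMul.inv fun _ ↦ eFun_ne_zero _).unique isExp_eFun_inv.comp_elevenMul

lemma vSeries_vSeries_eSeries_inv : (vSeries (vSeries eSeries))⁻¹ = vSeries (vSeries eSeries⁻¹) :=
  (isExp_eFun.comp_elevenMul.comp_elevenMul.inv fun _ ↦ eFun_ne_zero _).unique
    isExp_eFun_inv.comp_elevenMul.comp_elevenMul

/-- The Laurent series `q ^ d`. -/
noncomputable def qPow (d : ℤ) : LaurentSeries ℂ := HahnSeries.single d 1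

lemma isExp_qPow (d : ℤ) : IsExp (fun τ ↦ nome τ ^ d) (qPow d) := IsExp.single d

lemma coeff_qPow (d n : ℤ) : (qPow d).coeff n = if n = d then 1 else 0 := by
  rw [qPow, HahnSeries.coeff_single]
  congr

lemma coeff_qPow_mul (d : ℤ) (A : LaurentSeries ℂ) (n : ℤ) :
    (qPow d * A).coeff (d + n) = A.coeff n := by
  rw [qPow, add_comm, HahnSeries.coeff_single_mul_add, one_mul]

lemma qPow_mem (d : ℤ) : qPow d ∈ localSeries := fun n ↦ by
  rw [coeff_qPow]
  split_ifs
  exacts [one_mem _, zero_mem _]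

lemma ordGE_qPow (d : ℤ) : OrdGE d (qPow d) := fun _ hn ↦
  HahnSeries.coeff_single_of_ne hn.ne

lemma qPow_inv (d : ℤ) : (qPow d)⁻¹ = qPow (-d) := by
  refine inv_eq_of_mul_eq_one_right ?_
  rw [qPow, qPow, HahnSeries.single_mul_single, add_neg_cancel, one_mul]; rfl

lemma phiSeries_eq : phiSeries = qPow 5 * vSeries (vSeries eSeries) * eSeries⁻¹ :=
  div_eq_mul_inv _ _

lemma phiSeries_inv :
    phiSeries⁻¹ = qPow (-5) * vSeries (vSeries eSeries⁻¹) * eSeries := by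
  rw [phiSeries_eq, mul_inv, mul_inv, qPow_inv, inv_inv, vSeries_vSeries_eSeries_inv]

lemma phiSeries_mem : phiSeries ∈ localSeries := by
  rw [phiSeries_eq]
  exact mul_mem_localSeries
    (mul_mem_localSeries (qPow_mem _) (vSeries_mem (vSeries_mem eSeries_mem))) eSeries_inv_mem

lemma phiSeries_inv_mem : phiSeries⁻¹ ∈ localSeries := by
  rw [phiSeries_inv]
  exact mul_mem_localSeries
    (mul_mem_localSeries (qPow_mem _) (vSeries_mem (vSeries_mem eSeries_inv_mem))) eSeries_mem

lemma ordGE_phiSeries : OrdGE 5 phiSeries := by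
  rw [phiSeries_eq]
  exact (((ordGE_qPow 5).mul ordGE_eSeries.vSeries.vSeries).mul ordGE_eSeries_inv).mono
    (by norm_num)

lemma ordGE_phiSeries_inv : OrdGE (-5) phiSeries⁻¹ := by
  rw [phiSeries_inv]
  exact (((ordGE_qPow (-5)).mul ordGE_eSeries_inv.vSeries.vSeries).mul ordGE_eSeries).mono
    (by norm_num)

/-- The function `(η(11 τ) / η(τ)) ^ 12`. -/
noncomputable def tFun (τ : ℍ) : ℂ := (etaFun (elevenMul τ) / etaFun τ) ^ 12

lemma tFun_ne_zero (τ : ℍ) : tFun τ ≠ 0 :=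
  pow_ne_zero _ (div_ne_zero (etaFun_ne_zero _) (etaFun_ne_zero _))

lemma tFun_eq (τ : ℍ) :
    tFun τ = nome τ ^ (5 : ℤ) * (eFun (elevenMul τ) ^ 12 * (eFun τ)⁻¹ ^ 12) := by
  have h1 := rootNome_ne_zero τ
  have h2 := eFun_ne_zero τ
  rw [tFun, etaFun_eq, etaFun_eq, rootNome_elevenMul, ← rootNome_pow, zpow_ofNat]
  field_simp

/-- The `q`-expansion of `tFun`. -/
noncomputable def tSeries : LaurentSeries ℂ :=
  qPow 5 * (vSeries eSeries ^ 12 * eSeries⁻¹ ^ 12)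

lemma tSeries_eq : tSeries = qPow 5 * (vSeries eSeries ^ 12 * eSeries⁻¹ ^ 12) := by
  rw [tSeries]

lemma isExp_tFun : IsExp tFun tSeries :=
  tSeries_eq ▸ ((isExp_qPow 5).mul
    ((isExp_eFun.comp_elevenMul.pow 12).mul (isExp_eFun_inv.pow 12))).congr tFun_eq

lemma OrdGE.pow {A : LaurentSeries ℂ} {d : ℤ} (hA : OrdGE d A) (n : ℕ) : OrdGE (n * d) (A ^ n) := by
  induction n with
  | zero => simpa using OrdGE.one
  | succ n ih => rw [pow_succ]; convert ih.mul hA using 1; push_cast; ring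

lemma coeff_pow_of_ordGE {A : LaurentSeries ℂ} {d : ℤ} (hA : OrdGE d A) (n : ℕ) :
    (A ^ n).coeff (n * d) = A.coeff d ^ n := by
  induction n with
  | zero => simp
  | succ n ih =>
    have := coeff_mul_of_ordGE (hA.pow n) hA
    rw [ih] at this
    rw [pow_succ, pow_succ, ← this]
    congr 1
    push_cast; ring

lemma tSeries_mem : tSeries ∈ localSeries := by
  rw [tSeries_eq]
  have h1 := pow_mem_localSeries (vSeries_mem eSeries_mem) 12
  have h2 := pow_mem_localSeries eSeries_inv_mem 12
  exact mul_mem_localSeries (qPow_mem 5) (mul_mem_localSeries h1 h2)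

lemma ordGE_tSeries : OrdGE 5 tSeries := by
  rw [tSeries_eq]
  exact ((ordGE_qPow 5).mul ((ordGE_eSeries.vSeries.pow 12).mul (ordGE_eSeries_inv.pow 12))).mono
    (by norm_num)

lemma tSeries_inv :
    tSeries⁻¹ = qPow (-5) * (vSeries eSeries⁻¹ ^ 12 * eSeries ^ 12) := by
  rw [tSeries_eq, mul_inv, mul_inv, qPow_inv, inv_pow, inv_inv, ← inv_pow, vSeries_eSeries_inv]

lemma tSeries_inv_mem : tSeries⁻¹ ∈ localSeries := by
  rw [tSeries_inv]
  have h1 := pow_mem_localSeries (vSeries_mem eSeries_inv_mem) 12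
  have h2 := pow_mem_localSeries eSeries_mem 12
  exact mul_mem_localSeries (qPow_mem (-5)) (mul_mem_localSeries h1 h2)

lemma ordGE_tSeries_inv : OrdGE (-5) tSeries⁻¹ := by
  rw [tSeries_inv]
  exact ((ordGE_qPow (-5)).mul ((ordGE_eSeries_inv.vSeries.pow 12).mul (ordGE_eSeries.pow 12))).mono
    (by norm_num)

lemma coeff_tSeries : tSeries.coeff 5 = 1 := by
  have h1 : OrdGE 0 (vSeries eSeries ^ 12 * eSeries⁻¹ ^ 12) :=
    ((ordGE_eSeries.vSeries.pow 12).mul (ordGE_eSeries_inv.pow 12)).mono (by norm_num)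
  have h2 : (vSeries eSeries).coeff 0 = 1 := by simp [coeff_vSeries, coeff_eSeries_zero]
  have h3 := coeff_mul_of_ordGE (ordGE_qPow 5) h1
  have h4 := coeff_mul_of_ordGE (ordGE_eSeries.vSeries.pow 12) (ordGE_eSeries_inv.pow 12)
  rw [coeff_pow_of_ordGE ordGE_eSeries_inv, coeff_pow_of_ordGE ordGE_eSeries.vSeries,
    coeff_eSeries_inv_zero, mul_zero, h2] at h4
  simp only [mul_zero, add_zero, one_pow, mul_one] at h4
  rw [h4, add_zero, coeff_qPow, if_pos rfl, mul_one] at h3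
  rw [tSeries_eq]; exact h3

lemma tFun_fricke (τ : ℍ) : tFun (fricke τ) = 11 ^ (-6 : ℤ) * (tFun τ)⁻¹ := by
  have hτ := τ.ne_zero
  have h1 : (elevenMul (fricke τ) : ℂ) = -1 / τ := by simp; field_simp
  have h2 : (fricke τ : ℂ) = -1 / (elevenMul τ : ℍ) := by simp
  have h3 : ∀ z : ℂ, z ≠ 0 → sqrt z ^ 12 = z ^ 6 := fun z hz ↦ by
    rw [sqrt_eq_exp hz, ← Complex.exp_nat_mul]
    nth_rewrite 2 [← Complex.exp_log hz]
    rw [← Complex.exp_nat_mul]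
    congr 1
    push_cast
    ring
  have h5 : sqrt Complex.I ≠ 0 := by rw [sqrt_eq_exp I_ne_zero]; exact exp_ne_zero _
  have h6 := etaFun_ne_zero τ
  have h7 := etaFun_ne_zero (elevenMul τ)
  rw [tFun, etaFun_of_coe_eq h1, etaFun_of_coe_eq h2, tFun]
  simp only [div_pow, mul_pow]
  rw [h3 _ hτ, h3 _ (elevenMul τ).ne_zero, coe_elevenMul]
  rw [zpow_neg, zpow_ofNat]
  field_simp

lemma isExp_tFun_fricke :
    IsExp (fun τ ↦ tFun (fricke τ)) ((11 ^ (-6 : ℤ) : ℂ) • tSeries⁻¹) :=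
  ((isExp_tFun.inv tFun_ne_zero).const_mul _).congr tFun_fricke

lemma tFun_sq_smul {γ : SL(2, ℤ)} (hγ : γ ∈ CongruenceSubgroup.Gamma0 11) (τ : ℍ) :
    tFun (γ • τ) ^ 2 = tFun τ ^ 2 := by
  obtain ⟨k, hk⟩ : (11 : ℤ) ∣ γ 1 0 := mem_Gamma0_iff.mp hγ
  have hdet := sl_det γ
  have hγ' : γ 0 0 * γ 1 1 - (11 * γ 0 1) * k = 1 := by rw [hk] at hdet; linarith
  have h2 := sl_denom_ne_zero γ τ
  have h0 : elevenMul (γ • τ) = slMk _ _ _ _ hγ' • elevenMul τ := by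
    have h1 := slMk_denom_ne_zero hγ' (elevenMul τ)
    ext
    rw [coe_slMk_smul]
    simp only [coe_elevenMul, coe_sl_smul] at h1 ⊢
    rw [mul_div_assoc', div_eq_div_iff h2 h1, hk]
    push_cast
    ring
  have h3 := etaFun_ne_zero τ
  rw [tFun, tFun, ← pow_mul, ← pow_mul, div_pow, div_pow, h0]
  norm_num only
  rw [etaFun_pow_smul, etaFun_pow_smul]
  have h5 : ((slMk _ _ _ _ hγ' 1 0 : ℤ) : ℂ) * (elevenMul τ) +
      ((slMk _ _ _ _ hγ' 1 1 : ℤ) : ℂ) = γ 1 0 * τ + γ 1 1 := by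
    change (k : ℂ) * _ + γ 1 1 = _
    rw [hk, coe_elevenMul]; push_cast; ring
  rw [h5]
  field_simp

lemma hadamard_ordGE_prod {f : ℍ → ℂ} {A : LaurentSeries ℂ} (hf : IsExp f A) {d : ℤ}
    (hA : OrdGE d A) : ∃ B, IsExp (fun τ ↦ ∏ b, f (shiftEleven b τ)) B ∧ OrdGE (11 * d) B := by
  refine ⟨_, IsExp.prod Finset.univ fun b _ ↦ hf.comp_shiftEleven b, ?_⟩
  have : ∀ s : Finset (ZMod 11),
      OrdGE (s.card * d) (∏ b ∈ s, hadamard (fun k ↦ psi (b * k)) A) := fun s ↦ by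
    induction s using Finset.induction_on with
    | empty => simpa using OrdGE.one
    | insert b s hb ih =>
      rw [Finset.prod_insert hb, Finset.card_insert_of_notMem hb]
      convert (hA.hadamard fun k ↦ psi (b * k)).mul ih using 1
      push_cast; ring
  simpa [ZMod.card] using this Finset.univ

lemma isInv_tFun : IsInv 11 tFun := by
  set N : ℍ → ℂ := fun τ ↦ ∏ b, (phi (cosetPt b τ))⁻¹ with hN
  have hNinv : IsInv 11 N := by
    refine IsInv.symm_cosetPt (f := fun τ ↦ (phi τ)⁻¹) (F := fun x ↦ ∏ b, x b)
      (fun γ hγ τ ↦ by simp only [isInv_phi γ hγ τ]) fun σ x ↦ ?_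
    exact Equiv.prod_comp σ x
  have hN0 : ∀ τ, N τ ≠ 0 := fun τ ↦
    Finset.prod_ne_zero_iff.mpr fun b _ ↦ inv_ne_zero (phi_ne_zero _)
  obtain ⟨A, hA, hA0⟩ := hadamard_ordGE_prod (isExp_phi.inv phi_ne_zero) ordGE_phiSeries_inv
  have hNexp : IsExp N (uSeries A) := by
    refine isExp_of_comp_elevenMul_of_periodic ?_ hNinv.vadd_one
    simpa only [hN, cosetPt_elevenMul] using hA
  have hNord : OrdGE (-5) (uSeries A) := hA0.uSeries (by norm_num)
  obtain ⟨w, hw0, -, -, hphi⟩ := exists_weights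
  have hNW : ∃ B, IsExp (fun τ ↦ N (fricke τ)) B ∧ OrdGE 5 B := by
    have hexp : ∀ β ≠ 0, IsExp (fun τ ↦ (phi (cosetPt (-β⁻¹) (fricke τ)))⁻¹)
        (w β • (psi (6 * β) • (hadamard (fun k ↦ psi (β * k)) eSeries * eSeries⁻¹))) :=
        fun β hβ ↦ by
      refine ((((isExp_eFun.comp_shiftEleven β).mul isExp_eFun_inv).const_mul _).const_mul _).congr
        fun τ ↦ ?_
      rw [hphi β hβ]; ring
    have h1 := (isExp_phi.const_mul 11).mul (IsExp.prod ({0}ᶜ : Finset (ZMod 11))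
      fun β hβ ↦ hexp β (by simpa using hβ))
    refine ⟨_, h1.congr fun τ ↦ ?_, ?_⟩
    · have h : Function.Involutive fun β : ZMod 11 ↦ -β⁻¹ := fun β ↦ by simp
      rw [hN]
      simp only
      rw [← Equiv.prod_comp h.toPerm, Fintype.prod_eq_mul_prod_compl 0, ← phi_cosetPt_zero_fricke]
      simp
    · rw [← add_zero 5]
      refine (ordGE_phiSeries.smul _).mul ?_
      refine Finset.prod_induction _ (OrdGE 0) (fun A B hA hB ↦ by simpa using hA.mul hB) OrdGE.one
        fun β _ ↦ ?_
      exact (((ordGE_eSeries.hadamard _).mul ordGE_eSeries_inv).smul _).smul _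
  obtain ⟨B, hB, hB0⟩ := hNW
  obtain ⟨c, hc⟩ := IsInv.eq_const (f := fun τ ↦ (N τ * tFun τ) ^ 2)
    (fun γ hγ τ ↦ by simp only [mul_pow, hNinv γ hγ, tFun_sq_smul hγ])
    ((hNexp.mul isExp_tFun).pow 2) (by simpa using (hNord.mul ordGE_tSeries).pow 2)
    ((hB.mul isExp_tFun_fricke).pow 2) (by simpa using (hB0.mul (ordGE_tSeries_inv.smul _)).pow 2)
  obtain ⟨v, -, hv⟩ := exists_const_of_pow_eq (hNexp.mul isExp_tFun).continuous two_pos hc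
  have ht : ∀ τ, tFun τ = v / N τ := fun τ ↦ by
    rw [← hv τ, mul_comm, mul_div_cancel_right₀ _ (hN0 τ)]
  intro γ hγ τ
  rw [ht, ht, hNinv γ hγ]

end

section

lemma zpow_smul_mem_mono {a b : ℤ} (h : a ≤ b) {B : LaurentSeries ℂ}
    (hB : (11 : ℂ) ^ a • B ∈ localSeries) : (11 : ℂ) ^ b • B ∈ localSeries := by
  have := smul_mem_localSeries (zpow_mem_localRing (sub_nonneg.mpr h)) hB
  rwa [smul_smul, ← zpow_add₀ (by norm_num), sub_add_cancel] at this

lemma vSeries_smul (c : ℂ) (A : LaurentSeries ℂ) : vSeries (c • A) = c • vSeries A := by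
  ext n
  rw [coeff_vSeries, HahnSeries.coeff_smul, HahnSeries.coeff_smul, coeff_vSeries]
  split_ifs <;> simp

lemma smul_mul_eq (c : ℂ) (A B : LaurentSeries ℂ) : (c • A) * B = c • (A * B) := by
  rw [mul_comm, mul_smul_eq, mul_comm]

lemma chi_mem (m : ZMod 11) : chi m ∈ localRing := intCast_mem_localRing _

/-- `f` is a modular function for `Γ₀(11)` whose expansion at `∞` is `11`-integral of order at
least `d`, and whose expansion at `0` becomes `11`-integral after multiplication by `11 ^ a`. -/
structure Adm (a d : ℤ) (f : ℍ → ℂ) : Prop where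
  inv : IsInv 11 f
  exp : ∃ A, IsExp f A ∧ A ∈ localSeries ∧ OrdGE d A
  exp_fricke : ∃ B, IsExp (fun τ ↦ f (fricke τ)) B ∧ (11 : ℂ) ^ a • B ∈ localSeries

namespace Adm

variable {a b d e : ℤ} {f g : ℍ → ℂ}

lemma mono (hf : Adm a d f) (h : a ≤ b) (h' : e ≤ d) : Adm b e f := by
  obtain ⟨hi, ⟨A, hA, hA1, hA2⟩, B, hB, hB1⟩ := hf
  exact ⟨hi, ⟨A, hA, hA1, hA2.mono h'⟩, B, hB, zpow_smul_mem_mono h hB1⟩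

lemma zero : Adm a d 0 :=
  ⟨fun _ _ _ ↦ rfl, ⟨0, IsExp.zero, zero_mem _, OrdGE.zero _⟩, 0, IsExp.zero, by
    rw [smul_zero]; exact zero_mem _⟩

lemma one : Adm 0 0 1 :=
  ⟨fun _ _ _ ↦ rfl, ⟨1, IsExp.one, one_mem _, OrdGE.one⟩, 1, IsExp.one, by
    rw [zpow_zero, one_smul]; exact one_mem _⟩

lemma mul (hf : Adm a d f) (hg : Adm b e g) : Adm (a + b) (d + e) (f * g) := by
  obtain ⟨hi, ⟨A, hA, hA1, hA2⟩, B, hB, hB1⟩ := hf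
  obtain ⟨hi', ⟨A', hA', hA1', hA2'⟩, B', hB', hB1'⟩ := hg
  refine ⟨fun γ hγ τ ↦ ?_, ⟨_, hA.mul hA', mul_mem_localSeries hA1 hA1', hA2.mul hA2'⟩,
    _, hB.mul hB', ?_⟩
  · simp only [Pi.mul_apply, hi γ hγ, hi' γ hγ]
  · have := mul_mem_localSeries hB1 hB1'
    rwa [smul_mul_eq, mul_smul_eq, smul_smul, ← zpow_add₀ (by norm_num)] at this

lemma smul {c : ℂ} (hc : c ∈ localRing) (hf : Adm a d f) : Adm a d (c • f) := by
  obtain ⟨hi, ⟨A, hA, hA1, hA2⟩, B, hB, hB1⟩ := hf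
  refine ⟨fun γ hγ τ ↦ ?_, ⟨_, hA.const_mul c, smul_mem_localSeries hc hA1, hA2.smul c⟩,
    _, hB.const_mul c, ?_⟩
  · simp only [Pi.smul_apply, hi γ hγ]
  · rw [smul_comm]; exact smul_mem_localSeries hc hB1

lemma pow (hf : Adm a d f) (n : ℕ) : Adm (n * a) (n * d) (f ^ n) := by
  induction n with
  | zero => simpa using one
  | succ n ih =>
    rw [pow_succ]
    exact (ih.mul hf).mono (by push_cast; linarith) (by push_cast; linarith)

lemma uOp (hf : Adm a d f) (h1 : a + 1 ≤ b) (h2 : 1 ≤ b) (h3 : 11 * e ≤ d + 10) :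
    Adm b e (RamanujanEleven.uOp f) := by
  obtain ⟨hi, ⟨A, hA, hA1, hA2⟩, B, hB, hB1⟩ := hf
  refine ⟨(hi.mono (by norm_num)).uOp, ⟨_, hA.uOp, uSeries_mem hA1, hA2.uSeries h3⟩,
    _, hi.isExp_uOp_fricke hA hB, ?_⟩
  have key : ((11 : ℂ) ^ (b : ℤ)) * 11⁻¹ = 11 ^ (b - 1) := (zpow_sub_one₀ (by norm_num) _).symm
  rw [smul_add, smul_sub, smul_smul, smul_smul, key, ← vSeries_smul]
  refine add_mem (vSeries_mem (zpow_smul_mem_mono (by omega) hB1)) (sub_mem ?_ ?_)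
  · exact smul_mem_localSeries (zpow_mem_localRing (by omega)) (vSeries_mem (uSeries_mem hA1))
  · exact smul_mem_localSeries (zpow_mem_localRing (by omega)) hA1

lemma uOp_phi (hf : Adm a d f) (h1 : a + 2 ≤ b) (h2 : 1 ≤ b) (h3 : 11 * e ≤ d + 15) :
    Adm b e (RamanujanEleven.uOp (phi * f)) := by
  obtain ⟨hi, ⟨A, hA, hA1, hA2⟩, B, hB, hB1⟩ := hf
  have hinv : IsInv 121 (phi * f) := fun γ hγ τ ↦ by
    rw [Pi.mul_apply, Pi.mul_apply, isInv_phi γ hγ, hi.mono (by norm_num) γ hγ]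
  have hW := hi.isExp_uOp_phi_fricke hA hB (n := 1) (m := 0) (by norm_num)
  simp only [zpow_one] at hW
  refine ⟨hinv.uOp, ⟨_, (isExp_phi.mul hA).uOp, uSeries_mem (mul_mem_localSeries phiSeries_mem hA1),
    (ordGE_phiSeries.mul hA2).uSeries (by omega)⟩, _, hW, ?_⟩
  have key : ((11 : ℂ) ^ (b : ℤ)) * 11⁻¹ = 11 ^ (b - 1) := (zpow_sub_one₀ (by norm_num) _).symm
  have key2 : ((11 : ℂ) ^ (b - 1 : ℤ)) * 11 ^ (-1 : ℤ) = 11 ^ (b - 2) := by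
    rw [← zpow_add₀ (by norm_num)]; congr 1; ring
  rw [smul_smul, key, smul_add, smul_smul, key2, ← mul_smul_eq, ← vSeries_smul, zpow_neg_one,
    neg_zero, zpow_zero, one_smul, zpow_neg_one]
  refine add_mem (mul_mem_localSeries phiSeries_inv_mem
    (vSeries_mem (zpow_smul_mem_mono (by omega) hB1))) ?_
  refine smul_mem_localSeries (zpow_mem_localRing (by omega)) (mul_mem_localSeries eSeries_mem ?_)
  exact hadamard_mem (fun _ ↦ chi_mem _) (mul_mem_localSeries hA1 eSeries_inv_mem)

end Adm

lemma adm_tFun : Adm 6 5 tFun := by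
  refine ⟨isInv_tFun, ⟨_, isExp_tFun, tSeries_mem, ordGE_tSeries⟩, _, isExp_tFun_fricke, ?_⟩
  rw [smul_smul, ← zpow_add₀ (by norm_num)]
  norm_num only
  rw [one_smul]
  exact tSeries_inv_mem

lemma tFun_fricke' (τ : ℍ) : (tFun (fricke τ))⁻¹ = 11 ^ (6 : ℤ) * tFun τ := by
  rw [tFun_fricke, mul_inv, inv_inv, ← zpow_neg, neg_neg]

lemma adm_tFun_inv : Adm (-6) (-5) tFun⁻¹ := by
  refine ⟨fun γ hγ τ ↦ ?_, ⟨_, isExp_tFun.inv tFun_ne_zero, tSeries_inv_mem, ordGE_tSeries_inv⟩, _,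
    (isExp_tFun.const_mul (11 ^ (6 : ℤ))).congr tFun_fricke', ?_⟩
  · rw [Pi.inv_apply, Pi.inv_apply, isInv_tFun γ hγ]
  · rw [smul_smul, ← zpow_add₀ (by norm_num)]
    norm_num only
    rw [one_smul]
    exact tSeries_mem

end

section

/-- Euler's pentagonal series `∏ (1 - X ^ n)`. -/
noncomputable def eInt : PowerSeries ℤ := PowerSeries.pentagonalSeries ℤ

/-- The inverse of Euler's pentagonal series. -/
noncomputable def eInvInt : PowerSeries ℤ := PowerSeries.invOfUnit eInt 1

/-- The substitution `X ↦ X ^ 11`. -/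
noncomputable def vInt (A : PowerSeries ℤ) : PowerSeries ℤ :=
  PowerSeries.mk fun n ↦ if 11 ∣ n then PowerSeries.coeff (n / 11) A else 0

/-- The series formed by every eleventh coefficient. -/
noncomputable def uInt (A : PowerSeries ℤ) : PowerSeries ℤ :=
  PowerSeries.mk fun n ↦ PowerSeries.coeff (11 * n) A

/-- Twist the coefficients of a power series by the quadratic character of `ℤ/11`, shifted by
`s`. -/
noncomputable def twistInt (s : ℕ) (A : PowerSeries ℤ) : PowerSeries ℤ :=
  PowerSeries.mk fun n ↦ quadraticChar (ZMod 11) ((n + s : ℕ) : ZMod 11) * PowerSeries.coeff n A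

lemma eSeries_eq : eSeries = intSeries eInt := rfl

lemma eSeries_inv_eq : eSeries⁻¹ = intSeries eInvInt := eSeries_inv

lemma intSeries_ext {A : PowerSeries ℤ} {B : LaurentSeries ℂ} (hB : OrdGE 0 B)
    (h : ∀ n : ℕ, B.coeff n = PowerSeries.coeff n A) : B = intSeries A := by
  ext n
  rcases lt_or_ge n 0 with hn | hn
  · rw [hB n hn, ordGE_intSeries A n hn]
  · lift n to ℕ using hn
    rw [h, coeff_intSeries]

lemma vSeries_intSeries (A : PowerSeries ℤ) : vSeries (intSeries A) = intSeries (vInt A) := by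
  refine intSeries_ext ((ordGE_intSeries A).vSeries) fun n ↦ ?_
  rw [coeff_vSeries, vInt, PowerSeries.coeff_mk]
  by_cases h : 11 ∣ n
  · rw [if_pos h, if_pos (by exact_mod_cast h)]
    exact_mod_cast coeff_intSeries A (n / 11)
  · rw [if_neg h, if_neg (by exact_mod_cast h), Int.cast_zero]

lemma uSeries_intSeries (A : PowerSeries ℤ) : uSeries (intSeries A) = intSeries (uInt A) := by
  refine intSeries_ext ((ordGE_intSeries A).uSeries (by norm_num)) fun n ↦ ?_
  rw [coeff_uSeries, uInt, PowerSeries.coeff_mk]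
  exact_mod_cast coeff_intSeries A (11 * n)

lemma hadamard_chi_intSeries {c : ℤ → ZMod 11} {s : ℕ} (hc : ∀ n : ℕ, c n = ((n + s : ℕ) : ZMod 11))
    (A : PowerSeries ℤ) :
    hadamard (fun k ↦ chi (c k)) (intSeries A) = intSeries (twistInt s A) := by
  refine intSeries_ext ((ordGE_intSeries A).hadamard _) fun n ↦ ?_
  rw [coeff_hadamard, coeff_intSeries, twistInt, PowerSeries.coeff_mk, hc, chi]
  push_cast; ring

lemma smul_intSeries (m : ℤ) (A : PowerSeries ℤ) :
    (m : ℂ) • intSeries A = intSeries (PowerSeries.C m * A) := by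
  refine intSeries_ext ((ordGE_intSeries A).smul _) fun n ↦ ?_
  rw [HahnSeries.coeff_smul, coeff_intSeries, PowerSeries.coeff_C_mul]
  push_cast; rfl

lemma qPow_eq (d : ℕ) : qPow d = intSeries (PowerSeries.X ^ d) := by
  refine intSeries_ext ((ordGE_qPow d).mono (by positivity)) fun n ↦ ?_
  rw [coeff_qPow, PowerSeries.coeff_X_pow]
  split_ifs <;> simp_all

/-- The integral power series of `phi`. -/
noncomputable def phiInt : PowerSeries ℤ := PowerSeries.X ^ 5 * (vInt (vInt eInt) * eInvInt)

lemma phiSeries_eq_intSeries : phiSeries = intSeries phiInt := by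
  rw [phiSeries_eq, eSeries_inv_eq, eSeries_eq, vSeries_intSeries, vSeries_intSeries,
    show (5 : ℤ) = ((5 : ℕ) : ℤ) from rfl, qPow_eq, phiInt, map_mul, map_mul, mul_assoc]

/-- The integral power series of `tFun`. -/
noncomputable def tInt : PowerSeries ℤ := PowerSeries.X ^ 5 * (vInt eInt ^ 12 * eInvInt ^ 12)

lemma tSeries_eq_intSeries : tSeries = intSeries tInt := by
  rw [tSeries_eq, eSeries_inv_eq, eSeries_eq, vSeries_intSeries,
    show (5 : ℤ) = ((5 : ℕ) : ℤ) from rfl, qPow_eq, tInt]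
  simp only [map_mul, map_pow]

lemma IsInv.comp_fricke {f : ℍ → ℂ} (hf : IsInv 11 f) : IsInv 11 fun τ ↦ f (fricke τ) := by
  intro γ hγ τ
  obtain ⟨k, hk⟩ : (11 : ℤ) ∣ γ 1 0 := mem_Gamma0_iff.mp hγ
  have hdet := sl_det γ
  have hγ' : γ 1 1 * γ 0 0 - (-k) * (-11 * γ 0 1) = 1 := by rw [hk] at hdet; linarith
  have h2 := sl_denom_ne_zero γ τ
  have h0 : fricke (γ • τ) = slMk _ _ _ _ hγ' • fricke τ := by
    have h1 := slMk_denom_ne_zero hγ' (fricke τ)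
    have h3 := τ.ne_zero
    have h4 := (γ • τ).ne_zero
    ext
    rw [coe_slMk_smul]
    simp only [coe_fricke, coe_sl_smul] at h1 h4 ⊢
    have h5 : ((γ 0 0 : ℤ) : ℂ) * τ + (γ 0 1 : ℤ) ≠ 0 := fun h ↦ h4 (by rw [h, zero_div])
    rw [hk] at h2 ⊢
    push_cast at h1 h2 ⊢
    rw [eq_div_iff h1]
    field_simp
    ring
  have hmem : slMk _ _ _ _ hγ' ∈ CongruenceSubgroup.Gamma0 11 := by
    rw [mem_Gamma0_iff]
    exact ⟨-γ 0 1, by change -11 * γ 0 1 = _; ring⟩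
  change f (fricke (γ • τ)) = f (fricke τ)
  rw [h0, hf _ hmem]

end

section

/-- The polynomial with the given list of coefficients, as a power series. -/
noncomputable def ofList (l : List ℤ) : PowerSeries ℤ := PowerSeries.mk fun n ↦ l.getD n 0

/-- The first `N` coefficients of `A` are congruent modulo `M` to the entries of `l`. -/
def Approx (M : ℤ) (N : ℕ) (A : PowerSeries ℤ) (l : List ℤ) : Prop :=
  ∀ n < N, PowerSeries.coeff n A ≡ l.getD n 0 [ZMOD M]

/-- Entrywise sum of lists of coefficients. -/
def listAdd : List ℤ → List ℤ → List ℤ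
  | [], b => b
  | a, [] => a
  | a :: as, b :: bs => (a + b) :: listAdd as bs

/-- Dot product of lists of coefficients. -/
def listDot : List ℤ → List ℤ → ℤ
  | a :: as, b :: bs => a * b + listDot as bs
  | _, _ => 0

/-- `N` coefficients modulo `M` of a product, where `r` is the reversed list of the coefficients
of the second factor that have already been read. -/
def listMulAux (M : ℤ) (a : List ℤ) : ℕ → List ℤ → List ℤ → List ℤ
  | 0, _, _ => []
  | N + 1, r, [] => listDot a (0 :: r) % M :: listMulAux M a N (0 :: r) []
  | N + 1, r, b :: bs => listDot a (b :: r) % M :: listMulAux M a N (b :: r) bs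

/-- Product of lists of coefficients, reduced modulo `M` and truncated to length `N`. -/
def listMul (M : ℤ) (N : ℕ) (a b : List ℤ) : List ℤ := listMulAux M a N [] b

lemma getD_listAdd (a b : List ℤ) (n : ℕ) :
    (listAdd a b).getD n 0 = a.getD n 0 + b.getD n 0 := by
  induction a generalizing b n with
  | nil => simp [listAdd]
  | cons x as ih =>
    cases b with
    | nil => simp [listAdd]
    | cons y bs => cases n <;> simp_all [listAdd]

lemma getD_map_mod (M : ℤ) (a : List ℤ) (n : ℕ) :
    (a.map (· % M)).getD n 0 ≡ a.getD n 0 [ZMOD M] := by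
  have h := List.getD_map (l := a) (d := 0) (n := n) (· % M)
  rw [Int.zero_emod] at h
  rw [h]
  exact Int.mod_modEq _ _

lemma getD_map_mul (c : ℤ) (a : List ℤ) (n : ℕ) :
    (a.map (c * ·)).getD n 0 = c * a.getD n 0 := by
  have h := List.getD_map (l := a) (d := 0) (n := n) (c * ·)
  rwa [mul_zero] at h

lemma listDot_cons (a : List ℤ) (b : ℤ) (r : List ℤ) (n : ℕ) :
    listDot (a.drop n) (b :: r) = a.getD n 0 * b + listDot (a.drop (n + 1)) r := by
  induction n generalizing a with
  | zero => cases a <;> simp [listDot]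
  | succ n ih =>
    cases a with
    | nil => simp [listDot]
    | cons x a => simpa using ih a

lemma getD_listMulAux {M : ℤ} {a : List ℤ} {N : ℕ} {r b : List ℤ} {n : ℕ} (hn : n < N) :
    (listMulAux M a N r b).getD n 0 ≡
      ∑ i ∈ Finset.range (n + 1), a.getD i 0 * b.getD (n - i) 0 + listDot (a.drop (n + 1)) r
      [ZMOD M] := by
  induction N generalizing r b n with
  | zero => omega
  | succ N ih =>
    have key (c : ℤ) (cs : List ℤ) : (listDot a (c :: r) % M :: listMulAux M a N (c :: r) cs).getD
        n 0 ≡ ∑ i ∈ Finset.range (n + 1), a.getD i 0 * (c :: cs).getD (n - i) 0 +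
          listDot (a.drop (n + 1)) r [ZMOD M] := by
      have h0 := listDot_cons a c r
      cases n with
      | zero =>
        have h1 := h0 0
        rw [List.drop_zero, zero_add] at h1
        simpa [h1] using Int.mod_modEq _ _
      | succ n =>
        rw [Finset.sum_range_succ, Nat.sub_self, List.getD_cons_zero, add_assoc, ← h0,
          List.getD_cons_succ]
        have h2 : ∑ i ∈ Finset.range (n + 1), a.getD i 0 * (c :: cs).getD (n + 1 - i) 0 =
            ∑ i ∈ Finset.range (n + 1), a.getD i 0 * cs.getD (n - i) 0 := by
          refine Finset.sum_congr rfl fun i hi ↦ ?_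
          rw [Nat.succ_sub (Finset.mem_range_succ_iff.mp hi), List.getD_cons_succ]
        rw [h2]
        exact ih (by omega)
    cases b with
    | nil =>
      have h := key 0 []
      rw [listMulAux]
      refine h.trans (congrArg (· % M) ?_)
      congr 1
      refine Finset.sum_congr rfl fun i _ ↦ ?_
      cases n - i <;> simp
    | cons c cs => exact key c cs

namespace Approx

variable {M : ℤ} {N : ℕ} {A B : PowerSeries ℤ} {a b : List ℤ}

lemma ofList_mul_ofList (M : ℤ) (N : ℕ) (a b : List ℤ) :
    Approx M N (ofList a * ofList b) (listMul M N a b) := by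
  intro n hn
  refine Int.ModEq.trans ?_ (getD_listMulAux hn).symm
  rw [PowerSeries.coeff_mul, Finset.Nat.sum_antidiagonal_eq_sum_range_succ_mk]
  simp [ofList, listDot]

lemma congr_mul {A' B' : PowerSeries ℤ}
    (hA : ∀ n < N, PowerSeries.coeff n A ≡ PowerSeries.coeff n A' [ZMOD M])
    (hB : ∀ n < N, PowerSeries.coeff n B ≡ PowerSeries.coeff n B' [ZMOD M]) :
    ∀ n < N, PowerSeries.coeff n (A * B) ≡ PowerSeries.coeff n (A' * B') [ZMOD M] := by
  intro n hn
  rw [PowerSeries.coeff_mul, PowerSeries.coeff_mul]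
  refine Int.ModEq.sum fun i hi ↦ ?_
  have := Finset.HasAntidiagonal.mem_antidiagonal.mp hi
  exact (hA _ (by omega)).mul (hB _ (by omega))

lemma mul (hA : Approx M N A a) (hB : Approx M N B b) :
    Approx M N (A * B) (listMul M N a b) := fun n hn ↦
  (congr_mul (A' := ofList a) (B' := ofList b) (by simpa [Approx, ofList] using hA)
    (by simpa [Approx, ofList] using hB) n hn).trans (ofList_mul_ofList M N a b n hn)

lemma zero : Approx M N 0 [] := fun n _ ↦ by simp

lemma one : Approx M N 1 [1] := fun n _ ↦ by
  rw [PowerSeries.coeff_one]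
  cases n <;> simp

lemma mono {M' : ℤ} {N' : ℕ} (hA : Approx M N A a) (hN : N' ≤ N) (hM : M' ∣ M) :
    Approx M' N' A a := fun n hn ↦ (hA n (by omega)).of_dvd hM

lemma smul_add {c : ℤ} (hA : Approx M N A a) (hB : Approx M N B b) :
    Approx M N (PowerSeries.C c * A + B) ((listAdd (a.map (c * ·)) b).map (· % M)) := by
  intro n hn
  refine Int.ModEq.trans ?_ (getD_map_mod _ _ _).symm
  rw [getD_listAdd, getD_map_mul, map_add, PowerSeries.coeff_C_mul]
  exact ((hA n hn).mul_left c).add (hB n hn)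

/-- Inverses can be computed modulo `M` by checking a product of lists. -/
lemma of_mul_eq_one (hA : Approx M N A a) (hAB : A * B = 1)
    (h : ∀ n < N, (listMul M N a b).getD n 0 = if n = 0 then 1 else 0) : Approx M N B b := by
  have h1 : ∀ n < N, PowerSeries.coeff n (A * ofList b) ≡ PowerSeries.coeff n 1 [ZMOD M] := by
    intro n hn
    have h2 := hA.mul (show Approx M N (ofList b) b from fun n _ ↦ by simp [ofList]) n hn
    rwa [h n hn, ← PowerSeries.coeff_one] at h2
  intro n hn
  have h2 := congr_mul h1 (B := B) (B' := B) (fun _ _ ↦ rfl) n hn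
  rw [one_mul, mul_right_comm, hAB, one_mul] at h2
  simpa [ofList] using h2.symm

end Approx

end

section

/-- Powers of lists of coefficients, reduced modulo `M` and truncated to length `N`. -/
def listPow (M : ℤ) (N : ℕ) (a : List ℤ) : ℕ → List ℤ
  | 0 => [1]
  | k + 1 => listMul M N (listPow M N a k) a

/-- The list of coefficients after the substitution `X ↦ X ^ 11`. -/
def listV (N : ℕ) (a : List ℤ) : List ℤ :=
  (List.range N).map fun n ↦ if 11 ∣ n then a.getD (n / 11) 0 else 0

/-- The list of every eleventh coefficient. -/
def listU (N : ℕ) (a : List ℤ) : List ℤ := (List.range N).map fun n ↦ a.getD (11 * n) 0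

/-- The values of the quadratic character modulo `11`. -/
def charEleven (n : ℕ) : ℤ := [0, 1, -1, 1, 1, 1, -1, -1, -1, 1, -1].getD (n % 11) 0

/-- The list of coefficients twisted by the quadratic character modulo `11`. -/
def listTwist (N s : ℕ) (a : List ℤ) : List ℤ :=
  (List.range N).map fun n ↦ charEleven (n + s) * a.getD n 0

lemma getD_map_range {N n : ℕ} (hn : n < N) (f : ℕ → ℤ) :
    ((List.range N).map f).getD n 0 = f n := by
  simp [List.getD_eq_getElem?_getD, hn]

lemma quadraticChar_eq (n : ℕ) : quadraticChar (ZMod 11) (n : ZMod 11) = charEleven n := by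
  have h : ∀ k < 11, quadraticChar (ZMod 11) ((k : ℕ) : ZMod 11) = charEleven k := by decide
  rw [← ZMod.natCast_mod, h _ (Nat.mod_lt _ (by norm_num)), charEleven, charEleven, Nat.mod_mod]

namespace Approx

variable {M : ℤ} {N : ℕ} {A B : PowerSeries ℤ} {a b : List ℤ}

lemma of_eq (hA : Approx M N A a) (h : a = b) : Approx M N A b := h ▸ hA

lemma pow (hA : Approx M N A a) (k : ℕ) : Approx M N (A ^ k) (listPow M N a k) := by
  induction k with
  | zero => rw [pow_zero]; exact one
  | succ k ih => rw [pow_succ]; exact ih.mul hA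

lemma vInt (hA : Approx M N A a) : Approx M N (RamanujanEleven.vInt A) (listV N a) := by
  intro n hn
  rw [listV, getD_map_range hn, RamanujanEleven.vInt, PowerSeries.coeff_mk]
  split_ifs with h
  · exact hA _ (by omega)
  · rfl

lemma uInt (hA : Approx M (11 * N - 10) A a) :
    Approx M N (RamanujanEleven.uInt A) (listU N a) := by
  intro n hn
  rw [listU, getD_map_range hn, RamanujanEleven.uInt, PowerSeries.coeff_mk]
  exact hA _ (by omega)

lemma twistInt (hA : Approx M N A a) (s : ℕ) :
    Approx M N (RamanujanEleven.twistInt s A) (listTwist N s a) := by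
  intro n hn
  rw [listTwist, getD_map_range hn, RamanujanEleven.twistInt, PowerSeries.coeff_mk,
    quadraticChar_eq]
  exact (hA n hn).mul_left _

lemma X_pow (k : ℕ) : Approx M N (PowerSeries.X ^ k) (List.replicate k 0 ++ [1]) := by
  intro n _
  rw [PowerSeries.coeff_X_pow]
  rcases lt_trichotomy n k with h | h | h
  · simp [List.getD_eq_getElem?_getD, List.getElem?_append, h, h.ne]
  · simp [List.getD_eq_getElem?_getD, h]
  · rw [if_neg h.ne', List.getD_eq_default _ _ (by simpa using h)]

lemma X_pow_mul {k : ℕ} (h : N ≤ k) (A : PowerSeries ℤ) :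
    Approx M N (PowerSeries.X ^ k * A) [] := by
  intro n hn
  rw [PowerSeries.coeff_X_pow_mul', if_neg (by omega)]
  rfl

lemma C_mul_self (A : PowerSeries ℤ) : Approx M N (PowerSeries.C M * A) [] := by
  intro n _
  rw [PowerSeries.coeff_C_mul]
  exact (Int.modEq_zero_iff_dvd.mpr (dvd_mul_right _ _))

lemma sub (hA : Approx M N A a) (hB : Approx M N B b) :
    Approx M N (A - B) ((listAdd (b.map (-1 * ·)) a).map (· % M)) := by
  have := hB.smul_add (c := -1) hA
  rwa [map_neg, map_one, neg_one_mul, neg_add_eq_sub] at this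

end Approx

/-- The power series of the function `hTwoFun`. -/
noncomputable def hTwoInt : PowerSeries ℤ :=
  PowerSeries.C 121 * phiInt ^ 5 - eInvInt ^ 5 * twistInt 30 (eInt ^ 5) - 1

/-- The power series of the function `hThreeFun`. -/
noncomputable def hThreeInt : PowerSeries ℤ :=
  PowerSeries.C 1331 * phiInt ^ 7 + eInvInt ^ 7 * twistInt 42 (eInt ^ 7) - 1


/-- The coefficients of `eInt`. -/
def eList : List ℤ :=
  [1, -1, -1, 0, 0, 1, 0, 1, 0, 0, 0, 0, -1, 0, 0, -1, 0, 0, 0, 0, 0, 0, 1, 0, 0, 0, 1, 0, 0, 0,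
   0, 0, 0, 0, 0, -1, 0, 0, 0, 0, -1, 0, 0, 0, 0, 0, 0, 0, 0, 0, 0, 1, 0, 0, 0, 0, 0, 1]

/-- The coefficients of `eInvInt` modulo `121`. -/
def eInvList : List ℤ :=
  [1, 1, 2, 3, 5, 7, 11, 15, 22, 30, 42, 56, 77, 101, 14, 55, 110, 55, 22, 6, 22, 66, 34, 45, 2,
   22, 16, 106, 88, 88, 38, 66, 0, 100, 89, 0, 69, 99, 0, 88, 70, 55, 55, 99, 34, 78, 46, 3, 16,
   11, 99, 0, 22, 85, 44, 67, 110, 79, 110, 66, 40, 77, 11, 17, 77, 86, 78]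

/-- The coefficients of `phiInt` modulo `121`. -/
def phiList : List ℤ :=
  [0, 0, 0, 0, 0, 1, 1, 2, 3, 5, 7, 11, 15, 22, 30, 42, 56, 77, 101, 14, 55, 110, 55, 22, 6, 22,
   66, 34, 45, 2, 22, 16, 106, 88, 88, 38, 66, 0, 100, 89, 0, 69, 99, 0, 88, 70, 55, 55, 99, 34,
   78, 46, 3, 16, 11, 99, 0, 22, 85, 44, 67, 110, 79, 110, 66, 40, 77]

/-- The coefficients of `eInvInt ^ 5` modulo `121`. -/
def eInvFiveList : List ℤ :=
  [1, 5, 20, 65, 69, 22, 55, 86, 110, 84, 51, 101, 43, 88, 32, 3, 105, 66, 97, 88, 99, 33, 46,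
   48, 62, 9, 61, 44, 47, 31, 88, 3, 7, 81, 15, 84, 108, 39, 77, 107, 29, 0, 22, 84, 6, 102, 82,
   29, 42, 116, 44, 73, 0, 80, 91, 94, 2, 104, 84, 67, 39, 44, 71, 0, 3, 29, 97]

/-- The coefficients of `eInvInt ^ 7` modulo `121`. -/
def eInvSevenList : List ℤ :=
  [1, 7, 35, 19, 6, 95, 45, 63, 119, 0, 25, 51, 30, 97, 19, 9, 54, 10, 54, 119, 44, 34, 64, 109,
   11, 78, 95, 102, 46, 38, 55, 44, 83, 120, 18, 48, 36, 109, 2, 56, 62, 113, 88, 69, 63, 110,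
   30, 80, 44, 104, 59, 18, 14, 11, 120, 49, 32, 35, 111, 26, 100, 55, 11, 60, 99, 43, 71]

/-- The coefficients of `tInt` modulo `121`. -/
def tList : List ℤ :=
  [0, 0, 0, 0, 0, 1, 12, 90, 36, 115, 18, 22, 48, 88, 41, 119, 23, 22, 24, 14, 55, 55, 110, 99,
   61, 77, 22, 100, 89, 79, 11, 104, 73, 55, 88, 93, 0, 88, 100, 67, 22, 113, 0, 55, 55, 15, 88,
   88, 55, 100, 34, 101, 113, 49, 11, 77, 77, 110, 85, 0, 100, 88, 2, 99, 110, 51, 33]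

/-- The coefficients of `hTwoInt` modulo `121`. -/
def hTwoList : List ℤ :=
  [0, 10, 50, 69, 25, 35, 59, 116, 89, 105, 43, 77, 13, 61, 118, 82, 53, 89, 107, 86, 93, 103,
   22, 86, 30, 5, 85, 25, 37, 39, 58, 65, 83, 11, 5, 32, 48, 75, 100, 26, 108, 31, 86, 0, 11,
   32, 67, 3, 72, 49, 102, 30, 81, 120, 59, 88, 60, 116, 96, 86, 18, 1, 28, 74, 108, 21, 55]

/-- The coefficients of `hThreeInt` modulo `121`. -/
def hThreeList : List ℤ :=
  [0, 14, 84, 29, 116, 20, 78, 73, 91, 35, 96, 110, 29, 51, 24, 14, 23, 80, 13, 93, 74, 78, 66,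
   6, 68, 12, 46, 48, 67, 106, 64, 100, 18, 33, 81, 19, 86, 65, 47, 1, 115, 5, 38, 11, 33, 11,
   69, 62, 23, 44, 97, 112, 67, 67, 111, 22, 4, 40, 79, 87, 5, 113, 40, 68, 62, 118, 44]

lemma eInt_mul_eInvInt : eInt * eInvInt = 1 := by
  refine PowerSeries.mul_invOfUnit _ _ ?_
  have h := PowerSeries.coeff_pentagonalSeries_pentagonal ℤ 0
  rw [show pentagonal 0 = 0 from rfl, PowerSeries.coeff_zero_eq_constantCoeff_apply] at h
  rw [eInt, h]
  simp

lemma approx_eInt : Approx 0 67 eInt eList := by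
  intro n hn
  by_cases h : n ∈ Set.range pentagonal
  · obtain ⟨k, rfl⟩ := h
    rw [eInt, PowerSeries.coeff_pentagonalSeries_pentagonal]
    have h1 := two_mul_natCast_pentagonal k
    have h2 : -7 < k := by nlinarith
    have h3 : k < 7 := by nlinarith
    interval_cases k <;> decide
  · rw [eInt, PowerSeries.coeff_pentagonalSeries_eq_zero _ h]
    have h2 : ∀ n < 67, (∀ k ∈ Finset.Icc (-7 : ℤ) 7, pentagonal k ≠ n) → eList.getD n 0 = 0 := by
      decide +kernel
    rw [h2 n hn fun k _ hk ↦ h ⟨k, hk⟩]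

/-! ### Exact values of the first coefficients -/

lemma approx_eInvInt_exact : Approx 0 9 eInvInt [1, 1, 2, 3, 5, 7, 11, 15, 22] :=
  (approx_eInt.mono (by norm_num) dvd_rfl).of_mul_eq_one eInt_mul_eInvInt (by decide +kernel)

lemma approx_hTwoInt_exact :
    Approx 0 9 hTwoInt [0, 10, 50, 190, 630, 1850, 5020, 12700, 30460] := by
  have hE : Approx 0 9 eInt eList := approx_eInt.mono (by norm_num) dvd_rfl
  have h : Approx 0 9 (phiInt ^ 5) [] := by
    rw [phiInt, mul_pow, ← pow_mul]; exact Approx.X_pow_mul (by norm_num) _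
  have h1 := (Approx.smul_add (c := 121) h Approx.zero).sub
    ((approx_eInvInt_exact.pow 5).mul ((hE.pow 5).twistInt 30))
  rw [add_zero] at h1
  exact (h1.sub Approx.one).of_eq (by decide +kernel)

lemma approx_hThreeInt_exact :
    Approx 0 9 hThreeInt [0, 14, 84, 392, 1568, 5586, 18228, 55370, 158480] := by
  have hE : Approx 0 9 eInt eList := approx_eInt.mono (by norm_num) dvd_rfl
  have h : Approx 0 9 (phiInt ^ 7) [] := by
    rw [phiInt, mul_pow, ← pow_mul]; exact Approx.X_pow_mul (by norm_num) _
  have h1 := h.smul_add (c := 1331)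
    ((approx_eInvInt_exact.pow 7).mul ((hE.pow 7).twistInt 42))
  exact (h1.sub Approx.one).of_eq (by decide +kernel)

lemma approx_tInt_exact : Approx 0 9 tInt [0, 0, 0, 0, 0, 1, 12, 90, 520] := by
  have hE : Approx 0 9 eInt eList := approx_eInt.mono (by norm_num) dvd_rfl
  exact ((Approx.X_pow 5).mul ((hE.vInt.pow 12).mul (approx_eInvInt_exact.pow 12))).of_eq
    (by decide +kernel)

/-! ### Values modulo `121` -/

lemma approx_eInt_mod : Approx 121 67 eInt eList := approx_eInt.mono le_rfl (dvd_zero _)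

lemma approx_eInvInt : Approx 121 67 eInvInt eInvList :=
  approx_eInt_mod.of_mul_eq_one eInt_mul_eInvInt (by decide +kernel)

lemma approx_phiInt : Approx 121 67 phiInt phiList :=
  ((Approx.X_pow 5).mul (approx_eInt_mod.vInt.vInt.mul approx_eInvInt)).of_eq (by decide +kernel)

lemma approx_eInvInt_five : Approx 121 67 (eInvInt ^ 5) eInvFiveList :=
  (approx_eInvInt.pow 5).of_eq (by decide +kernel)

lemma approx_eInvInt_seven : Approx 121 67 (eInvInt ^ 7) eInvSevenList := by
  rw [show 7 = 5 + 2 from rfl, pow_add]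
  exact (approx_eInvInt_five.mul (approx_eInvInt.pow 2)).of_eq (by decide +kernel)

lemma approx_hTwoInt : Approx 121 67 hTwoInt hTwoList :=
  (((Approx.C_mul_self _).sub (approx_eInvInt_five.mul ((approx_eInt_mod.pow 5).twistInt 30))).sub
    Approx.one).of_eq (by decide +kernel)

lemma approx_hThreeInt : Approx 121 67 hThreeInt hThreeList := by
  rw [hThreeInt, show (1331 : ℤ) = 121 * 11 by norm_num, map_mul, mul_assoc]
  have h := (Approx.C_mul_self (M := 121) (N := 67) (PowerSeries.C 11 * phiInt ^ 7)).smul_add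
    (c := 1) (approx_eInvInt_seven.mul ((approx_eInt_mod.pow 7).twistInt 42))
  rw [map_one, one_mul] at h
  exact (h.sub Approx.one).of_eq (by decide +kernel)

lemma approx_tInt : Approx 121 67 tInt tList := by
  rw [tInt, show eInvInt ^ 12 = eInvInt ^ 5 * eInvInt ^ 7 by ring]
  exact ((Approx.X_pow 5).mul ((approx_eInt_mod.vInt.pow 12).mul
    (approx_eInvInt_five.mul approx_eInvInt_seven))).of_eq (by decide +kernel)

end

section

lemma uOp_phi_zpow_inv (n : ℤ) : IsInv 11 (uOp fun τ ↦ phi τ ^ n) := by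
  refine IsInv.uOp fun γ hγ τ ↦ ?_
  simp only [isInv_phi γ hγ τ]

/-- A modular function for `Γ₀(11)` with a double pole at `0`, vanishing at `∞`. -/
noncomputable def hTwoFun (τ : ℍ) : ℂ :=
  11 ^ (-2 : ℤ) * uOp (fun τ ↦ phi τ ^ (-5 : ℤ)) (fricke τ) - 1

/-- A modular function for `Γ₀(11)` with a triple pole at `0`, vanishing at `∞`. -/
noncomputable def hThreeFun (τ : ℍ) : ℂ :=
  11 ^ (-3 : ℤ) * uOp (fun τ ↦ phi τ ^ (-7 : ℤ)) (fricke τ) - 1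

lemma isInv_hTwoFun : IsInv 11 hTwoFun := fun γ hγ τ ↦ by
  have h := (uOp_phi_zpow_inv (-5)).comp_fricke γ hγ τ
  dsimp only at h
  rw [hTwoFun, hTwoFun, h]

lemma isInv_hThreeFun : IsInv 11 hThreeFun := fun γ hγ τ ↦ by
  have h := (uOp_phi_zpow_inv (-7)).comp_fricke γ hγ τ
  dsimp only at h
  rw [hThreeFun, hThreeFun, h]

lemma isInv_one : IsInv 11 fun _ ↦ 1 := fun _ _ _ ↦ rfl

lemma vSeries_one : vSeries 1 = 1 := IsExp.one.comp_elevenMul.unique IsExp.one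

lemma isExp_uOp_phi_zpow_fricke {n : ℕ} {m : ℤ} (h : -(n : ℤ) = 2 * m + 1) :
    IsExp (fun τ ↦ uOp (fun τ ↦ phi τ ^ (-n : ℤ)) (fricke τ))
      ((11 : ℂ) ^ (n - 1 : ℤ) • intSeries (phiInt ^ n) +
        (11⁻¹ * (-11) ^ (-m : ℤ) : ℂ) • intSeries (eInvInt ^ n * twistInt (6 * n) (eInt ^ n))) := by
  have h0 := isInv_one.isExp_uOp_phi_fricke IsExp.one IsExp.one h
  have h1 := hadamard_chi_intSeries (c := fun k : ℤ ↦ ((k - 6 * (-n) : ℤ) : ZMod 11))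
    (s := 6 * n) (fun n ↦ by push_cast; ring) (eInt ^ n)
  have h2 : (11 : ℂ) ^ (n - 1 : ℤ) = 11⁻¹ * 11 ^ n := by
    rw [zpow_sub_one₀ (by norm_num), zpow_natCast, mul_comm]
  simp only [mul_one, one_mul, neg_neg, vSeries_one, zpow_natCast, phiSeries_eq_intSeries] at h0
  rw [eSeries_eq, ← map_pow, ← map_pow, h1, ← eSeries_eq] at h0
  rw [h2, map_mul, map_pow _ eInvInt, ← eSeries_inv_eq, inv_pow, ← zpow_natCast eSeries, ← zpow_neg]
  rw [smul_add, smul_smul, smul_smul] at h0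
  exact h0

lemma isExp_hTwoFun : IsExp hTwoFun (intSeries hTwoInt) := by
  have h := ((isExp_uOp_phi_zpow_fricke (n := 5) (m := -3) (by norm_num)).const_mul
    (11 ^ (-2 : ℤ))).sub IsExp.one
  have e : (11 : ℂ) ^ (-2 : ℤ) • ((11 : ℂ) ^ ((5 : ℕ) - 1 : ℤ) • intSeries (phiInt ^ 5) +
      (11⁻¹ * (-11) ^ (-(-3) : ℤ) : ℂ) • intSeries (eInvInt ^ 5 * twistInt (6 * 5) (eInt ^ 5))) -
      1 = intSeries hTwoInt := by
    rw [hTwoInt, map_sub, map_sub, map_one, ← smul_intSeries, smul_add, smul_smul, smul_smul]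
    norm_num [sub_eq_add_neg]
  rw [e] at h
  exact h

lemma isExp_hThreeFun : IsExp hThreeFun (intSeries hThreeInt) := by
  have h := ((isExp_uOp_phi_zpow_fricke (n := 7) (m := -4) (by norm_num)).const_mul
    (11 ^ (-3 : ℤ))).sub IsExp.one
  have e : (11 : ℂ) ^ (-3 : ℤ) • ((11 : ℂ) ^ ((7 : ℕ) - 1 : ℤ) • intSeries (phiInt ^ 7) +
      (11⁻¹ * (-11) ^ (-(-4) : ℤ) : ℂ) • intSeries (eInvInt ^ 7 * twistInt (6 * 7) (eInt ^ 7))) -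
      1 = intSeries hThreeInt := by
    rw [hThreeInt, map_sub, map_add, map_one, ← smul_intSeries, smul_add, smul_smul, smul_smul]
    norm_num
  rw [e] at h
  exact h

/-- The expansion `B` has a pole of order at most `p`, the series `11 ^ w • B` is `11`-integral, and
`v` is the coefficient of `11 ^ w • B` at the pole. -/
structure PoleLE (w p : ℤ) (v : ℂ) (B : LaurentSeries ℂ) : Prop where
  ord : OrdGE (-p) B
  mem : (11 : ℂ) ^ w • B ∈ localSeries
  coeff : (11 : ℂ) ^ w * B.coeff (-p) = v

namespace PoleLE

variable {w w' p p' : ℤ} {v v' : ℂ} {B B' : LaurentSeries ℂ}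

lemma mono (h : PoleLE w p v B) (hw : w ≤ w') (hp : p < p') : PoleLE w' p' 0 B :=
  ⟨h.ord.mono (by omega), zpow_smul_mem_mono hw h.mem, by rw [h.ord _ (by omega), mul_zero]⟩

lemma add (h : PoleLE w p v B) (h' : PoleLE w p v' B') : PoleLE w p (v + v') (B + B') :=
  ⟨h.ord.add h'.ord, by rw [smul_add]; exact add_mem h.mem h'.mem, by
    rw [HahnSeries.coeff_add, mul_add, h.coeff, h'.coeff]⟩

lemma smul (h : PoleLE w p v B) (m : ℤ) : PoleLE w p (m * v) ((m : ℂ) • B) :=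
  ⟨h.ord.smul _, by rw [smul_comm]; exact smul_mem_localSeries (intCast_mem_localRing m) h.mem, by
    rw [HahnSeries.coeff_smul, smul_eq_mul, mul_left_comm, h.coeff]⟩

lemma mul (h : PoleLE w p v B) (h' : PoleLE w' p' v' B') :
    PoleLE (w + w') (p + p') (v * v') (B * B') := by
  refine ⟨?_, ?_, ?_⟩
  · rw [neg_add]; exact h.ord.mul h'.ord
  · have := mul_mem_localSeries h.mem h'.mem
    rwa [smul_mul_eq, mul_smul_eq, smul_smul, ← zpow_add₀ (by norm_num)] at this
  · rw [neg_add, coeff_mul_of_ordGE h.ord h'.ord, zpow_add₀ (by norm_num), ← h.coeff, ← h'.coeff]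
    ring

lemma one : PoleLE 0 0 1 1 :=
  ⟨OrdGE.one, by rw [zpow_zero, one_smul]; exact one_mem _, by simp⟩

lemma pow (h : PoleLE w p v B) (n : ℕ) : PoleLE (n * w) (n * p) (v ^ n) (B ^ n) := by
  induction n with
  | zero => simpa using one
  | succ n ih =>
    have := ih.mul h
    rw [pow_succ, pow_succ]
    convert this using 1 <;> (push_cast; ring)

end PoleLE

lemma qPow_pow (d : ℤ) (n : ℕ) : qPow d ^ n = qPow (d * n) := by
  refine ((isExp_qPow d).pow n).unique ((isExp_qPow (d * n)).congr fun τ ↦ ?_)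
  rw [zpow_mul, zpow_natCast]

lemma phiSeries_zpow_neg (n : ℕ) : phiSeries ^ (-n : ℤ) =
    qPow (-5 * n) * intSeries ((vInt (vInt eInvInt) * eInt) ^ n) := by
  rw [zpow_neg, ← inv_zpow, zpow_natCast, phiSeries_inv, eSeries_inv_eq, vSeries_intSeries,
    vSeries_intSeries, eSeries_eq, mul_assoc, mul_pow, qPow_pow, ← map_mul, ← map_pow]

lemma PoleLE.uSeries_qPow {n p k : ℕ} {v : ℤ} {A : PowerSeries ℤ} (h : 11 * p + k = 5 * n)
    (hk : k < 10) (hv : PowerSeries.coeff k A = v) :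
    PoleLE p p v ((11 : ℂ) ^ (-p : ℤ) • uSeries (qPow (-5 * n) * intSeries A)) := by
  have h0 : OrdGE (-5 * n) (qPow (-5 * n) * intSeries A) := by
    have := (ordGE_qPow (-5 * n)).mul (ordGE_intSeries A)
    rwa [add_zero] at this
  have h1 : OrdGE (-p) (RamanujanEleven.uSeries (qPow (-5 * n) * intSeries A)) :=
    h0.uSeries (by omega)
  have h2 : (11 : ℂ) ^ (p : ℤ) * 11 ^ (-p : ℤ) = 1 := by
    rw [← zpow_add₀ (by norm_num), add_neg_cancel, zpow_zero]
  refine ⟨h1.smul _, ?_, ?_⟩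
  · rw [smul_smul, h2, one_smul]
    exact uSeries_mem (mul_mem_localSeries (qPow_mem _) (intSeries_mem _))
  · have h3 : (11 * -p : ℤ) = -5 * n + (k : ℤ) := by omega
    rw [HahnSeries.coeff_smul, smul_eq_mul, ← mul_assoc, h2, one_mul, coeff_uSeries, h3,
      coeff_qPow_mul, coeff_intSeries, hv]

lemma approx_eInvInt_mul_eInt :
    Approx 0 9 (vInt (vInt eInvInt) * eInt) [1, -1, -1, 0, 0, 1, 0, 1, 0] :=
  (approx_eInvInt_exact.vInt.vInt.mul (approx_eInt.mono (by norm_num) dvd_rfl)).of_eq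
    (by decide +kernel)

lemma negOne_smul (A : LaurentSeries ℂ) : ((-1 : ℤ) : ℂ) • A = -A := by
  ext n
  rw [HahnSeries.coeff_smul, HahnSeries.coeff_neg]
  simp

lemma exists_poleLE_hTwoFun :
    ∃ B, IsExp (fun τ ↦ hTwoFun (fricke τ)) B ∧ PoleLE 2 2 10 B := by
  have h := ((isExp_phi.zpow phi_ne_zero (-5)).uOp.const_mul (11 ^ (-2 : ℤ))).sub IsExp.one
  have hc := (approx_eInvInt_mul_eInt.pow 5) 3 (by norm_num)
  rw [show (listPow 0 9 [1, -1, -1, 0, 0, 1, 0, 1, 0] 5).getD 3 0 = 10 by decide +kernel] at hc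
  have hp := PoleLE.uSeries_qPow (n := 5) (p := 2) (by norm_num) (by norm_num)
    (Int.modEq_zero_iff.mp hc)
  rw [← phiSeries_zpow_neg] at hp
  refine ⟨_, h.congr fun τ ↦ by rw [hTwoFun, fricke_fricke], ?_⟩
  have h1 := hp.add ((PoleLE.one.smul (-1)).mono (w' := 2) (p' := 2) (by norm_num) (by norm_num))
  rw [negOne_smul, ← sub_eq_add_neg] at h1
  simpa using h1

lemma exists_poleLE_hThreeFun :
    ∃ B, IsExp (fun τ ↦ hThreeFun (fricke τ)) B ∧ PoleLE 3 3 14 B := by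
  have h := ((isExp_phi.zpow phi_ne_zero (-7)).uOp.const_mul (11 ^ (-3 : ℤ))).sub IsExp.one
  have hc := (approx_eInvInt_mul_eInt.pow 7) 2 (by norm_num)
  rw [show (listPow 0 9 [1, -1, -1, 0, 0, 1, 0, 1, 0] 7).getD 2 0 = 14 by decide +kernel] at hc
  have hp := PoleLE.uSeries_qPow (n := 7) (p := 3) (by norm_num) (by norm_num)
    (Int.modEq_zero_iff.mp hc)
  rw [← phiSeries_zpow_neg] at hp
  refine ⟨_, h.congr fun τ ↦ by rw [hThreeFun, fricke_fricke], ?_⟩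
  have h1 := hp.add ((PoleLE.one.smul (-1)).mono (w' := 3) (p' := 3) (by norm_num) (by norm_num))
  rw [negOne_smul, ← sub_eq_add_neg] at h1
  simpa using h1

lemma exists_poleLE_tFun : ∃ B, IsExp (fun τ ↦ tFun (fricke τ)) B ∧ PoleLE 6 5 1 B := by
  refine ⟨_, isExp_tFun_fricke, ordGE_tSeries_inv.smul _, ?_, ?_⟩
  · rw [smul_smul, ← zpow_add₀ (by norm_num)]
    norm_num only
    simpa using tSeries_inv_mem
  · have h := coeff_mul_of_ordGE ordGE_tSeries ordGE_tSeries_inv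
    rw [mul_inv_cancel₀ (isExp_tFun.ne_zero UpperHalfPlane.I (tFun_ne_zero _)), coeff_tSeries,
      one_mul] at h
    rw [HahnSeries.coeff_smul, ← h]
    norm_num

end

section

/-- Combinations of `1, x, y, x ^ 2, y ^ 2` which, for `x = hTwoFun` and `y = hThreeFun`, vanish at
`∞` to the successive orders `0, 1, 2, 3, 4`. -/
def baseForm {R : Type*} [CommRing R] (x y : R) : ℕ → R
  | 0 => 1
  | 1 => x
  | 2 => (5 : ℤ) * y + (-7 : ℤ) * x
  | 3 => (70 : ℤ) * x + ((-50 : ℤ) * y + (7 : ℤ) * (x * x))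
  | _ => (-980 : ℤ) * x + ((700 : ℤ) * y + ((-147 : ℤ) * (x * x) + (25 : ℤ) * (y * y)))

/-- The products of the forms `baseForm` with powers of `t`. -/
def baseElt {R : Type*} [CommRing R] (x y t : R) (i : ℕ) : R := baseForm x y (i % 5) * t ^ (i / 5)

lemma map_baseForm {R S : Type*} [CommRing R] [CommRing S] (f : R →+* S) (x y : R) (r : ℕ) :
    f (baseForm x y r) = baseForm (f x) (f y) r := by
  rcases r with _ | _ | _ | _ | r <;> simp only [baseForm, map_add, map_mul, map_one, map_intCast]

lemma map_baseElt {R S : Type*} [CommRing R] [CommRing S] (f : R →+* S) (x y t : R) (i : ℕ) :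
    f (baseElt x y t i) = baseElt (f x) (f y) (f t) i := by
  rw [baseElt, baseElt, map_mul, map_pow, map_baseForm]

lemma baseForm_mem {R : Type*} [CommRing R] (S : Subring R) {x y : R} (hx : x ∈ S) (hy : y ∈ S)
    (r : ℕ) : baseForm x y r ∈ S := by
  have hi (c : ℤ) {z : R} (hz : z ∈ S) : (c : R) * z ∈ S := S.mul_mem (intCast_mem S c) hz
  rcases r with _ | _ | _ | _ | r
  · exact S.one_mem
  · exact hx
  · exact S.add_mem (hi _ hy) (hi _ hx)
  · exact S.add_mem (hi _ hx) (S.add_mem (hi _ hy) (hi _ (S.mul_mem hx hx)))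
  · exact S.add_mem (hi _ hx) (S.add_mem (hi _ hy) (S.add_mem (hi _ (S.mul_mem hx hx))
      (hi _ (S.mul_mem hy hy))))

lemma baseElt_mem {R : Type*} [CommRing R] (S : Subring R) {x y t : R} (hx : x ∈ S) (hy : y ∈ S)
    (ht : t ∈ S) (i : ℕ) : baseElt x y t i ∈ S :=
  S.mul_mem (baseForm_mem S hx hy _) (S.pow_mem ht _)

/-- The ring of functions with a `q`-expansion, paired with their expansions. -/
noncomputable def expRing : Subring ((ℍ → ℂ) × LaurentSeries ℂ) where
  carrier := {p | IsExp p.1 p.2}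
  mul_mem' h h' := h.mul h'
  one_mem' := IsExp.one
  add_mem' h h' := h.add h'
  zero_mem' := IsExp.zero
  neg_mem' h := h.neg

/-- The ring of `Γ₀(11)`-invariant functions. -/
def invRing : Subring (ℍ → ℂ) where
  carrier := {f | IsInv 11 f}
  mul_mem' h h' γ hγ τ := by rw [Pi.mul_apply, Pi.mul_apply, h γ hγ, h' γ hγ]
  one_mem' := isInv_one
  add_mem' h h' γ hγ τ := by rw [Pi.add_apply, Pi.add_apply, h γ hγ, h' γ hγ]
  zero_mem' _ _ _ := rfl
  neg_mem' h γ hγ τ := by rw [Pi.neg_apply, Pi.neg_apply, h γ hγ]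

lemma IsExp.baseElt {f g h : ℍ → ℂ} {A B C : LaurentSeries ℂ} (hf : IsExp f A) (hg : IsExp g B)
    (hh : IsExp h C) (i : ℕ) :
    IsExp (RamanujanEleven.baseElt f g h i) (RamanujanEleven.baseElt A B C i) := by
  have h1 : IsExp _ _ := baseElt_mem expRing (x := (f, A)) (y := (g, B)) (t := (h, C)) hf hg hh i
  have h2 := map_baseElt (RingHom.fst (ℍ → ℂ) (LaurentSeries ℂ)) (f, A) (g, B) (h, C) i
  have h3 := map_baseElt (RingHom.snd (ℍ → ℂ) (LaurentSeries ℂ)) (f, A) (g, B) (h, C) i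
  rw [RingHom.coe_fst] at h2
  rw [RingHom.coe_snd] at h3
  rwa [h2, h3] at h1

/-- A basis of the modular functions for `Γ₀(11)` with poles at most at the cusp `0`. -/
noncomputable def bFun (i : ℕ) : ℍ → ℂ := baseElt hTwoFun hThreeFun tFun i

/-- The power series of the function `bFun i`. -/
noncomputable def bInt (i : ℕ) : PowerSeries ℤ := baseElt hTwoInt hThreeInt tInt i

/-- The pole orders at the cusp `0` of the functions `baseForm`. -/
def baseWt : ℕ → ℕ
  | 0 => 0
  | 1 => 2
  | 2 => 3
  | 3 => 4
  | _ => 6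

/-- The power of `11` in the denominator of the expansion of `bFun i` at the cusp `0`. -/
def wt (i : ℕ) : ℕ := baseWt (i % 5) + 6 * (i / 5)

/-- The pole order of `bFun i` at the cusp `0`. -/
def poleOrd (i : ℕ) : ℕ := baseWt (i % 5) + 5 * (i / 5)

/-- The leading coefficients of the functions `bFun i` at both cusps. -/
def lead (i : ℕ) : ℤ := [1, 10, 70, 700, 4900].getD (i % 5) 0

lemma isInv_bFun (i : ℕ) : IsInv 11 (bFun i) :=
  baseElt_mem invRing isInv_hTwoFun isInv_hThreeFun isInv_tFun i

lemma isExp_bFun (i : ℕ) : IsExp (bFun i) (intSeries (bInt i)) := by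
  rw [bInt, map_baseElt]
  refine IsExp.baseElt isExp_hTwoFun isExp_hThreeFun ?_ i
  rw [← tSeries_eq_intSeries]
  exact isExp_tFun

lemma not_dvd_lead (i : ℕ) : ¬ (11 : ℤ) ∣ lead i := by
  have h : ∀ r < 5, ¬ (11 : ℤ) ∣ lead r := by decide
  have := h (i % 5) (Nat.mod_lt _ (by norm_num))
  rwa [lead, Nat.mod_mod] at this

lemma lead_ne_zero (i : ℕ) : (lead i : ℂ) ≠ 0 := by
  refine Int.cast_ne_zero.mpr fun h ↦ not_dvd_lead i ?_
  rw [h]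
  exact dvd_zero _

namespace PoleLE

lemma intCast_mul {w p v : ℤ} {B : LaurentSeries ℂ} (h : PoleLE w p v B) (c : ℤ) :
    PoleLE w p ((c * v : ℤ) : ℂ) (c * B) := by
  have h1 := h.smul c
  rw [← Int.cast_mul] at h1
  have : (c : ℂ) • B = c * B := by
    ext n
    rw [HahnSeries.coeff_smul, ← zsmul_eq_mul, HahnSeries.coeff_smul, zsmul_eq_mul, smul_eq_mul]
  rwa [← this]

lemma baseForm {A B : LaurentSeries ℂ} (hA : PoleLE 2 2 ((10 : ℤ) : ℂ) A)
    (hB : PoleLE 3 3 ((14 : ℤ) : ℂ) B) {r : ℕ} (hr : r < 5) :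
    PoleLE (baseWt r) (baseWt r) (lead r) (RamanujanEleven.baseForm A B r) := by
  have hAA := hA.mul hA
  have hBB := hB.mul hB
  rw [← Int.cast_mul] at hAA hBB
  interval_cases r
  · simpa [baseWt, lead, RamanujanEleven.baseForm] using one
  · exact hA
  · have := (hB.intCast_mul 5).add ((hA.intCast_mul (-7)).mono (w' := 3) (p' := 3)
      (by norm_num) (by norm_num))
    rwa [add_zero] at this
  · have := ((hA.intCast_mul 70).mono (w' := 4) (p' := 4) (by norm_num) (by norm_num)).add
      (((hB.intCast_mul (-50)).mono (w' := 4) (p' := 4) (by norm_num) (by norm_num)).add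
        (hAA.intCast_mul 7))
    rwa [zero_add, zero_add] at this
  · have := ((hA.intCast_mul (-980)).mono (w' := 6) (p' := 6) (by norm_num) (by norm_num)).add
      (((hB.intCast_mul 700).mono (w' := 6) (p' := 6) (by norm_num) (by norm_num)).add
        (((hAA.intCast_mul (-147)).mono (w' := 6) (p' := 6) (by norm_num) (by norm_num)).add
          (hBB.intCast_mul 25)))
    rwa [zero_add, zero_add, zero_add] at this

end PoleLE

lemma exists_poleLE_bFun (i : ℕ) :
    ∃ B, IsExp (fun τ ↦ bFun i (fricke τ)) B ∧ PoleLE (wt i) (poleOrd i) (lead i) B := by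
  obtain ⟨A, hA, hA'⟩ := exists_poleLE_hTwoFun
  obtain ⟨B, hB, hB'⟩ := exists_poleLE_hThreeFun
  obtain ⟨C, hC, hC'⟩ := exists_poleLE_tFun
  refine ⟨_, (IsExp.baseElt hA hB hC i).congr fun τ ↦ ?_, ?_⟩
  · exact congrFun (map_baseElt (RingHom.pi fun τ ↦ Pi.evalRingHom (fun _ : ℍ ↦ ℂ) (fricke τ))
      hTwoFun hThreeFun tFun i) τ
  · have h1 := (PoleLE.baseForm (r := i % 5) (by exact_mod_cast hA') (by exact_mod_cast hB')
      (Nat.mod_lt _ (by norm_num))).mul (hC'.pow (i / 5))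
    rw [one_pow, mul_one, lead, Nat.mod_mod, ← lead] at h1
    rw [wt, poleOrd]
    push_cast
    rwa [mul_comm (6 : ℤ), mul_comm (5 : ℤ)]

/-- The multiple of a list by a number, modulo `M`. -/
def listSmul (M c : ℤ) (a : List ℤ) : List ℤ := (a.map (c * ·)).map (· % M)

/-- The list computing `baseForm` modulo `M`. -/
def listForm (M : ℤ) (N : ℕ) (x y : List ℤ) : ℕ → List ℤ
  | 0 => [1]
  | 1 => x
  | 2 => listAdd (listSmul M 5 y) (listSmul M (-7) x)
  | 3 => listAdd (listSmul M 70 x) (listAdd (listSmul M (-50) y) (listSmul M 7 (listMul M N x x)))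
  | _ => listAdd (listSmul M (-980) x) (listAdd (listSmul M 700 y)
      (listAdd (listSmul M (-147) (listMul M N x x)) (listSmul M 25 (listMul M N y y))))

namespace Approx

variable {M : ℤ} {N : ℕ} {A B : PowerSeries ℤ} {a b : List ℤ}

lemma add (hA : Approx M N A a) (hB : Approx M N B b) : Approx M N (A + B) (listAdd a b) := by
  intro n hn
  rw [getD_listAdd, map_add]
  exact (hA n hn).add (hB n hn)

lemma intCast_mul (hA : Approx M N A a) (c : ℤ) : Approx M N (c * A) (listSmul M c a) := by
  intro n hn
  refine Int.ModEq.trans ?_ (getD_map_mod _ _ _).symm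
  rw [getD_map_mul, ← eq_intCast (PowerSeries.C (R := ℤ)), PowerSeries.coeff_C_mul]
  exact (hA n hn).mul_left _

lemma baseForm (hA : Approx M N A a) (hB : Approx M N B b) (r : ℕ) :
    Approx M N (RamanujanEleven.baseForm A B r) (listForm M N a b r) := by
  rcases r with _ | _ | _ | _ | r
  · exact one
  · exact hA
  · exact (hB.intCast_mul _).add (hA.intCast_mul _)
  · exact (hA.intCast_mul _).add ((hB.intCast_mul _).add ((hA.mul hA).intCast_mul _))
  · exact (hA.intCast_mul _).add ((hB.intCast_mul _).add (((hA.mul hA).intCast_mul _).add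
      ((hB.mul hB).intCast_mul _)))

end Approx

lemma coeff_baseForm {r k : ℕ} (hr : r < 5) (hk : k < r + 1) :
    PowerSeries.coeff k (baseForm hTwoInt hThreeInt r) = if k = r then lead r else 0 := by
  have h := (approx_hTwoInt_exact.baseForm approx_hThreeInt_exact r) k (by omega)
  rw [Int.modEq_zero_iff.mp h]
  clear h
  have h : ∀ r < 5, ∀ k < r + 1, (listForm 0 9 [0, 10, 50, 190, 630, 1850, 5020, 12700, 30460]
    [0, 14, 84, 392, 1568, 5586, 18228, 55370, 158480] r).getD k 0 =
      if k = r then lead r else 0 := by decide +kernel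
  exact h r hr k hk

lemma ordGE_coeff_bInt (i : ℕ) :
    OrdGE i (intSeries (bInt i)) ∧ (intSeries (bInt i)).coeff i = lead i := by
  have hr : i % 5 < 5 := Nat.mod_lt _ (by norm_num)
  have h1 : OrdGE (i % 5 : ℕ) (intSeries (baseForm hTwoInt hThreeInt (i % 5))) := by
    intro n hn
    rcases lt_or_ge n 0 with h | h
    · exact ordGE_intSeries _ n h
    · lift n to ℕ using h
      rw [coeff_intSeries, coeff_baseForm hr (by omega), if_neg (by omega), Int.cast_zero]
  have h2 : (intSeries (baseForm hTwoInt hThreeInt (i % 5))).coeff (i % 5 : ℕ) = lead i := by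
    rw [coeff_intSeries, coeff_baseForm hr (by omega), if_pos rfl, lead, lead, Nat.mod_mod]
  have h3 : intSeries (bInt i) =
      intSeries (baseForm hTwoInt hThreeInt (i % 5)) * tSeries ^ (i / 5) := by
    rw [bInt, baseElt, map_mul, map_pow, tSeries_eq_intSeries]
  have h4 := coeff_pow_of_ordGE ordGE_tSeries (i / 5)
  have h5 : (i : ℤ) = (i % 5 : ℕ) + (i / 5 : ℕ) * 5 := by omega
  rw [h3, h5, coeff_mul_of_ordGE h1 (ordGE_tSeries.pow _), h4, h2, coeff_tSeries, one_pow, mul_one]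
  exact ⟨h1.mul (ordGE_tSeries.pow _), rfl⟩

lemma adm_bFun (i : ℕ) : Adm (wt i) i (bFun i) := by
  obtain ⟨B, hB, hB'⟩ := exists_poleLE_bFun i
  exact ⟨isInv_bFun i, ⟨_, isExp_bFun i, intSeries_mem _, (ordGE_coeff_bInt i).1⟩, B, hB, hB'.mem⟩

end

section

/-- The series `A` starts with the terms `x q ^ d + y q ^ (d + 1) + z q ^ (d + 2)`. -/
structure LeadingTerms (d : ℤ) (x y z : ℂ) (A : LaurentSeries ℂ) : Prop where
  ord : OrdGE d A
  fst : A.coeff d = x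
  snd : A.coeff (d + 1) = y
  trd : A.coeff (d + 2) = z

namespace LeadingTerms

variable {d d' : ℤ} {x y z x' y' z' : ℂ} {A A' : LaurentSeries ℂ}

lemma exists_tail (hA : OrdGE d A) : ∃ A₁, OrdGE (d + 1) A₁ ∧
    (∀ n, d < n → A₁.coeff n = A.coeff n) ∧
    ∀ B n, (A * B).coeff (d + n) = A.coeff d * B.coeff n + (A₁ * B).coeff (d + n) := by
  refine ⟨A - A.coeff d • qPow d, fun n hn ↦ ?_, fun n hn ↦ ?_, fun B n ↦ ?_⟩
  · rw [HahnSeries.coeff_sub, HahnSeries.coeff_smul, coeff_qPow]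
    rcases (show n < d ∨ n = d by omega) with h | rfl
    · rw [hA n h, if_neg h.ne, smul_zero, sub_zero]
    · rw [if_pos rfl, smul_eq_mul, mul_one, sub_self]
  · rw [HahnSeries.coeff_sub, HahnSeries.coeff_smul, coeff_qPow, if_neg hn.ne', smul_zero, sub_zero]
  · rw [sub_mul, HahnSeries.coeff_sub, smul_mul_eq, HahnSeries.coeff_smul, coeff_qPow_mul,
      smul_eq_mul]
    ring

lemma mul (h : LeadingTerms d x y z A) (h' : LeadingTerms d' x' y' z' A') :
    LeadingTerms (d + d') (x * x') (x * y' + y * x') (x * z' + y * y' + z * x') (A * A') := by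
  obtain ⟨A₁, h1, h2, h3⟩ := exists_tail h.ord
  obtain ⟨A₂, h4, h5, h6⟩ := exists_tail h1
  refine ⟨h.ord.mul h'.ord, by rw [coeff_mul_of_ordGE h.ord h'.ord, h.fst, h'.fst], ?_, ?_⟩
  · rw [add_assoc, h3, h'.snd, h.fst, show d + (d' + 1) = d + 1 + d' by ring,
      coeff_mul_of_ordGE h1 h'.ord, h2 _ (by omega), h.snd, h'.fst]
  · rw [add_assoc, h3, h'.trd, h.fst, show d + (d' + 2) = d + 1 + (d' + 1) by ring, h6, h'.snd,
      h2 _ (by omega), h.snd, show d + 1 + (d' + 1) = d + 1 + 1 + d' by ring,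
      coeff_mul_of_ordGE h4 h'.ord, h5 _ (by omega), h2 _ (by omega),
      show d + 1 + 1 = d + 2 by ring, h.trd, h'.fst]
    ring

lemma smul (c : ℂ) (h : LeadingTerms d x y z A) :
    LeadingTerms d (c * x) (c * y) (c * z) (c • A) :=
  ⟨h.ord.smul _, by rw [HahnSeries.coeff_smul, h.fst, smul_eq_mul],
    by rw [HahnSeries.coeff_smul, h.snd, smul_eq_mul],
    by rw [HahnSeries.coeff_smul, h.trd, smul_eq_mul]⟩

end LeadingTerms

lemma leadingTerms_tSeries : LeadingTerms 5 1 12 90 tSeries := by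
  have h1 := Int.modEq_zero_iff.mp (approx_tInt_exact 6 (by norm_num))
  have h2 := Int.modEq_zero_iff.mp (approx_tInt_exact 7 (by norm_num))
  refine ⟨ordGE_tSeries, coeff_tSeries, ?_, ?_⟩
  · rw [tSeries_eq_intSeries, show (5 + 1 : ℤ) = (6 : ℕ) by norm_num, coeff_intSeries, h1]
    norm_num
  · rw [tSeries_eq_intSeries, show (5 + 2 : ℤ) = (7 : ℕ) by norm_num, coeff_intSeries, h2]
    norm_num

lemma bInt_one : bInt 1 = hTwoInt := by
  simp [bInt, baseElt, baseForm]

lemma coeff_hTwoInt : (intSeries hTwoInt).coeff 1 = 10 ∧ (intSeries hTwoInt).coeff 2 = 50 ∧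
    (intSeries hTwoInt).coeff 3 = 190 := by
  have h1 := Int.modEq_zero_iff.mp (approx_hTwoInt_exact 1 (by norm_num))
  have h2 := Int.modEq_zero_iff.mp (approx_hTwoInt_exact 2 (by norm_num))
  have h3 := Int.modEq_zero_iff.mp (approx_hTwoInt_exact 3 (by norm_num))
  have e (n : ℕ) := coeff_intSeries hTwoInt n
  refine ⟨(e 1).trans ?_, (e 2).trans ?_, (e 3).trans ?_⟩
  · rw [h1]; norm_num
  · rw [h2]; norm_num
  · rw [h3]; norm_num

lemma IsInv.eq_zero {f : ℍ → ℂ} {A B : LaurentSeries ℂ} (hf : IsInv 11 f) (hA : IsExp f A)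
    (hA1 : OrdGE 1 A) (hB : IsExp (fun τ ↦ f (fricke τ)) B) (hB0 : OrdGE 0 B) : A = 0 := by
  obtain ⟨c, hc⟩ := hf.eq_const hA (hA1.mono (by norm_num)) hB hB0
  have h := (hA.congr (g := fun _ ↦ c) fun τ ↦ (hc τ).symm).unique (IsExp.const c)
  have h1 := hA1 0 (by norm_num)
  rw [h, HahnSeries.coeff_smul, HahnSeries.coeff_one, if_pos rfl, smul_eq_mul, mul_one] at h1
  exact hA.unique (IsExp.zero.congr fun τ ↦ (hc τ).trans h1)

/-- There is no modular function for `Γ₀(11)` whose only pole is a simple pole at a cusp. -/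
lemma IsInv.eq_zero_of_simple_pole {f : ℍ → ℂ} {A B : LaurentSeries ℂ} (hf : IsInv 11 f)
    (hA : IsExp f A) (hA1 : OrdGE 1 A) (hB : IsExp (fun τ ↦ f (fricke τ)) B)
    (hB1 : OrdGE (-1) B) : A = 0 := by
  by_contra h0
  have hb : B.coeff (-1) ≠ 0 := fun hb ↦ h0 <| hf.eq_zero hA hA1 hB fun n hn ↦ by
    rcases (show n < -1 ∨ n = -1 by omega) with h | rfl
    · exact hB1 n h
    · exact hb
  -- the fifth power of `f` is a multiple of `t`
  obtain ⟨c, hc⟩ : ∃ c, A ^ 5 = c • tSeries := by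
    have h1 := (hA.pow 5).mul (isExp_tFun.inv tFun_ne_zero)
    have h2 := (hB.pow 5).mul (isExp_tFun.const_mul (11 ^ 6))
    obtain ⟨c, hc⟩ := IsInv.eq_const (f := fun τ ↦ f τ ^ 5 * (tFun τ)⁻¹)
      (fun γ hγ τ ↦ by simp only [hf γ hγ, isInv_tFun γ hγ τ]) h1
      (((hA1.pow 5).mul ordGE_tSeries_inv).mono (by norm_num))
      (h2.congr fun τ ↦ by rw [tFun_fricke, mul_inv, inv_inv, zpow_neg, inv_inv]; norm_cast)
      (((hB1.pow 5).mul (ordGE_tSeries.smul _)).mono (by norm_num))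
    refine ⟨c, (hA.pow 5).unique ((isExp_tFun.const_mul c).congr fun τ ↦ ?_)⟩
    rw [← hc τ, inv_mul_cancel_right₀ (tFun_ne_zero τ)]
  -- the function `hTwoFun` is a combination of `f` and `f ^ 2`
  obtain ⟨α, β, hαβ⟩ : ∃ α β : ℂ, intSeries hTwoInt = α • A + β • (A * A) := by
    obtain ⟨H, hH, hH'⟩ := exists_poleLE_hTwoFun
    set b := B.coeff (-1)
    set β := H.coeff (-2) / (b * b)
    set α := (H - β • (B * B)).coeff (-1) / b
    refine ⟨α, β, ?_⟩
    have h1 := (isExp_hTwoFun.sub ((hA.mul hA).const_mul β)).sub (hA.const_mul α)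
    have h2 := (hH.sub ((hB.mul hB).const_mul β)).sub (hB.const_mul α)
    have h3 := (ordGE_coeff_bInt 1).1
    rw [bInt_one, Nat.cast_one] at h3
    have h4 := IsInv.eq_zero (f := fun τ ↦ hTwoFun τ - β * (f τ * f τ) - α * f τ)
      (fun γ hγ τ ↦ by simp only [hf γ hγ, isInv_hTwoFun γ hγ τ]) h1
      ((h3.sub (((hA1.mul hA1).mono (e := 1) (by norm_num)).smul _)).sub (hA1.smul _)) h2
      (fun n hn ↦ by
        rw [HahnSeries.coeff_sub, HahnSeries.coeff_smul]
        rcases (show n < -1 ∨ n = -1 by omega) with h | rfl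
        · rw [hB1 n h, smul_zero, sub_zero, HahnSeries.coeff_sub, HahnSeries.coeff_smul]
          rcases (show n < -2 ∨ n = -2 by omega) with h | rfl
          · rw [hH'.ord n h, (hB1.mul hB1) n (by omega), smul_zero, sub_zero]
          · have := coeff_mul_of_ordGE hB1 hB1
            norm_num only at this
            rw [this, smul_eq_mul, div_mul_cancel₀ _ (mul_ne_zero hb hb), sub_self]
        · rw [smul_eq_mul, div_mul_cancel₀ _ hb, sub_self])
    rw [sub_sub, sub_eq_zero] at h4
    rw [h4, add_comm]
  -- comparing coefficients gives a contradiction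
  have hA2 : LeadingTerms 1 _ _ _ A := ⟨hA1, rfl, rfl, rfl⟩
  have h5 := (((hA2.mul hA2).mul hA2).mul hA2).mul hA2
  rw [show A * A * A * A * A = A ^ 5 by ring, hc] at h5
  have h6 := leadingTerms_tSeries.smul c
  have e1 := h5.fst.symm.trans h6.fst
  have e2 := h5.snd.symm.trans h6.snd
  have e3 := h5.trd.symm.trans h6.trd
  have h7 := hA2.mul hA2
  norm_num only at e1 e2 e3
  obtain ⟨k1, k2, k3⟩ := coeff_hTwoInt
  have c1 := h7.ord 1 (by norm_num)
  have c2 := h7.fst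
  have c3 := h7.snd
  norm_num only at c2 c3
  rw [hαβ, HahnSeries.coeff_add, HahnSeries.coeff_smul, HahnSeries.coeff_smul] at k1 k2 k3
  rw [c1] at k1
  rw [c2] at k2
  rw [c3] at k3
  generalize A.coeff 1 = x at *
  generalize A.coeff 2 = y at *
  generalize A.coeff 3 = z at *
  simp only [smul_eq_mul, mul_one, mul_zero, add_zero] at k1 k2 k3 e1
  have hx : x ≠ 0 := by
    rintro rfl
    norm_num at k1
  have hy : y = 12 / 5 * x := by
    have : x ^ 4 * (5 * y - 12 * x) = 0 := by linear_combination e2 - 12 * e1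
    have := (mul_eq_zero.mp this).resolve_left (pow_ne_zero _ hx)
    linear_combination this / 5
  subst hy
  have hz : z = 162 / 25 * x := by
    have : x ^ 4 * (5 * z - 162 / 5 * x) = 0 := by linear_combination e3 - 90 * e1
    have := (mul_eq_zero.mp this).resolve_left (pow_ne_zero _ hx)
    linear_combination this / 5
  subst hz
  have : (0 : ℂ) = 2 / 5 := by linear_combination k3 - 24 / 5 * k2 + 126 / 25 * k1
  norm_num at this

end

section

/-- The linear combination of the basis functions `bFun i` with coefficients `c i`. -/
noncomputable def bSum (c : ℕ →₀ ℂ) (τ : ℍ) : ℂ := c.sum fun i x ↦ x * bFun i τ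

lemma bSum_add_single (c : ℕ →₀ ℂ) (i : ℕ) (x : ℂ) (τ : ℍ) :
    bSum (c + Finsupp.single i x) τ = bSum c τ + x * bFun i τ := by
  rw [bSum, Finsupp.sum_add_index' (by simp) (by intros; ring), Finsupp.sum_single_index (by simp),
    bSum]

lemma exists_poleOrd_eq {p : ℕ} (hp : 2 ≤ p) : ∃ i, i ≠ 0 ∧ poleOrd i = p := by
  have h5 : p = p % 5 + 5 * (p / 5) := by omega
  have h (r m : ℕ) (hr : r < 5) : poleOrd (r + 5 * m) = baseWt r + 5 * m := by
    rw [poleOrd, Nat.add_mul_mod_self_left, Nat.mod_eq_of_lt hr]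
    omega
  obtain hr | hr | hr | hr | hr : p % 5 = 0 ∨ p % 5 = 1 ∨ p % 5 = 2 ∨ p % 5 = 3 ∨ p % 5 = 4 := by
    omega
  · exact ⟨0 + 5 * (p / 5), by omega, by rw [h 0 _ (by norm_num), baseWt]; omega⟩
  · exact ⟨4 + 5 * (p / 5 - 1), by omega, by
      rw [h 4 _ (by norm_num), show baseWt 4 = 6 from rfl]; omega⟩
  · exact ⟨1 + 5 * (p / 5), by omega, by rw [h 1 _ (by norm_num), baseWt]; omega⟩
  · exact ⟨2 + 5 * (p / 5), by omega, by rw [h 2 _ (by norm_num), baseWt]; omega⟩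
  · exact ⟨3 + 5 * (p / 5), by omega, by rw [h 3 _ (by norm_num), baseWt]; omega⟩

/-- A modular function for `Γ₀(11)` vanishing at `∞` is a linear combination of the basis functions,
with coefficients controlled by its expansion at the cusp `0`. -/
lemma IsInv.exists_eq_bSum (p : ℕ) {f : ℍ → ℂ} {A B : LaurentSeries ℂ} {a : ℤ} (hf : IsInv 11 f)
    (hA : IsExp f A) (hA1 : OrdGE 1 A) (hB : IsExp (fun τ ↦ f (fricke τ)) B) (hBp : OrdGE (-p) B)
    (hBa : (11 : ℂ) ^ a • B ∈ localSeries) :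
    ∃ c : ℕ →₀ ℂ, f = bSum c ∧ c 0 = 0 ∧ ∀ i, (11 : ℂ) ^ (a - wt i) * c i ∈ localRing := by
  induction p generalizing f A B with
  | zero =>
    refine ⟨0, ?_, rfl, fun i ↦ by simp [zero_mem]⟩
    have := hf.eq_zero hA hA1 hB (by simpa using hBp)
    funext τ
    rw [this] at hA
    rw [hA.eq_of_series IsExp.zero τ]
    simp [bSum]
  | succ p ih =>
    rcases Nat.eq_zero_or_pos p with rfl | hp
    · refine ⟨0, ?_, rfl, fun i ↦ by simp [zero_mem]⟩
      have := hf.eq_zero_of_simple_pole hA hA1 hB (by simpa using hBp)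
      funext τ
      rw [this] at hA
      rw [hA.eq_of_series IsExp.zero τ]
      simp [bSum]
    obtain ⟨i, hi, hip⟩ := exists_poleOrd_eq (show 2 ≤ p + 1 by omega)
    obtain ⟨H, hH, hH'⟩ := exists_poleLE_bFun i
    rw [hip] at hH'
    have hlead := lead_ne_zero i
    have hu : (lead i : ℂ)⁻¹ ∈ localRing := inv_intCast_mem_localRing (not_dvd_lead i)
    have h11 : (11 : ℂ) ^ (wt i : ℤ) ≠ 0 := zpow_ne_zero _ (by norm_num)
    set x := B.coeff (-(p + 1 : ℕ)) * 11 ^ (wt i : ℤ) * (lead i : ℂ)⁻¹ with hx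
    have hx1 : (11 : ℂ) ^ (a - wt i) * x ∈ localRing := by
      have h1 := mul_mem (hBa (-(p + 1 : ℕ))) hu
      rw [HahnSeries.coeff_smul, smul_eq_mul] at h1
      rw [hx, zpow_sub₀ (by norm_num)]
      convert h1 using 1
      field_simp
    have hb := ordGE_coeff_bInt i
    have hord : OrdGE 1 (A - x • intSeries (bInt i)) :=
      hA1.sub ((hb.1.mono (by exact_mod_cast Nat.pos_of_ne_zero hi)).smul x)
    have hpole : OrdGE (-p) (B - x • H) := by
      intro n hn
      rw [HahnSeries.coeff_sub, HahnSeries.coeff_smul]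
      rcases (show n < -(p + 1 : ℕ) ∨ n = -(p + 1 : ℕ) by omega) with h | rfl
      · rw [hBp n h, hH'.ord n h, smul_zero, sub_zero]
      · rw [smul_eq_mul, hx, ← hH'.coeff, sub_eq_zero]
        have h2 : H.coeff (-(p + 1 : ℕ)) ≠ 0 := by
          intro h
          have := hH'.coeff
          rw [h, mul_zero] at this
          exact hlead this.symm
        field_simp
    have hmem : (11 : ℂ) ^ a • (B - x • H) ∈ localSeries := by
      have h1 := smul_mem_localSeries hx1 hH'.mem
      rw [smul_smul, mul_right_comm, ← zpow_add₀ (by norm_num), sub_add_cancel, ← smul_smul] at h1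
      rw [smul_sub]
      exact sub_mem hBa h1
    obtain ⟨c, hc, hc0, hc1⟩ := ih
      (f := fun τ ↦ f τ - x * bFun i τ) (fun γ hγ τ ↦ by simp only [hf γ hγ, isInv_bFun i γ hγ τ])
      (hA.sub ((isExp_bFun i).const_mul x)) hord (hB.sub (hH.const_mul x)) hpole hmem
    refine ⟨c + Finsupp.single i x, ?_, ?_, fun j ↦ ?_⟩
    · funext τ
      rw [bSum_add_single, ← hc]
      ring
    · rw [Finsupp.add_apply, hc0, Finsupp.single_eq_of_ne (Ne.symm hi), zero_add]
    · rw [Finsupp.add_apply, mul_add]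
      refine add_mem (hc1 j) ?_
      rcases eq_or_ne j i with rfl | h
      · rwa [Finsupp.single_eq_same]
      · rw [Finsupp.single_eq_of_ne h, mul_zero]
        exact zero_mem _

lemma Adm.exists_eq_bSum {a : ℤ} {f : ℍ → ℂ} (hf : Adm a 1 f) :
    ∃ c : ℕ →₀ ℂ, f = bSum c ∧ c 0 = 0 ∧ ∀ i, (11 : ℂ) ^ (a - wt i) * c i ∈ localRing := by
  obtain ⟨A, hA, -, hA1⟩ := hf.exp
  obtain ⟨B, hB, hBa⟩ := hf.exp_fricke
  obtain ⟨d, hd⟩ := exists_ordGE B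
  exact hf.inv.exists_eq_bSum d.natAbs hA hA1 hB (hd.mono (by omega)) hBa

lemma isExp_bSum (c : ℕ →₀ ℂ) :
    IsExp (bSum c) (c.sum fun i x ↦ x • intSeries (bInt i)) :=
  IsExp.sum c.support fun i _ ↦ (isExp_bFun i).const_mul (c i)

lemma coeff_bSum (c : ℕ →₀ ℂ) (n : ℤ) :
    (c.sum fun i x ↦ x • intSeries (bInt i)).coeff n =
      ∑ i ∈ c.support, c i * (intSeries (bInt i)).coeff n := by
  rw [Finsupp.sum, HahnSeries.coeff_sum]
  exact Finset.sum_congr rfl fun i _ ↦ by rw [HahnSeries.coeff_smul, smul_eq_mul]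

/-- The coefficients of a combination of the basis functions are determined successively by the
expansion at `∞`. -/
lemma mul_mem_of_isExp_bSum {c : ℕ →₀ ℂ} {A : LaurentSeries ℂ} (hA : IsExp (bSum c) A) (y : ℂ)
    (K : ℕ) (h : ∀ k ≤ K, y * A.coeff k ∈ localRing) : ∀ i ≤ K, y * c i ∈ localRing := by
  intro i
  induction i using Nat.strong_induction_on with
  | _ i ih =>
    intro hi
    have hb := ordGE_coeff_bInt i
    have h1 := h i hi
    rw [hA.unique (isExp_bSum c), coeff_bSum] at h1
    have h2 : ∑ j ∈ c.support, c j * (intSeries (bInt j)).coeff i =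
        c i * lead i + ∑ j ∈ c.support.erase i, c j * (intSeries (bInt j)).coeff i := by
      by_cases hs : i ∈ c.support
      · rw [← Finset.add_sum_erase _ _ hs, hb.2]
      · rw [Finset.erase_eq_of_notMem hs, Finsupp.notMem_support_iff.mp hs, zero_mul, zero_add]
    rw [h2, mul_add, Finset.mul_sum] at h1
    have h3 : ∑ j ∈ c.support.erase i, y * (c j * (intSeries (bInt j)).coeff i) ∈ localRing := by
      refine sum_mem fun j hj ↦ ?_
      rcases lt_or_gt_of_ne (Finset.ne_of_mem_erase hj) with h | h
      · rw [← mul_assoc]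
        exact mul_mem (ih j h (by omega)) (intSeries_mem _ _)
      · rw [(ordGE_coeff_bInt j).1 i (by omega), mul_zero, mul_zero]
        exact zero_mem _
    have h4 := mul_mem (sub_mem h1 h3) (inv_intCast_mem_localRing (not_dvd_lead i))
    rw [add_sub_cancel_right, mul_assoc, mul_assoc, mul_inv_cancel₀ (lead_ne_zero i), mul_one] at h4
    exact h4

end

section

section ElemSymm

variable {ι R S : Type*} [CommRing R] [CommRing S]

/-- The elementary symmetric function of degree `k` in the elements `x i` for `i ∈ s`. -/
def elemSymm (s : Finset ι) (x : ι → R) (k : ℕ) : R := ∑ T ∈ s.powersetCard k, ∏ i ∈ T, x i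

lemma map_elemSymm (f : R →+* S) (s : Finset ι) (x : ι → R) (k : ℕ) :
    f (elemSymm s x k) = elemSymm s (fun i ↦ f (x i)) k := by
  simp only [elemSymm, map_sum, map_prod]

lemma elemSymm_zero (s : Finset ι) (x : ι → R) : elemSymm s x 0 = 1 := by
  simp [elemSymm]

lemma elemSymm_insert [DecidableEq ι] {s : Finset ι} {i : ι} (hi : i ∉ s) (x : ι → R) (k : ℕ) :
    elemSymm (insert i s) x (k + 1) = elemSymm s x (k + 1) + x i * elemSymm s x k := by
  have hT {T : Finset ι} (hT : T ∈ s.powersetCard k) : i ∉ T := fun h ↦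
    hi ((Finset.mem_powersetCard.mp hT).1 h)
  rw [elemSymm, Finset.powersetCard_succ_insert hi, Finset.sum_union, Finset.sum_image,
    elemSymm, elemSymm, Finset.mul_sum]
  · congr 1
    exact Finset.sum_congr rfl fun T h ↦ Finset.prod_insert (hT h)
  · intro T h T' h' hTT
    rw [← Finset.erase_insert (hT h), hTT, Finset.erase_insert (hT h')]
  · refine Finset.disjoint_left.mpr fun T h h' ↦ ?_
    obtain ⟨T', -, rfl⟩ := Finset.mem_image.mp h'
    exact hi ((Finset.mem_powersetCard.mp h).1 (Finset.mem_insert_self i T'))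

lemma elemSymm_eq_esymm (s : Finset ι) (x : ι → R) (k : ℕ) :
    elemSymm s x k = (s.val.map x).esymm k := by
  rw [Finset.esymm_map_val, elemSymm]

/-- Newton's identities. -/
lemma mul_elemSymm_eq (s : Finset ι) (x : ι → R) (k : ℕ) :
    k * elemSymm s x k = (-1) ^ (k + 1) * ∑ a ∈ Finset.HasAntidiagonal.antidiagonal k with a.1 < k,
      (-1) ^ a.1 * elemSymm s x a.1 * ∑ i ∈ s, x i ^ a.2 := by
  have h := congrArg (MvPolynomial.aeval fun i : s ↦ x i) (MvPolynomial.mul_esymm_eq_sum s R k)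
  have he (n : ℕ) : MvPolynomial.aeval (fun i : s ↦ x i) (MvPolynomial.esymm s R n) =
      elemSymm s x n := by
    rw [MvPolynomial.aeval_esymm_eq_multiset_esymm, elemSymm_eq_esymm]
    congr 1
    exact Multiset.attach_map_val' s.val x
  have hp (n : ℕ) : MvPolynomial.aeval (fun i : s ↦ x i) (MvPolynomial.psum s R n) =
      ∑ i ∈ s, x i ^ n := by
    rw [MvPolynomial.psum, map_sum]
    simp only [map_pow, MvPolynomial.aeval_X]
    exact Finset.sum_coe_sort s (fun i ↦ x i ^ n)
  simpa only [map_mul, map_natCast, map_pow, map_neg, map_one, map_sum, he, hp] using h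

lemma sum_elemSymm_mul_pow {s : Finset ι} {i : ι} (hi : i ∈ s) (x : ι → R) :
    ∑ k ∈ Finset.range (s.card + 1), (-1) ^ k * elemSymm s x k * x i ^ (s.card - k) = 0 := by
  have h := congrArg (Polynomial.eval (x i)) (Multiset.prod_X_sub_X_eq_sum_esymm (s.val.map x))
  rw [Polynomial.eval_multiset_prod, Polynomial.eval_finsetSum] at h
  rw [Multiset.prod_eq_zero] at h
  · rw [h, Multiset.card_map]
    refine Finset.sum_congr rfl fun k _ ↦ ?_
    rw [elemSymm_eq_esymm]
    simp [mul_assoc]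
  · simp only [Multiset.map_map, Multiset.mem_map]
    exact ⟨i, hi, by simp⟩

end ElemSymm

end

section

/-! ### The elementary symmetric functions of the conjugates of `t` -/

lemma natCast_mul_elemSymm_mem {ι R : Type*} [CommRing R] (P : ℕ → AddSubgroup R)
    (hmul : ∀ {i j x y}, x ∈ P i → y ∈ P j → x * y ∈ P (i + j)) (s : Finset ι) (x : ι → R)
    (hp : ∀ j, 1 ≤ j → ∑ i ∈ s, x i ^ j ∈ P j) {k : ℕ} (hk : 1 ≤ k)
    (he : ∀ i, 1 ≤ i → i < k → elemSymm s x i ∈ P i) : k * elemSymm s x k ∈ P k := by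
  have hsign {n : ℕ} {y : R} {i : ℕ} (hy : y ∈ P i) : (-1) ^ n * y ∈ P i := by
    rcases neg_one_pow_eq_or R n with h | h <;> rw [h]
    · rwa [one_mul]
    · rw [neg_one_mul]; exact neg_mem hy
  rw [mul_elemSymm_eq]
  refine hsign (sum_mem fun a ha ↦ ?_)
  rw [Finset.mem_filter, Finset.HasAntidiagonal.mem_antidiagonal] at ha
  obtain ⟨ha1, ha2⟩ := ha
  rw [mul_assoc]
  refine hsign ?_
  rcases Nat.eq_zero_or_pos a.1 with h0 | h0
  · rw [h0, elemSymm_zero, one_mul, show a.2 = k by omega]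
    exact hp k hk
  · rw [← ha1]
    exact hmul (he _ h0 ha2) (hp _ (by omega))

lemma elemSymm_mem {ι R : Type*} [CommRing R] (P : ℕ → AddSubgroup R)
    (hmul : ∀ {i j x y}, x ∈ P i → y ∈ P j → x * y ∈ P (i + j)) (s : Finset ι) (x : ι → R)
    (hp : ∀ j, 1 ≤ j → ∑ i ∈ s, x i ^ j ∈ P j)
    (hdiv : ∀ {k : ℕ} {x : R}, 1 ≤ k → k ≤ 10 → k * x ∈ P k → x ∈ P k) {k : ℕ} (hk : 1 ≤ k)
    (hk' : k ≤ 10) : elemSymm s x k ∈ P k := by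
  induction k using Nat.strong_induction_on with
  | _ k ih =>
    exact hdiv hk hk' (natCast_mul_elemSymm_mem P hmul s x hp hk
      fun i h h' ↦ ih i h' h (h'.le.trans hk'))

/-- Functions invariant under `Γ₀(11)` whose expansion at `∞` is divisible by `11` and has order
at least `5 * k / 11`. -/
noncomputable def symGroup (k : ℕ) : AddSubgroup (ℍ → ℂ) where
  carrier := {f | IsInv 11 f ∧ ∃ A, IsExp f ((11 : ℂ) • A) ∧ A ∈ localSeries ∧
    OrdGE ((5 * k + 10) / 11 : ℤ) A}
  add_mem' := by
    rintro f g ⟨hi, A, hA, hA1, hA2⟩ ⟨hi', A', hA', hA1', hA2'⟩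
    refine ⟨invRing.add_mem hi hi', A + A', ?_, add_mem hA1 hA1', hA2.add hA2'⟩
    rw [smul_add]
    exact hA.add hA'
  zero_mem' := ⟨invRing.zero_mem, 0, by rw [smul_zero]; exact IsExp.zero, zero_mem _, OrdGE.zero _⟩
  neg_mem' := by
    rintro f ⟨hi, A, hA, hA1, hA2⟩
    refine ⟨invRing.neg_mem hi, -A, ?_, neg_mem hA1, hA2.neg⟩
    rw [smul_neg]
    exact hA.neg

/-- Functions with an `11`-integral expansion at `∞`. -/
noncomputable def intExpGroup : AddSubgroup (ℍ → ℂ) where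
  carrier := {f | ∃ A, IsExp f A ∧ A ∈ localSeries}
  add_mem' := by
    rintro f g ⟨A, hA, hA1⟩ ⟨A', hA', hA1'⟩
    exact ⟨_, hA.add hA', add_mem hA1 hA1'⟩
  zero_mem' := ⟨0, IsExp.zero, zero_mem _⟩
  neg_mem' := by
    rintro f ⟨A, hA, hA1⟩
    exact ⟨_, hA.neg, neg_mem hA1⟩

lemma inv_natCast_mem_localRing {k : ℕ} (hk : 1 ≤ k) (hk' : k ≤ 10) :
    ((k : ℂ))⁻¹ ∈ localRing := by
  have := inv_intCast_mem_localRing (d := k) (by omega)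
  rwa [Int.cast_natCast] at this

lemma natCast_mul_eq_smul (k : ℕ) (hk : 1 ≤ k) (f : ℍ → ℂ) (τ : ℍ) :
    f τ = (k : ℂ)⁻¹ * (k * f) τ := by
  rw [Pi.mul_apply, Pi.natCast_apply, inv_mul_cancel_left₀]
  exact_mod_cast (by omega)

lemma mem_symGroup_of_natCast_mul {k : ℕ} {f : ℍ → ℂ} (hk : 1 ≤ k) (hk' : k ≤ 10)
    (hf : k * f ∈ symGroup k) : f ∈ symGroup k := by
  obtain ⟨hi, A, hA, hA1, hA2⟩ := hf
  refine ⟨fun γ hγ τ ↦ ?_, (k : ℂ)⁻¹ • A, ?_,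
    smul_mem_localSeries (inv_natCast_mem_localRing hk hk') hA1, hA2.smul _⟩
  · rw [natCast_mul_eq_smul k hk f, hi γ hγ, ← natCast_mul_eq_smul k hk f]
  · rw [smul_comm]
    exact (hA.const_mul _).congr (natCast_mul_eq_smul k hk f)

lemma mem_intExpGroup_of_natCast_mul {k : ℕ} {f : ℍ → ℂ} (hk : 1 ≤ k) (hk' : k ≤ 10)
    (hf : k * f ∈ intExpGroup) : f ∈ intExpGroup := by
  obtain ⟨A, hA, hA1⟩ := hf
  exact ⟨_, (hA.const_mul _).congr (natCast_mul_eq_smul k hk f),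
    smul_mem_localSeries (inv_natCast_mem_localRing hk hk') hA1⟩

lemma mul_mem_symGroup {i j : ℕ} {f g : ℍ → ℂ} (hf : f ∈ symGroup i) (hg : g ∈ symGroup j) :
    f * g ∈ symGroup (i + j) := by
  obtain ⟨hi, A, hA, hA1, hA2⟩ := hf
  obtain ⟨hi', A', hA', hA1', hA2'⟩ := hg
  refine ⟨invRing.mul_mem hi hi', (11 : ℂ) • (A * A'), ?_, ?_, ?_⟩
  · rw [← smul_mul_eq, ← mul_smul_eq]
    exact hA.mul hA'
  · exact smul_mem_localSeries (natCast_mem_localRing 11) (mul_mem_localSeries hA1 hA1')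
  · exact ((hA2.mul hA2').mono (by push_cast; omega)).smul _

lemma mul_mem_intExpGroup {f g : ℍ → ℂ} (hf : f ∈ intExpGroup) (hg : g ∈ intExpGroup) :
    f * g ∈ intExpGroup := by
  obtain ⟨A, hA, hA1⟩ := hf
  obtain ⟨A', hA', hA1'⟩ := hg
  exact ⟨_, hA.mul hA', mul_mem_localSeries hA1 hA1'⟩

/-- The conjugates of `t` under the Hecke correspondence at `11`. -/
noncomputable def conjT (b : ZMod 11) (τ : ℍ) : ℂ := tFun (cosetPt b τ)

lemma sum_conjT_pow_apply (j : ℕ) (τ : ℍ) :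
    (∑ b, conjT b ^ j) τ = 11 * uOp (tFun ^ j) τ := by
  simp only [uOp, Finset.sum_apply, Pi.pow_apply, conjT]
  ring

lemma sum_conjT_pow_mem (j : ℕ) : ∑ b, conjT b ^ j ∈ symGroup j := by
  refine ⟨fun γ hγ τ ↦ ?_, uSeries (tSeries ^ j), (isExp_tFun.pow j).uOp.const_mul _ |>.congr
    (sum_conjT_pow_apply j), uSeries_mem (pow_mem_localSeries tSeries_mem j),
    (ordGE_tSeries.pow j).uSeries (by omega)⟩
  have h : IsInv 11 (uOp (tFun ^ j)) :=
    ((invRing.pow_mem isInv_tFun j : IsInv 11 _).mono (by norm_num)).uOp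
  rw [sum_conjT_pow_apply, sum_conjT_pow_apply, h γ hγ]

/-- The elementary symmetric functions of the conjugates of `t`. -/
noncomputable def sigma (k : ℕ) : ℍ → ℂ := elemSymm Finset.univ conjT k

lemma sigma_mem {k : ℕ} (hk : 1 ≤ k) (hk' : k ≤ 10) : sigma k ∈ symGroup k :=
  elemSymm_mem symGroup mul_mem_symGroup _ _ (fun j _ ↦ sum_conjT_pow_mem j)
    mem_symGroup_of_natCast_mul hk hk'

lemma eleven_mul_sigma_mem : ((11 : ℕ) : ℍ → ℂ) * sigma 11 ∈ symGroup 11 :=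
  natCast_mul_elemSymm_mem symGroup mul_mem_symGroup _ _ (fun j _ ↦ sum_conjT_pow_mem j)
    (by norm_num) fun _ h h' ↦ sigma_mem h (by omega)

/-! At the cusp `0` the conjugate `t(τ / 11)` plays a special role. -/

lemma conjT_zero_fricke (τ : ℍ) :
    conjT 0 (fricke τ) = 11 ^ (-6 : ℤ) * (tFun (elevenMul τ))⁻¹ := by
  rw [conjT, cosetPt_zero_fricke, tFun_fricke]

lemma exists_isExp_conjT_zero_fricke : ∃ B ∈ localSeries,
    IsExp (fun τ ↦ conjT 0 (fricke τ)) ((11 : ℂ) ^ (-6 : ℤ) • B) :=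
  ⟨_, vSeries_mem tSeries_inv_mem,
    ((isExp_tFun.inv tFun_ne_zero).comp_elevenMul.const_mul _).congr conjT_zero_fricke⟩

/-- Precomposition with the Fricke involution. -/
noncomputable def compFricke : (ℍ → ℂ) →+* (ℍ → ℂ) where
  toFun f τ := f (fricke τ)
  map_one' := rfl
  map_mul' _ _ := rfl
  map_zero' := rfl
  map_add' _ _ := rfl

lemma IsInv.isExp_sum_cosetPt_fricke {f : ℍ → ℂ} (hf : IsInv 11 f) {A : LaurentSeries ℂ}
    (hA : IsExp f A) :
    IsExp (fun τ ↦ ∑ b ∈ Finset.univ.erase (0 : ZMod 11), f (cosetPt b (fricke τ)))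
      ((11 : ℂ) • vSeries (uSeries A) - A) := by
  refine ((hA.uOp.comp_elevenMul.const_mul 11).sub hA).congr fun τ ↦ ?_
  have h1 := sum_eq_zero_add fun b ↦ f (cosetPt b (fricke τ))
  have h2 : ∀ β : ZMod 11, (if β = 0 then 0 else f (cosetPt (-β⁻¹) (fricke τ))) =
      f (shiftEleven β τ) - if β = 0 then f τ else 0 := fun β ↦ by
    split_ifs with hβ
    · rw [hβ, eq_comm, sub_eq_zero]
      congr 1; ext; simp [shiftEleven]
    · rw [hf.apply_cosetPt_fricke hA hβ, sub_zero]
  rw [← add_right_inj (f (cosetPt 0 (fricke τ))), Finset.add_sum_erase _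
    (fun b ↦ f (cosetPt b (fricke τ))) (Finset.mem_univ 0), h1,
    Finset.sum_congr rfl fun β _ ↦ h2 β, Finset.sum_sub_distrib,
    Finset.sum_ite_eq', if_pos (Finset.mem_univ _)]
  simp only [RamanujanEleven.uOp, cosetPt_elevenMul]
  ring

lemma sum_conjT_fricke_pow_mem (j : ℕ) :
    ∑ b ∈ Finset.univ.erase 0, compFricke (conjT b) ^ j ∈ intExpGroup := by
  have hA := isExp_tFun.pow j
  have hA1 := pow_mem_localSeries tSeries_mem j
  have hi : IsInv 11 (tFun ^ j) := invRing.pow_mem isInv_tFun j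
  generalize tSeries ^ j = A at hA hA1
  refine ⟨_, (hi.isExp_sum_cosetPt_fricke hA).congr fun τ ↦ ?_, sub_mem
    (smul_mem_localSeries (natCast_mem_localRing 11) (vSeries_mem (uSeries_mem hA1))) hA1⟩
  rw [Finset.sum_apply]
  rfl

/-- The elementary symmetric functions of the conjugates of `t` other than `t(τ / 11)`, at the
cusp `0`. -/
noncomputable def sigmaRest (k : ℕ) : ℍ → ℂ :=
  elemSymm (Finset.univ.erase 0) (fun b ↦ compFricke (conjT b)) k

lemma sigmaRest_mem {k : ℕ} (hk : k ≤ 11) : sigmaRest k ∈ intExpGroup := by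
  rcases Nat.eq_zero_or_pos k with rfl | h0
  · rw [sigmaRest, elemSymm_zero]
    exact ⟨1, IsExp.one, one_mem _⟩
  rcases Nat.lt_or_ge k 11 with h | h
  · exact elemSymm_mem (fun _ ↦ intExpGroup) mul_mem_intExpGroup _ _
      (fun j _ ↦ sum_conjT_fricke_pow_mem j) mem_intExpGroup_of_natCast_mul h0 (by omega)
  · have : sigmaRest k = 0 := by
      rw [sigmaRest, elemSymm, Finset.powersetCard_eq_empty.mpr, Finset.sum_empty]
      rw [Finset.card_erase_of_mem (Finset.mem_univ _), Finset.card_univ, ZMod.card]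
      omega
    rw [this]
    exact zero_mem _

lemma sigma_succ_fricke (k : ℕ) :
    compFricke (sigma (k + 1)) = sigmaRest (k + 1) + compFricke (conjT 0) * sigmaRest k := by
  rw [sigma, map_elemSymm, ← Finset.insert_erase (Finset.mem_univ (0 : ZMod 11)),
    elemSymm_insert (Finset.notMem_erase _ _)]
  rfl

lemma exists_isExp_sigma_fricke {k : ℕ} (hk : 1 ≤ k) (hk' : k ≤ 11) :
    ∃ B, IsExp (fun τ ↦ sigma k (fricke τ)) B ∧ (11 : ℂ) ^ (6 : ℤ) • B ∈ localSeries := by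
  obtain ⟨k, rfl⟩ : ∃ n, k = n + 1 := ⟨k - 1, by omega⟩
  obtain ⟨A, hA, hA1⟩ := sigmaRest_mem hk'
  obtain ⟨A', hA', hA1'⟩ := sigmaRest_mem (k := k) (by omega)
  obtain ⟨B, hB, hB'⟩ := exists_isExp_conjT_zero_fricke
  refine ⟨_, (hA.add (hB'.mul hA')).congr
    fun τ ↦ congrFun (sigma_succ_fricke k) τ, ?_⟩
  rw [smul_add, smul_mul_eq, smul_smul, ← zpow_add₀ (by norm_num), add_neg_cancel, zpow_zero,
    one_smul]
  exact add_mem (smul_mem_localSeries (zpow_mem_localRing (by norm_num)) hA1)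
    (mul_mem_localSeries hB hA1')

lemma adm_sigma {k : ℕ} (hk : 1 ≤ k) (hk' : k ≤ 10) :
    Adm 7 ((5 * k + 10) / 11) ((11 : ℂ)⁻¹ • sigma k) := by
  obtain ⟨hi, A, hA, hA1, hA2⟩ := sigma_mem hk hk'
  obtain ⟨B, hB, hB1⟩ := exists_isExp_sigma_fricke hk (hk'.trans (by norm_num))
  refine ⟨fun γ hγ τ ↦ by rw [Pi.smul_apply, Pi.smul_apply, hi γ hγ], ⟨A, ?_, hA1, hA2⟩,
    (11 : ℂ)⁻¹ • B, hB.const_mul _, ?_⟩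
  · have := hA.const_mul (11 : ℂ)⁻¹
    rwa [smul_smul, inv_mul_cancel₀ (by norm_num), one_smul] at this
  · rw [smul_smul, ← zpow_sub_one₀ (by norm_num)]
    exact hB1

lemma adm_sigma_eleven : Adm 6 5 (sigma 11) := by
  obtain ⟨hi, A, hA, hA1, hA2⟩ := eleven_mul_sigma_mem
  have h (τ : ℍ) := natCast_mul_eq_smul 11 (by norm_num) (sigma 11) τ
  refine ⟨fun γ hγ τ ↦ ?_, ⟨A, ?_, hA1, hA2.mono (by norm_num)⟩,
    exists_isExp_sigma_fricke (by norm_num) le_rfl⟩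
  · rw [h, hi γ hγ, ← h]
  · have := (hA.const_mul (11 : ℂ)⁻¹).congr h
    rwa [smul_smul, inv_mul_cancel₀ (by norm_num), one_smul] at this

end

section

/-- Sums of functions `11 ^ k • f` where the pole of `f` at the cusp `0` is `11`-integral after
multiplication by `11 ^ (7 * k + x)`. -/
inductive Filt (x d : ℤ) : (ℍ → ℂ) → Prop
  | of (k : ℕ) {f : ℍ → ℂ} (hf : Adm (7 * k + x) d f) : Filt x d ((11 : ℂ) ^ k • f)
  | add {f g : ℍ → ℂ} (hf : Filt x d f) (hg : Filt x d g) : Filt x d (f + g)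

lemma Adm.filt {x d : ℤ} {f : ℍ → ℂ} (hf : Adm x d f) : Filt x d f := by
  have := Filt.of (x := x) 0 (hf.mono (by simp) le_rfl)
  rwa [pow_zero, one_smul] at this

namespace Filt

variable {x y d e : ℤ} {f g : ℍ → ℂ}

lemma mono (hf : Filt x d f) (h : x ≤ y) (h' : e ≤ d) : Filt y e f := by
  induction hf with
  | of k hf => exact .of k (hf.mono (by linarith) h')
  | add _ _ h h' => exact h.add h'

lemma smul {c : ℂ} (hc : c ∈ localRing) (hf : Filt x d f) : Filt x d (c • f) := by
  induction hf with
  | of k hf => rw [smul_comm]; exact .of k (hf.smul hc)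
  | add _ _ h h' => rw [smul_add]; exact h.add h'

lemma mul (hf : Filt x d f) (hg : Filt y e g) : Filt (x + y) (d + e) (f * g) := by
  induction hf with
  | of k hf =>
    induction hg with
    | of l hg =>
      rw [smul_mul_smul_comm, ← pow_add]
      exact .of (k + l) ((hf.mul hg).mono (by push_cast; linarith) le_rfl)
    | add _ _ h h' => rw [mul_add]; exact h.add h'
  | add _ _ h h' => rw [add_mul]; exact h.add h'

lemma sum {ι : Type*} (s : Finset ι) {f : ι → ℍ → ℂ} (h : ∀ i ∈ s, Filt x d (f i)) :
    Filt x d (∑ i ∈ s, f i) :=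
  Finset.sum_induction _ (Filt x d) (fun _ _ h h' ↦ h.add h') Adm.zero.filt h

end Filt

lemma filt_sigma {k : ℕ} (hk : 1 ≤ k) (hk' : k ≤ 10) : Filt 0 ((5 * k + 10) / 11) (sigma k) := by
  have := Filt.of (x := 0) 1 ((adm_sigma hk hk').mono (by simp) le_rfl)
  rwa [pow_one, smul_smul, mul_inv_cancel₀ (by norm_num), one_smul] at this

lemma uOp_mul_tFun_zpow_apply (f : ℍ → ℂ) (n : ℤ) (τ : ℍ) :
    uOp (f * tFun ^ n) τ = 11⁻¹ * ∑ b, f (cosetPt b τ) * conjT b τ ^ n := rfl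

lemma uOp_mul_tFun_zpow_eq (f : ℍ → ℂ) (n : ℤ) :
    uOp (f * tFun ^ n) =
      ∑ k ∈ Finset.range 11, ((-1) ^ k : ℂ) • (sigma (k + 1) * uOp (f * tFun ^ (n - (k + 1)))) := by
  ext τ
  rw [Finset.sum_apply]
  simp only [Pi.smul_apply, Pi.mul_apply, uOp_mul_tFun_zpow_apply, Finset.mul_sum, smul_eq_mul]
  rw [Finset.sum_comm]
  refine Finset.sum_congr rfl fun b _ ↦ ?_
  have h0 : conjT b τ ≠ 0 := tFun_ne_zero _
  have h := congrFun (sum_elemSymm_mul_pow (Finset.mem_univ b) conjT) τ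
  rw [Finset.card_univ, ZMod.card, Finset.sum_range_succ', elemSymm_zero] at h
  simp only [Pi.add_apply, Finset.sum_apply, Pi.mul_apply, Pi.pow_apply, Pi.neg_apply,
    Pi.one_apply, Pi.zero_apply, pow_zero, one_mul, Nat.sub_zero] at h
  have h1 : conjT b τ ^ n = conjT b τ ^ (n - 11) * conjT b τ ^ 11 := by
    rw [← zpow_natCast, ← zpow_add₀ h0, Nat.cast_ofNat, sub_add_cancel]
  rw [h1, eq_neg_of_add_eq_zero_right h, ← Finset.sum_neg_distrib, Finset.mul_sum, Finset.mul_sum,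
    Finset.mul_sum]
  refine Finset.sum_congr rfl fun k hk ↦ ?_
  rw [Finset.mem_range] at hk
  have h2 : conjT b τ ^ (n - (k + 1)) = conjT b τ ^ (n - 11) * conjT b τ ^ (11 - (k + 1)) := by
    rw [← zpow_natCast, ← zpow_add₀ h0]
    congr 1
    omega
  rw [h2, sigma]
  ring

variable {g : ℍ → ℂ}

lemma Adm.uOp_mul (hg : g = 1 ∨ g = phi) {a b d e : ℤ} {f : ℍ → ℂ} (hf : Adm a d f)
    (h1 : a + 2 ≤ b) (h2 : 1 ≤ b) (h3 : 11 * e ≤ d + 10) :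
    Adm b e (RamanujanEleven.uOp (g * f)) := by
  rcases hg with rfl | rfl
  · rw [one_mul]; exact hf.uOp (by omega) h2 h3
  · exact hf.uOp_phi h1 h2 (by omega)

lemma Adm.mul_tFun_zpow {a d : ℤ} {f : ℍ → ℂ} (hf : Adm a d f) (n : ℤ) :
    Adm (a + 6 * n) (d + 5 * n) (f * tFun ^ n) := by
  obtain ⟨m, rfl | rfl⟩ := n.eq_nat_or_neg
  · rw [zpow_natCast]
    exact (hf.mul (adm_tFun.pow m)).mono (by linarith) (by linarith)
  · rw [zpow_neg, zpow_natCast, ← inv_pow]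
    exact (hf.mul (adm_tFun_inv.pow m)).mono (by linarith) (by linarith)

lemma filt_uOp_mul_tFun_zpow (hg : g = 1 ∨ g = phi) {a d : ℤ} (ha : a ≤ 6) {f : ℍ → ℂ}
    (hf : Adm a d f) (n : ℕ) : ∀ m : ℤ, -10 ≤ m → m ≤ n →
      Filt (8 + 6 * (m / 11)) ((5 * m + d + 10) / 11) (uOp (g * (f * tFun ^ m))) := by
  induction n using Nat.strong_induction_on with
  | _ n ih =>
  intro m hm hmn
  rcases le_or_gt m 0 with h0 | h0
  · exact ((hf.mul_tFun_zpow m).uOp_mul hg (by omega) (by omega) (by omega)).filt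
  · have hS (k : ℕ) := ih (n - 1) (by omega) (m - (k + 1))
    rw [← mul_assoc, uOp_mul_tFun_zpow_eq]
    refine Filt.sum _ fun k hk ↦ Filt.smul (pow_mem (neg_mem (one_mem _)) k) ?_
    rw [Finset.mem_range] at hk
    rw [mul_assoc]
    have h := hS k (by omega) (by omega)
    rcases Nat.lt_or_ge k 10 with h10 | h10
    · exact ((filt_sigma (k := k + 1) (by omega) (by omega)).mul h).mono (by omega)
        (by push_cast; omega)
    · obtain rfl : k = 10 := by omega
      exact (adm_sigma_eleven.filt.mul h).mono (by push_cast; omega) (by push_cast; omega)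

lemma bFun_eq (i : ℕ) : bFun i = bFun (i % 5) * tFun ^ ((i / 5 : ℕ) : ℤ) := by
  rw [bFun, bFun, baseElt, baseElt, Nat.mod_mod, Nat.div_eq_of_lt (Nat.mod_lt _ (by norm_num)),
    pow_zero, mul_one, zpow_natCast]

lemma filt_uOp_bFun (hg : g = 1 ∨ g = phi) {i : ℕ} (hi : 1 ≤ i) :
    Filt (8 + 6 * (i / 5 / 11 : ℕ)) 1 (uOp (g * bFun i)) := by
  have h : (wt (i % 5) : ℤ) ≤ 6 := by
    have := Nat.mod_lt i (show 5 > 0 by norm_num)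
    interval_cases i % 5 <;> decide
  rw [bFun_eq]
  exact (filt_uOp_mul_tFun_zpow hg h (adm_bFun (i % 5)) (i / 5) (i / 5 : ℕ) (by omega)
    le_rfl).mono (by omega) (by omega)

lemma bSum_add (c c' : ℕ →₀ ℂ) : bSum (c + c') = bSum c + bSum c' := by
  ext τ
  exact Finsupp.sum_add_index' (fun _ ↦ zero_mul _) fun _ _ _ ↦ add_mul _ _ _

lemma bSum_smul (x : ℂ) (c : ℕ →₀ ℂ) : bSum (x • c) = x • bSum c := by
  ext τ
  rw [bSum, Finsupp.sum_smul_index' fun _ ↦ zero_mul _, Pi.smul_apply, bSum, Finsupp.smul_sum]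
  simp only [smul_eq_mul, mul_assoc]

lemma Filt.exists_eq_bSum {x : ℤ} {f : ℍ → ℂ} (hf : Filt x 1 f) :
    ∃ c, f = bSum c ∧ c 0 = 0 ∧ ∀ i (e : ℤ), (∀ k : ℕ, e ≤ k ∨ e ≤ wt i - 6 * k - x) →
      (11 : ℂ) ^ (-e) * c i ∈ localRing := by
  induction hf with
  | of k hf =>
    obtain ⟨c, rfl, hc0, hc⟩ := hf.exists_eq_bSum
    obtain ⟨-, ⟨A, hA, hA1, -⟩, -⟩ := hf
    refine ⟨(11 : ℂ) ^ k • c, (bSum_smul _ c).symm, by simp [hc0], fun i e h ↦ ?_⟩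
    rw [Finsupp.smul_apply, smul_eq_mul, ← mul_assoc, ← zpow_natCast, ← zpow_add₀ (by norm_num)]
    rcases h k with h | h
    · have h1 := mul_mem_of_isExp_bSum hA 1 i (fun n _ ↦ by rw [one_mul]; exact hA1 n) i le_rfl
      rw [one_mul] at h1
      exact mul_mem (zpow_mem_localRing (by omega)) h1
    · have h1 := mul_mem (zpow_mem_localRing (k := -e + k - (7 * k + x - wt i)) (by omega)) (hc i)
      rwa [← mul_assoc, ← zpow_add₀ (by norm_num), sub_add_cancel] at h1
  | add _ _ h h' =>
    obtain ⟨c, rfl, hc0, hc⟩ := h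
    obtain ⟨c', rfl, hc0', hc'⟩ := h'
    refine ⟨c + c', (bSum_add c c').symm, by simp [hc0, hc0'], fun i e h ↦ ?_⟩
    rw [Finsupp.add_apply, mul_add]
    exact add_mem (hc i e h) (hc' i e h)

end

section

/-- The coefficients of `bInt i` modulo `121`, for `i < 13`. -/
def bLists : List (List ℤ) :=
  [[1], [0, 10, 50, 69, 25, 35, 59, 116, 89, 105, 43, 77, 13, 61, 118, 82, 53, 89, 107, 86, 93,
   103, 22, 86, 30, 5, 85, 25, 37, 39, 58, 65, 83, 11, 5, 32, 48, 75, 100, 26, 108, 31, 86, 0,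
   11, 32, 67, 3, 72, 49, 102, 30, 81, 120, 59, 88, 60, 116, 96, 86, 18, 1, 28, 74, 108, 21,
   55], [0, 0, 70, 25, 42, 97, 98, 37, 74, 45, 58, 11, 54, 70, 20, 101, 107, 19, 42, 105, 82,
   32, 55, 33, 9, 25, 119, 65, 76, 15, 35, 45, 114, 88, 7, 113, 94, 42, 19, 65, 61, 50, 72, 55,
   88, 73, 118, 47, 95, 119, 13, 108, 10, 100, 21, 99, 84, 114, 86, 75, 20, 74, 4, 64, 38, 80,
   77], [0, 0, 0, 95, 120, 10, 55, 33, 0, 72, 22, 33, 27, 0, 54, 1, 15, 33, 110, 44, 19, 55, 44,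
   33, 99, 106, 120, 27, 77, 22, 55, 6, 88, 22, 75, 11, 91, 10, 81, 99, 11, 33, 91, 66, 22, 108,
   99, 62, 86, 109, 0, 88, 11, 17, 33, 55, 64, 55, 54, 120, 87, 22, 77, 66, 85, 33, 110], [0, 0,
   0, 0, 60, 101, 81, 49, 94, 23, 8, 55, 49, 62, 108, 32, 100, 76, 42, 14, 109, 91, 33, 84, 29,
   16, 45, 31, 64, 79, 21, 37, 10, 77, 31, 82, 115, 39, 86, 86, 97, 19, 109, 36, 77, 95, 18, 81,
   98, 24, 31, 89, 70, 64, 75, 11, 88, 83, 39, 36, 101, 90, 45, 11, 99, 38, 22], [0, 0, 0, 0, 0,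
   1, 12, 90, 36, 115, 18, 22, 48, 88, 41, 119, 23, 22, 24, 14, 55, 55, 110, 99, 61, 77, 22,
   100, 89, 79, 11, 104, 73, 55, 88, 93, 0, 88, 100, 67, 22, 113, 0, 55, 55, 15, 88, 88, 55,
   100, 34, 101, 113, 49, 11, 77, 77, 110, 85, 0, 100, 88, 2, 99, 110, 51, 33], [0, 0, 0, 0, 0,
   0, 10, 49, 117, 26, 57, 11, 14, 75, 20, 52, 90, 7, 60, 101, 90, 5, 55, 101, 119, 42, 46, 42,
   14, 0, 80, 33, 62, 88, 29, 39, 59, 73, 10, 54, 99, 60, 91, 26, 88, 48, 48, 43, 34, 101, 8,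
   58, 111, 25, 22, 99, 5, 53, 6, 102, 23, 10, 119, 44, 90, 105, 77], [0, 0, 0, 0, 0, 0, 0, 70,
   18, 108, 47, 77, 102, 48, 17, 3, 33, 7, 51, 51, 60, 100, 110, 98, 69, 2, 2, 82, 77, 20, 69,
   3, 7, 77, 104, 6, 116, 60, 72, 113, 116, 16, 38, 63, 88, 35, 44, 80, 82, 35, 85, 93, 115, 26,
   60, 44, 49, 40, 34, 31, 99, 10, 88, 108, 57, 100, 33], [0, 0, 0, 0, 0, 0, 0, 0, 95, 50, 78,
   117, 19, 41, 16, 49, 8, 75, 46, 63, 82, 43, 24, 82, 4, 107, 6, 20, 38, 77, 87, 108, 9, 78, 7,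
   22, 34, 101, 43, 34, 82, 5, 112, 90, 89, 53, 73, 11, 97, 12, 37, 94, 82, 110, 82, 85, 46, 47,
   77, 40, 62, 104, 3, 81, 30, 88, 38], [0, 0, 0, 0, 0, 0, 0, 0, 0, 60, 95, 38, 50, 116, 118,
   92, 13, 86, 40, 66, 51, 102, 36, 55, 107, 6, 38, 88, 6, 8, 46, 94, 75, 62, 73, 1, 60, 82, 71,
   95, 39, 114, 36, 6, 51, 27, 100, 14, 62, 113, 75, 49, 29, 118, 14, 89, 15, 105, 83, 39, 55,
   7, 49, 77, 41, 118, 57], [0, 0, 0, 0, 0, 0, 0, 0, 0, 0, 1, 24, 82, 54, 119, 80, 87, 44, 86,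
   102, 8, 15, 109, 43, 102, 40, 47, 55, 119, 0, 92, 110, 82, 115, 64, 86, 108, 105, 52, 37,
   111, 17, 44, 50, 5, 120, 74, 14, 10, 66, 106, 67, 0, 38, 104, 29, 3, 28, 71, 9, 9, 22, 92,
   39, 68, 109, 102], [0, 0, 0, 0, 0, 0, 0, 0, 0, 0, 0, 10, 48, 32, 29, 19, 115, 78, 17, 38, 56,
   29, 28, 17, 45, 23, 56, 84, 67, 84, 46, 52, 79, 113, 53, 64, 15, 16, 29, 16, 17, 63, 65, 106,
   36, 79, 0, 29, 61, 118, 97, 56, 112, 36, 71, 46, 90, 117, 98, 95, 94, 2, 50, 76, 29, 20, 4],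
   [0, 0, 0, 0, 0, 0, 0, 0, 0, 0, 0, 0, 70, 11, 90, 38, 62, 11, 99, 55, 75, 11, 66, 88, 44, 84,
   21, 94, 88, 66, 44, 87, 55, 110, 109, 99, 45, 120, 44, 0, 66, 88, 73, 22, 88, 94, 88, 78, 44,
   120, 33, 77, 44, 66, 33, 88, 91, 22, 17, 46, 9, 88, 0, 99, 87, 11, 44]]

/-- The coefficients of `uInt (phiInt * bInt i)` modulo `121`, for `i < 13`. -/
def uPhiLists : List (List ℤ) :=
  [[0, 11, 55, 88, 88, 99, 77], [0, 66, 88, 44, 44, 110, 99], [0, 99, 77, 55, 33, 11, 11], [0,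
   106, 68, 34, 12, 118, 27], [0, 60, 47, 73, 95, 34, 24], [0, 13, 32, 71, 49, 62, 91], [0, 10,
   61, 47, 80, 90, 26], [0, 0, 110, 22, 66, 66, 33], [0, 0, 77, 88, 22, 22, 11], [0, 0, 11, 99,
   55, 55, 88], [0, 0, 77, 88, 22, 22, 11], [0, 0, 77, 55, 44, 44, 11], [0, 0, 117, 19, 90, 35,
   67]]

lemma bInt_add_five (i : ℕ) : bInt (i + 5) = bInt i * tInt := by
  rw [bInt, bInt, baseElt, baseElt, Nat.add_mod_right, Nat.add_div_right _ (by norm_num), pow_succ,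
    mul_assoc]

lemma Approx.map_mod {M : ℤ} {N : ℕ} {A : PowerSeries ℤ} {a : List ℤ} (hA : Approx M N A a) :
    Approx M N A (a.map (· % M)) := fun n hn ↦ (hA n hn).trans (getD_map_mod M a n).symm

lemma approx_bInt {i : ℕ} (hi : i < 13) : Approx 121 67 (bInt i) (bLists.getD i []) := by
  induction i using Nat.strong_induction_on with
  | _ i ih =>
  rcases Nat.lt_or_ge i 5 with h | h
  · have h1 : ∀ r < 5, (listForm 121 67 hTwoList hThreeList r).map (· % 121) =
        bLists.getD r [] := by
      decide +kernel
    rw [bInt, baseElt, Nat.div_eq_of_lt h, Nat.mod_eq_of_lt h, pow_zero, mul_one]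
    exact (approx_hTwoInt.baseForm approx_hThreeInt i).map_mod.of_eq (h1 i h)
  · obtain ⟨k, rfl⟩ := Nat.exists_eq_add_of_le' h
    have h1 : ∀ r < 8, listMul 121 67 (bLists.getD r []) tList = bLists.getD (r + 5) [] := by
      decide +kernel
    rw [bInt_add_five]
    exact ((ih k (by omega) (by omega)).mul approx_tInt).of_eq (h1 k (by omega))

lemma approx_uInt_phiInt_mul {i : ℕ} (hi : i < 13) :
    Approx 121 7 (uInt (phiInt * bInt i)) (uPhiLists.getD i []) := by
  have h : ∀ r < 13, listU 7 (listMul 121 67 phiList (bLists.getD r [])) = uPhiLists.getD r [] := by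
    decide +kernel
  exact (approx_phiInt.mul (approx_bInt hi)).uInt.of_eq (h i hi)

/-- The coefficients of `s` are congruent to those of a combination of `bInt 1` and `bInt 2`. -/
def Combination (M x y : ℤ) (s : List ℤ) : Prop :=
  ∀ k < 7, s.getD k 0 ≡ x * (bLists.getD 1 []).getD k 0 + y * (bLists.getD 2 []).getD k 0 [ZMOD M]

instance (M x y : ℤ) (s : List ℤ) : Decidable (Combination M x y s) :=
  inferInstanceAs (Decidable (∀ _ < _, _))

lemma combination_listU_small : ∀ i < 3, 1 ≤ i →
    Combination 121 (11 * [0, 4, 10].getD i 0) (11 * 0) (listU 7 (bLists.getD i [])) := by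
  decide +kernel

lemma combination_listU : ∀ i < 13, 3 ≤ i →
    Combination 11 ([0, 0, 0, 0, 0, 0, 0, 0, 4, 6, 9, 1, 0].getD i 0) 0
      (listU 7 (bLists.getD i [])) := by
  decide +kernel

lemma combination_uPhiLists_small : ∀ i < 3,
    Combination 121 (11 * [10, 5, 2].getD i 0) (11 * [0, 0, 7].getD i 0) (uPhiLists.getD i []) := by
  decide +kernel

lemma combination_uPhiLists : ∀ i < 13, 3 ≤ i →
    Combination 11 ([0, 0, 0, 4, 6, 9, 1, 0, 0, 0, 0, 0, 0].getD i 0) (if i = 12 then 10 else 0)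
      (uPhiLists.getD i []) := by
  decide +kernel

lemma Approx.exists_combination {M x y : ℤ} (hM : M ∣ 121) {A : PowerSeries ℤ} {s : List ℤ}
    (hA : Approx 121 7 A s) (h : Combination M x y s) : ∀ k < 7, ∃ z : ℤ,
      PowerSeries.coeff k A - x * PowerSeries.coeff k (bInt 1) - y * PowerSeries.coeff k (bInt 2) =
        M * z := by
  intro k hk
  have h1 := (approx_bInt (i := 1) (by norm_num) k (by omega)).of_dvd hM
  have h2 := (approx_bInt (i := 2) (by norm_num) k (by omega)).of_dvd hM
  have h3 := (((hA k hk).of_dvd hM).trans (h k hk)).trans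
    ((h1.symm.mul_left x).add (h2.symm.mul_left y))
  obtain ⟨z, hz⟩ := h3.symm.dvd
  exact ⟨z, by linarith⟩

end

section

/-! ### A lattice on which `U` and `U ∘ φ` are divisible by `11` -/

lemma mem_of_combination {c : ℕ →₀ ℂ} {A : PowerSeries ℤ} (hA : IsExp (bSum c) (intSeries A))
    {m : ℕ} {x y : ℤ} (h : ∀ k < 7, ∃ z : ℤ, PowerSeries.coeff k A -
      x * PowerSeries.coeff k (bInt 1) - y * PowerSeries.coeff k (bInt 2) = 11 ^ m * z)
    {i : ℕ} (hi : i < 7) :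
    (11 : ℂ) ^ (-m : ℤ) * (c i - ((if i = 1 then x else 0 : ℤ) + (if i = 2 then y else 0 : ℤ))) ∈
      localRing := by
  have h1 := (hA.add ((isExp_bFun 1).const_mul (-x))).add ((isExp_bFun 2).const_mul (-y))
  have h2 := h1.congr (g := bSum (c + Finsupp.single 1 (-x : ℂ) + Finsupp.single 2 (-y : ℂ)))
    fun τ ↦ by rw [bSum_add_single, bSum_add_single]
  have h3 := mul_mem_of_isExp_bSum h2 ((11 : ℂ) ^ (-m : ℤ)) 6 (fun k hk ↦ ?_) i (by omega)
  · convert h3 using 2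
    simp only [Finsupp.add_apply, Finsupp.single_apply, eq_comm (a := i)]
    split_ifs <;> push_cast <;> ring
  · obtain ⟨z, hz⟩ := h k (by omega)
    simp only [HahnSeries.coeff_add, HahnSeries.coeff_smul, coeff_intSeries, smul_eq_mul]
    have h4 : ((PowerSeries.coeff k A : ℤ) : ℂ) + -x * (PowerSeries.coeff k (bInt 1) : ℤ) +
        -y * (PowerSeries.coeff k (bInt 2) : ℤ) = 11 ^ m * z := by
      have := congrArg (Int.cast : ℤ → ℂ) hz
      push_cast at this
      linear_combination this
    rw [h4, ← mul_assoc, zpow_neg, zpow_natCast, inv_mul_cancel₀ (pow_ne_zero _ (by norm_num)),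
      one_mul]
    exact intCast_mem_localRing z

/-- The exponent of `11` attached to the basis function `bFun i`. -/
def latticeExp (i : ℕ) : ℕ := if i ≤ 2 then 0 else max 1 ((wt i - 2) / 7)

/-- The function lies in the lattice spanned by the functions `11 ^ latticeExp i • bFun i` with
`1 ≤ i`, multiplied by `11 ^ n`. -/
def InLattice (n : ℤ) (f : ℍ → ℂ) : Prop :=
  ∃ c, f = bSum c ∧ c 0 = 0 ∧ ∀ i, (11 : ℂ) ^ (-(n + latticeExp i)) * c i ∈ localRing


lemma wt_bounds (i : ℕ) : 6 * (i / 5) ≤ wt i ∧ (7 ≤ i → 9 ≤ wt i) ∧ (13 ≤ i → 16 ≤ wt i) := by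
  have h := Nat.div_add_mod i 5
  have h' := Nat.mod_lt i (show 5 > 0 by norm_num)
  rw [wt]
  generalize i % 5 = r at *
  interval_cases r <;> simp only [baseWt] <;> omega

lemma latticeExp_of_le {i : ℕ} (h : 3 ≤ i) (h' : i ≤ 12) : latticeExp i = 1 := by
  interval_cases i <;> rfl

lemma zpow_neg_mul_mem {a b : ℤ} {x : ℂ} (h : (11 : ℂ) ^ a * x ∈ localRing) (hab : a ≤ b) :
    (11 : ℂ) ^ b * x ∈ localRing := by
  have := mul_mem (zpow_mem_localRing (sub_nonneg.mpr hab)) h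
  rwa [← mul_assoc, ← zpow_add₀ (by norm_num), sub_add_cancel] at this

lemma inLattice_one_of_combination {f : ℍ → ℂ} (hf : Adm 5 1 f) {A : PowerSeries ℤ} {s : List ℤ}
    (hA : IsExp f (intSeries A)) (hs : Approx 121 7 A s) {x y : ℤ}
    (h : Combination 121 (11 * x) (11 * y) s) : InLattice 1 f := by
  obtain ⟨c, rfl, hc0, hc⟩ := hf.exists_eq_bSum
  refine ⟨c, rfl, hc0, fun i ↦ ?_⟩
  rcases Nat.lt_or_ge i 7 with hi | hi
  · have h1 := mem_of_combination hA (m := 2) (hs.exists_combination dvd_rfl h) hi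
    rcases Nat.lt_or_ge i 3 with h3 | h3
    · rw [latticeExp, if_pos (by omega)]
      obtain ⟨z, hz⟩ : ∃ z : ℤ, ((if i = 1 then 11 * x else 0 : ℤ) +
          (if i = 2 then 11 * y else 0 : ℤ) : ℂ) = 11 * z :=
        ⟨(if i = 1 then x else 0) + (if i = 2 then y else 0), by
          split_ifs <;> push_cast <;> ring⟩
      rw [hz] at h1
      have h2 := add_mem (mul_mem (natCast_mem_localRing 11) h1) (intCast_mem_localRing z)
      convert h2 using 1
      norm_num
      ring
    · rw [if_neg (by omega), if_neg (by omega), Int.cast_zero, add_zero, sub_zero] at h1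
      rw [latticeExp_of_le h3 (by omega)]
      exact h1
  · refine zpow_neg_mul_mem (hc i) ?_
    have := (wt_bounds i).2.1 hi
    rw [latticeExp, if_neg (by omega)]
    omega

lemma inLattice_zero_of_combination {f : ℍ → ℂ} (hf : Filt 8 1 f) {A : PowerSeries ℤ}
    {s : List ℤ} (hA : IsExp f (intSeries A)) (hs : Approx 121 7 A s) {x y : ℤ}
    (h : Combination 11 x y s) : InLattice 0 f := by
  obtain ⟨c, rfl, hc0, hc⟩ := hf.exists_eq_bSum
  refine ⟨c, rfl, hc0, fun i ↦ ?_⟩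
  rw [zero_add]
  rcases Nat.lt_or_ge i 3 with h3 | h3
  · refine hc i _ fun k ↦ Or.inl ?_
    rw [latticeExp, if_pos (by omega)]
    omega
  rcases Nat.lt_or_ge i 7 with hi | hi
  · have h1 := mem_of_combination hA (m := 1)
      (hs.exists_combination (M := 11 ^ 1) (by norm_num) h) hi
    rw [if_neg (by omega), if_neg (by omega), Int.cast_zero, add_zero, sub_zero] at h1
    rw [latticeExp_of_le h3 (by omega)]
    exact h1
  · refine hc i _ fun k ↦ ?_
    have := (wt_bounds i).2.1 hi
    rw [latticeExp, if_neg (by omega)]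
    omega

variable {g : ℍ → ℂ}

lemma exists_isExp_uOp_bFun {i : ℕ} (hg : g = 1 ∧ 1 ≤ i ∨ g = phi) (hi : i < 13) :
    ∃ A s, IsExp (uOp (g * bFun i)) (intSeries A) ∧ Approx 121 7 A s ∧
      (i < 3 → ∃ x y, Combination 121 (11 * x) (11 * y) s) ∧
      (3 ≤ i → ∃ x y, Combination 11 x y s) := by
  rcases hg with ⟨rfl, hi'⟩ | rfl
  · refine ⟨_, _, ?_, (approx_bInt hi).uInt (N := 7),
      fun h ↦ ⟨_, _, combination_listU_small i h hi'⟩,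
      fun h ↦ ⟨_, _, combination_listU i hi h⟩⟩
    rw [one_mul, ← uSeries_intSeries]
    exact (isExp_bFun i).uOp
  · refine ⟨_, _, ?_, approx_uInt_phiInt_mul hi,
      fun h ↦ ⟨_, _, combination_uPhiLists_small i h⟩,
      fun h ↦ ⟨_, _, combination_uPhiLists i hi h⟩⟩
    rw [← uSeries_intSeries, map_mul, ← phiSeries_eq_intSeries]
    exact (isExp_phi.mul (isExp_bFun i)).uOp

lemma inLattice_uOp_bFun (hg : g = 1 ∨ g = phi) {i : ℕ} (hi : 1 ≤ i) :
    InLattice (1 - latticeExp i) (uOp (g * bFun i)) := by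
  rcases Nat.lt_or_ge i 13 with h13 | h13
  · obtain ⟨A, s, hA, hs, h1, h2⟩ := exists_isExp_uOp_bFun (hg.imp (⟨·, hi⟩) id) h13
    rcases Nat.lt_or_ge i 3 with h3 | h3
    · obtain ⟨x, y, h⟩ := h1 h3
      have hwt : wt i ≤ 3 := by interval_cases i <;> decide
      rw [latticeExp, if_pos (by omega)]
      exact inLattice_one_of_combination
        ((adm_bFun i).uOp_mul hg (by omega) (by norm_num) (by omega)) hA hs h
    · obtain ⟨x, y, h⟩ := h2 h3
      have hF := filt_uOp_bFun hg hi
      rw [show i / 5 / 11 = 0 by omega] at hF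
      rw [latticeExp_of_le h3 (by omega)]
      exact inLattice_zero_of_combination hF hA hs h
  · obtain ⟨c, hc1, hc0, hc⟩ := (filt_uOp_bFun hg hi).exists_eq_bSum
    refine ⟨c, hc1, hc0, fun j ↦ hc j _ fun k ↦ ?_⟩
    have hwi := wt_bounds i
    have hwi' := hwi.2.2 h13
    rw [latticeExp, latticeExp, if_neg (by omega)]
    split_ifs <;> omega

lemma inLattice_uOp_phi : InLattice 1 (uOp phi) := by
  obtain ⟨A, s, hA, hs, h1, -⟩ := exists_isExp_uOp_bFun (g := phi) (i := 0) (Or.inr rfl)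
    (by norm_num)
  obtain ⟨x, y, h⟩ := h1 (by norm_num)
  have hb : bFun 0 = 1 := by
    rw [bFun, baseElt, Nat.zero_mod, Nat.zero_div, pow_zero, mul_one]; rfl
  rw [hb, mul_one] at hA
  refine inLattice_one_of_combination ?_ hA hs h
  rw [← mul_one phi]
  exact Adm.one.uOp_phi (by norm_num) (by norm_num) (by norm_num)

namespace InLattice

variable {m n : ℤ} {f : ℍ → ℂ}

lemma add {f' : ℍ → ℂ} (hf : InLattice n f) (hf' : InLattice n f') : InLattice n (f + f') := by
  obtain ⟨c, rfl, hc0, hc⟩ := hf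
  obtain ⟨c', rfl, hc0', hc'⟩ := hf'
  refine ⟨c + c', (bSum_add c c').symm, by simp [hc0, hc0'], fun i ↦ ?_⟩
  rw [Finsupp.add_apply, mul_add]
  exact add_mem (hc i) (hc' i)

lemma zero : InLattice n 0 :=
  ⟨0, by ext; rfl, rfl, fun i ↦ by rw [Finsupp.zero_apply, mul_zero]; exact zero_mem _⟩

lemma smul {x : ℂ} (hx : (11 : ℂ) ^ (-m) * x ∈ localRing) (hf : InLattice n f) :
    InLattice (m + n) (x • f) := by
  obtain ⟨c, rfl, hc0, hc⟩ := hf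
  refine ⟨x • c, (bSum_smul x c).symm, by simp [hc0], fun i ↦ ?_⟩
  have := mul_mem hx (hc i)
  rwa [mul_mul_mul_comm, ← zpow_add₀ (by norm_num), ← neg_add, ← add_assoc] at this

lemma uOp_mul (hg : g = 1 ∨ g = phi) (hf : InLattice n f) :
    InLattice (n + 1) (RamanujanEleven.uOp (g * f)) := by
  obtain ⟨c, rfl, hc0, hc⟩ := hf
  have h : RamanujanEleven.uOp (g * bSum c) =
      ∑ i ∈ c.support, c i • RamanujanEleven.uOp (g * bFun i) := by
    ext τ
    simp only [RamanujanEleven.uOp, Finset.sum_apply, Pi.smul_apply, Pi.mul_apply, bSum,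
      Finsupp.sum, Finset.mul_sum, smul_eq_mul]
    rw [Finset.sum_comm]
    exact Finset.sum_congr rfl fun i _ ↦ Finset.sum_congr rfl fun b _ ↦ by ring
  rw [h]
  refine Finset.sum_induction _ (InLattice (n + 1)) (fun _ _ h h' ↦ h.add h') zero fun i hi ↦ ?_
  have hi0 : 1 ≤ i := Nat.one_le_iff_ne_zero.mpr fun h0 ↦ by
    rw [h0, Finsupp.mem_support_iff] at hi
    exact hi hc0
  have := (inLattice_uOp_bFun hg hi0).smul (hc i)
  rwa [show n + latticeExp i + (1 - latticeExp i) = n + 1 by ring] at this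

/-- The expansion at `∞` of an element of `11 ^ n` times the lattice is divisible by `11 ^ n`. -/
lemma dvd_coeff {n : ℕ} (hf : InLattice n f) {A : PowerSeries ℤ} (hA : IsExp f (intSeries A))
    (k : ℕ) : 11 ^ n ∣ PowerSeries.coeff k A := by
  obtain ⟨c, rfl, -, hc⟩ := hf
  have h := congrArg (HahnSeries.coeff · (k : ℤ)) (hA.unique (isExp_bSum c))
  simp only [coeff_bSum, coeff_intSeries] at h
  refine pow_dvd_of_eq_mul_localRing (x := ∑ i ∈ c.support,
    (11 : ℂ) ^ (-n : ℤ) * c i * (PowerSeries.coeff k (bInt i) : ℤ))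
    (sum_mem fun i _ ↦ mul_mem (zpow_neg_mul_mem (hc i) (by omega)) (intCast_mem_localRing _)) ?_
  rw [h, Finset.mul_sum]
  refine Finset.sum_congr rfl fun i _ ↦ ?_
  rw [zpow_neg, zpow_natCast, mul_assoc, mul_inv_cancel_left₀ (pow_ne_zero _ (by norm_num))]

end InLattice

end

section

/-! ### The partition function -/

lemma coeff_vInt_mul_elevenMul (B : PowerSeries ℤ) (n : ℕ) :
    PowerSeries.coeff (11 * n) (vInt B) = PowerSeries.coeff n B := by
  rw [vInt, PowerSeries.coeff_mk, if_pos (dvd_mul_right _ _),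
    Nat.mul_div_cancel_left _ (by norm_num)]

lemma uInt_vInt_mul (A B : PowerSeries ℤ) : uInt (vInt B * A) = B * uInt A := by
  ext n
  rw [uInt, PowerSeries.coeff_mk, PowerSeries.coeff_mul, PowerSeries.coeff_mul]
  symm
  refine Finset.sum_of_injOn (fun p ↦ (11 * p.1, 11 * p.2)) ?_ ?_ ?_ ?_
  · rintro ⟨a, b⟩ - ⟨c, d⟩ - h
    simp only [Prod.mk.injEq] at h ⊢
    omega
  · rintro ⟨a, b⟩ h
    simp only [Finset.mem_coe, Finset.HasAntidiagonal.mem_antidiagonal] at h ⊢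
    omega
  · rintro ⟨a, b⟩ h h'
    rw [Finset.HasAntidiagonal.mem_antidiagonal] at h
    rw [vInt, PowerSeries.coeff_mk, if_neg, zero_mul]
    rintro ⟨a, rfl⟩
    refine h' ⟨(a, n - a), ?_, ?_⟩
    · simp only [Finset.mem_coe, Finset.HasAntidiagonal.mem_antidiagonal]
      omega
    · simp only [Prod.mk.injEq, true_and]
      omega
  · rintro ⟨a, b⟩ -
    rw [coeff_vInt_mul_elevenMul, uInt, PowerSeries.coeff_mk]

lemma dvd_coeff_of_mul {d : ℤ} {A w : PowerSeries ℤ} (hw : PowerSeries.constantCoeff w = 1)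
    (h : ∀ k, d ∣ PowerSeries.coeff k (w * A)) (k : ℕ) : d ∣ PowerSeries.coeff k A := by
  have hA : A = PowerSeries.invOfUnit w 1 * (w * A) := by
    rw [← mul_assoc, mul_comm _ w, PowerSeries.mul_invOfUnit w 1 (by simpa using hw), one_mul]
  rw [hA, PowerSeries.coeff_mul]
  exact Finset.dvd_sum fun p _ ↦ (h p.2).mul_left _

/-- The generating functions of the values of the partition function on the residue classes
`24 n ≡ 1 [MOD 11 ^ j]`. -/
noncomputable def progSeries : ℕ → PowerSeries ℤ
  | 0 => eInvInt
  | j + 1 => uInt (PowerSeries.X ^ (if Even j then 5 else 0) * progSeries j)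

lemma uInt_phiInt_mul (A : PowerSeries ℤ) :
    uInt (phiInt * (eInt * A)) = vInt eInt * uInt (PowerSeries.X ^ 5 * A) := by
  rw [← uInt_vInt_mul]
  congr 1
  rw [phiInt]
  linear_combination
    (PowerSeries.X ^ 5 * vInt (vInt eInt) * A) * eInt_mul_eInvInt

lemma exists_inLattice_isExp_progSeries (j : ℕ) : ∃ f, InLattice (j + 1 : ℕ) f ∧
    IsExp f (intSeries ((if Even j then vInt eInt else eInt) * progSeries (j + 1))) := by
  induction j with
  | zero =>
    refine ⟨uOp phi, inLattice_uOp_phi, ?_⟩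
    rw [if_pos Even.zero, progSeries, if_pos Even.zero, progSeries, ← uInt_phiInt_mul,
      eInt_mul_eInvInt, mul_one, ← uSeries_intSeries, ← phiSeries_eq_intSeries]
    exact isExp_phi.uOp
  | succ j ih =>
    obtain ⟨f, hf, hA⟩ := ih
    rw [progSeries]
    rcases Nat.even_or_odd j with hj | hj
    · rw [if_pos hj] at hA
      have hj' : ¬ Even (j + 1) := Nat.not_even_iff_odd.2 hj.add_one
      refine ⟨uOp (1 * f), ?_, ?_⟩
      · rw [Nat.cast_add_one (j + 1)]
        exact hf.uOp_mul (Or.inl rfl)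
      · rw [if_neg hj', if_neg hj', pow_zero, one_mul, one_mul, ← uInt_vInt_mul,
          ← uSeries_intSeries]
        exact hA.uOp
    · rw [if_neg (Nat.not_even_iff_odd.2 hj)] at hA
      have hj' : Even (j + 1) := hj.add_one
      refine ⟨uOp (phi * f), ?_, ?_⟩
      · rw [Nat.cast_add_one (j + 1)]
        exact hf.uOp_mul (Or.inr rfl)
      · rw [if_pos hj', if_pos hj', ← uInt_phiInt_mul, ← uSeries_intSeries, map_mul,
          ← phiSeries_eq_intSeries]
        exact (isExp_phi.mul hA).uOp

lemma constantCoeff_eInt : PowerSeries.constantCoeff eInt = 1 := by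
  have := PowerSeries.coeff_pentagonalSeries_pentagonal (R := ℤ) 0
  simpa [pentagonal, eInt] using this

lemma dvd_coeff_progSeries (j k : ℕ) :
    (11 : ℤ) ^ (j + 1) ∣ PowerSeries.coeff k (progSeries (j + 1)) := by
  obtain ⟨f, hf, hA⟩ := exists_inLattice_isExp_progSeries j
  refine dvd_coeff_of_mul ?_ (hf.dvd_coeff hA) k
  split_ifs
  · rw [← PowerSeries.coeff_zero_eq_constantCoeff_apply, ← mul_zero 11, coeff_vInt_mul_elevenMul,
      PowerSeries.coeff_zero_eq_constantCoeff_apply, constantCoeff_eInt]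
  · exact constantCoeff_eInt

lemma exists_coeff_progSeries (j : ℕ) {n : ℕ} (h : (11 : ℤ) ^ j ∣ 24 * n - 1) :
    ∃ m : ℕ, PowerSeries.coeff m (progSeries j) = PowerSeries.coeff n eInvInt ∧
      (24 * n - 1 : ℤ) = 11 ^ j * (24 * m - if Even j then 1 else 11) := by
  induction j with
  | zero => exact ⟨n, rfl, by simp⟩
  | succ j ih =>
    obtain ⟨m, hm, hmn⟩ := ih ((pow_dvd_pow _ j.le_succ).trans h)
    rw [hmn, pow_succ] at h
    have h11 := Int.dvd_of_mul_dvd_mul_left (by positivity) h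
    rw [hmn, pow_succ]
    rcases Nat.even_or_odd j with hj | hj
    · rw [if_pos hj] at h11 ⊢
      rw [if_neg (Nat.not_even_iff_odd.2 hj.add_one)]
      obtain ⟨m', hm'⟩ : 11 ∣ m + 5 := by omega
      refine ⟨m', ?_, ?_⟩
      · rw [progSeries, if_pos hj, uInt, PowerSeries.coeff_mk, ← hm', PowerSeries.coeff_X_pow_mul,
          hm]
      · have : (m : ℤ) = 11 * m' - 5 := by omega
        rw [this]
        ring
    · have hj' := Nat.not_even_iff_odd.2 hj
      rw [if_neg hj'] at h11 ⊢
      rw [if_pos hj.add_one]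
      obtain ⟨m', rfl⟩ : 11 ∣ m := by omega
      refine ⟨m', ?_, ?_⟩
      · rw [progSeries, if_neg hj', pow_zero, one_mul, uInt, PowerSeries.coeff_mk, hm]
      · push_cast
        ring

open PowerSeries.WithPiTopology in
lemma eInt_mul_mk_partp : eInt * PowerSeries.mk (fun n ↦ (partp n : ℤ)) = 1 := by
  have h1 := hasProd_one_sub_X_pow ℤ
  have h2 := Nat.Partition.hasProd_powerSeriesMk_card_restricted ℤ fun _ ↦ True
  have h3 := (h1.mul h2).unique (a₂ := 1) ?_
  · rw [← h3, eInt]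
    congr 2
    ext n
    simp [partp, Nat.Partition.restricted]
  · convert! hasProd_one using 2 with i
    rw [if_pos trivial]
    simp_rw [pow_mul]
    exact one_sub_mul_tsum_pow_of_constantCoeff_eq_zero (by simp)

lemma coeff_eInvInt (n : ℕ) : PowerSeries.coeff n eInvInt = partp n := by
  rw [left_inv_eq_right_inv ((mul_comm _ _).trans eInt_mul_eInvInt) eInt_mul_mk_partp,
    PowerSeries.coeff_mk]

end

end RamanujanEleven

open RamanujanEleven

theorem stmt7 (n j : ℕ) (hj : 1 ≤ j) (h : 24 * n ≡ 1 [MOD 11 ^ j]) :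
    11 ^ j ∣ partp n := by
  obtain ⟨j, rfl⟩ := Nat.exists_eq_add_of_le' hj
  obtain ⟨m, hm, -⟩ := exists_coeff_progSeries (j + 1) (n := n) <| by
    simpa using (Nat.modEq_iff_dvd.1 h.symm)
  have := dvd_coeff_progSeries j m
  rw [hm, coeff_eInvInt] at this
  exact_mod_cast this
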